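/- arXiv:1405.0912 — 4 statements merged into one kernel-verified Lean document; each statement's English description precedes it below -/
import Mathlib

section
/- Every subgroup of the group Diff^ω_+([0,1]) of orientation-preserving real-analytic diffeomorphisms of the interval that satisfies a nontrivial group law is solvable. -/
/-- An element of the group of order-isomorphisms of `[0,1]` (equivalently, an
orientation-preserving homeomorphism of `[0,1]`, automatically fixing `0` and `1`)
is an orientation-preserving real-analytic diffeomorphism of `[0,1]` if both it and
its inverse extend to functions that are real-analytic on a neighborhood of `[0,1]`
with nowhere-vanishing derivative on `[0,1]`. -/
def IsAnalyticDiffeo (σ : ↥(Set.Icc (0:ℝ) 1) ≃o ↥(Set.Icc (0:ℝ) 1)) : Prop :=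
  ∃ F G : ℝ → ℝ,
    AnalyticOnNhd ℝ F (Set.Icc 0 1) ∧ AnalyticOnNhd ℝ G (Set.Icc 0 1) ∧
    (∀ x ∈ Set.Icc (0:ℝ) 1, deriv F x ≠ 0) ∧ (∀ x ∈ Set.Icc (0:ℝ) 1, deriv G x ≠ 0) ∧
    (∀ x : ↥(Set.Icc (0:ℝ) 1), (σ x : ℝ) = F x) ∧
    (∀ x : ↥(Set.Icc (0:ℝ) 1), (σ.symm x : ℝ) = G x)

/-- A group satisfies a nontrivial law if for some `n ≥ 1` there is a nontrivial
element `w` of the free group on `n` generators killed by every homomorphism to the group. -/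
def SatisfiesLaw (G : Type*) [Group G] : Prop :=
  ∃ n : ℕ, 1 ≤ n ∧ ∃ w : FreeGroup (Fin n), w ≠ 1 ∧ ∀ φ : FreeGroup (Fin n) →* G, φ w = 1

open Filter Topology

namespace AnLaw

abbrev II := ↥(Set.Icc (0:ℝ) 1)

lemma pos_of_ne {x : II} (hx : x ≠ 0) : (0:ℝ) < x :=
  lt_of_le_of_ne x.2.1 (fun h => hx (Subtype.ext h.symm))

lemma map_zero (h : II ≃o II) : h 0 = 0 := by
  have := h.map_bot
  exact this

lemma map_ne (h : II ≃o II) {x : II} (hx : x ≠ 0) : h x ≠ 0 := by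
  intro h0
  exact hx (h.injective (h0.trans (map_zero h).symm))

lemma tends (h : II ≃o II) : Tendsto h (𝓝[≠] (0:II)) (𝓝[≠] (0:II)) := by
  apply tendsto_nhdsWithin_of_tendsto_nhds_of_eventually_within
  · have := h.continuous.tendsto 0
    rw [map_zero] at this
    exact this.mono_left nhdsWithin_le_nhds
  · filter_upwards [self_mem_nhdsWithin] with x hx
    exact map_ne h hx

lemma coe_tends : Tendsto (fun x : II => (x:ℝ)) (𝓝[≠] (0:II)) (𝓝 0) := by
  have := (continuous_subtype_val (p := fun x => x ∈ Set.Icc (0:ℝ) 1)).tendsto 0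
  exact this.mono_left nhdsWithin_le_nhds

lemma coe_tends' : Tendsto (fun x : II => (x:ℝ)) (𝓝[≠] (0:II)) (𝓝[>] 0) := by
  apply tendsto_nhdsWithin_of_tendsto_nhds_of_eventually_within _ coe_tends
  filter_upwards [self_mem_nhdsWithin] with x hx
  exact pos_of_ne hx

instance : (𝓝[≠] (0:II)).NeBot := by
  rw [← mem_closure_iff_nhdsWithin_neBot]
  rw [mem_closure_iff_seq_limit]
  refine ⟨fun n => ⟨1/((n:ℝ)+1), by positivity, ?_⟩, ?_, ?_⟩
  · rw [div_le_one (by positivity)]; linarith [n.cast_nonneg (α := ℝ)]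
  · intro n h
    have := congrArg Subtype.val (Set.mem_singleton_iff.1 h)
    have h2 : 1/((n:ℝ)+1) = 0 := this
    have : 0 < 1/((n:ℝ)+1) := by positivity
    linarith
  · rw [tendsto_subtype_rng]
    exact tendsto_one_div_add_atTop_nhds_zero_nat

/-- derivative at `0`. -/
def dl (h : II ≃o II) (l : ℝ) : Prop :=
  Tendsto (fun x : II => (h x : ℝ) / x) (𝓝[≠] (0:II)) (𝓝 l)

/-- `h x = x + a x^(k+1) + o(x^(k+1))`. -/
def ord (k : ℕ) (h : II ≃o II) (a : ℝ) : Prop :=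
  Tendsto (fun x : II => ((h x : ℝ) - x) / (x:ℝ)^(k+1)) (𝓝[≠] (0:II)) (𝓝 a)

lemma dl_mul {f g : II ≃o II} {a b : ℝ} (hf : dl f a) (hg : dl g b) : dl (f * g) (a * b) := by
  have := (Tendsto.comp hf (tends g)).mul hg
  refine this.congr' ?_
  filter_upwards [self_mem_nhdsWithin] with x hx
  have h1 := pos_of_ne hx
  have h2 := pos_of_ne (map_ne g hx)
  have : (f * g) x = f (g x) := rfl
  simp only [Function.comp, this]
  field_simp

lemma dl_one : dl 1 1 := by
  refine tendsto_const_nhds.congr' ?_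
  filter_upwards [self_mem_nhdsWithin] with x hx
  have h1 := pos_of_ne hx
  have : (1 : II ≃o II) x = x := rfl
  rw [this]; field_simp

lemma dl_of_ord {k : ℕ} (hk : 1 ≤ k) {f : II ≃o II} {a : ℝ} (hf : ord k f a) : dl f 1 := by
  have h1 := ((coe_tends.pow k).mul hf).add_const 1
  rw [zero_pow (by omega), zero_mul, zero_add] at h1
  refine h1.congr' ?_
  filter_upwards [self_mem_nhdsWithin] with x hx
  have h1 := pos_of_ne hx
  field_simp
  ring

lemma ord_mul {k : ℕ} (hk : 1 ≤ k) {f g : II ≃o II} {a b : ℝ} (hf : ord k f a) (hg : ord k g b) :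
    ord k (f * g) (a + b) := by
  have h1 := ((Tendsto.comp hf (tends g)).mul ((dl_of_ord hk hg).pow (k+1))).add hg
  rw [one_pow, mul_one] at h1
  refine h1.congr' ?_
  filter_upwards [self_mem_nhdsWithin] with x hx
  have h1 := pos_of_ne hx
  have h2 := pos_of_ne (map_ne g hx)
  have : (f * g) x = f (g x) := rfl
  simp only [Function.comp, this]
  simp only [div_pow, inv_pow, inv_div]
  field_simp
  ring

lemma ord_inv {k : ℕ} (hk : 1 ≤ k) {f : II ≃o II} {a : ℝ} (hf : ord k f a) :
    ord k f⁻¹ (-a) := by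
  have h1 := (hf.mul (((dl_of_ord hk hf).inv₀ one_ne_zero).pow (k+1))).neg
  rw [inv_one, one_pow, mul_one] at h1
  have h2 := h1.comp (tends f⁻¹)
  refine h2.congr' ?_
  filter_upwards [self_mem_nhdsWithin] with x hx
  have h1 := pos_of_ne hx
  have h2 := pos_of_ne (map_ne f⁻¹ hx)
  have : f (f⁻¹ x) = x := RelIso.apply_inv_self f x
  simp only [Function.comp, this]
  simp only [div_pow, inv_pow, inv_div]
  field_simp
  ring

lemma ord_comm {k : ℕ} (hk : 1 ≤ k) {f g : II ≃o II} {a b : ℝ} (hf : ord k f a) (hg : ord k g b) :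
    ord k ((f * g) * (g * f)⁻¹) 0 := by
  have h1 := ord_mul hk hf hg
  have h2 := ord_inv hk (ord_mul hk hg hf)
  have h3 := ord_mul hk h1 h2
  have h4 : (a + b) + -(b + a) = 0 := by ring
  rw [h4] at h3
  exact h3

lemma dl_of_analytic {f : II ≃o II} (hf : IsAnalyticDiffeo f) : ∃ l, dl f l := by
  obtain ⟨F, G, hF, hG, hF', hG', h1, h2⟩ := hf
  have hF0 : F 0 = 0 := by
    have := h1 0
    rw [map_zero] at this
    exact this.symm
  have hd := (hF 0 ⟨le_rfl, zero_le_one⟩).differentiableAt.hasDerivAt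
  rw [hasDerivAt_iff_tendsto_slope] at hd
  refine ⟨deriv F 0, ?_⟩
  have h3 := hd.comp (coe_tends'.mono_right (nhdsWithin_mono _ (fun x (hx : 0 < x) => hx.ne')))
  refine h3.congr' ?_
  filter_upwards [self_mem_nhdsWithin] with x hx
  simp only [Function.comp, slope_def_field, hF0, h1 x, sub_zero]

lemma ord_of_analytic {f : II ≃o II} (hf : IsAnalyticDiffeo f) (hd : dl f 1) (hne : f ≠ 1) :
    ∃ k : ℕ, 1 ≤ k ∧ ∃ a : ℝ, a ≠ 0 ∧ ord k f a := by
  obtain ⟨F, G, hF, hG, hF', hG', h1, h2⟩ := hf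
  have hF0 : F 0 = 0 := by
    have := h1 0
    rw [map_zero] at this
    exact this.symm
  have han : AnalyticAt ℝ (fun x => F x - x) 0 := (hF 0 ⟨le_rfl, zero_le_one⟩).sub analyticAt_id
  have hnz : ¬∀ᶠ (z : ℝ) in 𝓝 0, F z - z = 0 := by
    intro hz
    apply hne
    have := hF.eqOn_of_preconnected_of_eventuallyEq (g := fun x => x) (fun x _ => analyticAt_id)
      isPreconnected_Icc (z₀ := 0) ⟨le_rfl, zero_le_one⟩
      (by filter_upwards [hz] with x hx; linarith)
    ext x
    rw [h1 x, this x.2]; rfl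
  obtain ⟨n, g, hg, hg0, hn⟩ := han.exists_eventuallyEq_pow_smul_nonzero_iff.2 hnz
  have hl : Tendsto (fun x : II => ((f x : ℝ) - x)/(x:ℝ)^n) (𝓝[≠] (0:II)) (𝓝 (g 0)) := by
    have h3 : Tendsto (fun x : II => g x) (𝓝[≠] (0:II)) (𝓝 (g 0)) :=
      hg.continuousAt.tendsto.comp coe_tends
    refine h3.congr' ?_
    filter_upwards [self_mem_nhdsWithin, coe_tends.eventually hn] with x hx h4
    have := pos_of_ne hx
    rw [h1 x, h4, sub_zero, smul_eq_mul]
    field_simp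
  have hlow : Tendsto (fun x : II => ((f x : ℝ) - x)/(x:ℝ)) (𝓝[≠] (0:II)) (𝓝 0) := by
    have := hd.sub_const 1
    rw [sub_self] at this
    refine this.congr' ?_
    filter_upwards [self_mem_nhdsWithin] with x hx
    have := pos_of_ne hx
    field_simp
  rcases n with _ | _ | k
  · exfalso
    apply hg0
    have := hlow.mul coe_tends
    rw [mul_zero] at this
    refine tendsto_nhds_unique hl (this.congr' ?_)
    filter_upwards [self_mem_nhdsWithin] with x hx
    have := pos_of_ne hx
    field_simp
  · exfalso
    apply hg0
    refine tendsto_nhds_unique hl (hlow.congr' ?_)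
    filter_upwards [self_mem_nhdsWithin] with x hx
    simp
  · exact ⟨k+1, by omega, g 0, hg0, hl⟩

lemma solvable_of_same (Γ : Subgroup (II ≃o II)) (hΓ : ∀ f ∈ Γ, IsAnalyticDiffeo f) (k : ℕ)
    (hk : 1 ≤ k) (h : ∀ f ∈ Γ, dl f 1 → f ≠ 1 → ∃ a : ℝ, a ≠ 0 ∧ ord k f a) : Group.IsSolvable Γ := by
  choose D hD using fun f : Γ => dl_of_analytic (hΓ f f.2)
  let D' : Γ →* ℝ :=
    { toFun := D
      map_one' := tendsto_nhds_unique (hD 1) dl_one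
      map_mul' := fun f g => tendsto_nhds_unique (hD (f * g)) (dl_mul (hD f) (hD g)) }
  let E := D'.toHomUnits
  have hE : ∀ f : Γ, E f = 1 → dl f 1 := by
    intro f hf
    have : D f = 1 := congrArg Units.val hf
    have h2 := hD f
    rw [this] at h2
    exact h2
  have hord : ∀ f ∈ Γ, dl f 1 → ∃ a : ℝ, ord k f a := by
    intro f hf h1
    by_cases hf1 : f = 1
    · refine ⟨0, ?_⟩
      rw [hf1]
      refine tendsto_const_nhds.congr' ?_
      filter_upwards with x
      have : (1 : II ≃o II) x = x := rfl
      rw [this]; simp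
    · obtain ⟨a, -, ha⟩ := h f hf h1 hf1
      exact ⟨a, ha⟩
  have hcomm : ∀ a b : E.ker, a * b = b * a := by
    intro x y
    obtain ⟨a, ha⟩ := hord x.1.1 x.1.2 (hE _ x.2)
    obtain ⟨b, hb⟩ := hord y.1.1 y.1.2 (hE _ y.2)
    have h0 := ord_comm hk ha hb
    have hm : (x.1.1 * y.1.1) * (y.1.1 * x.1.1)⁻¹ ∈ Γ :=
      Γ.mul_mem (Γ.mul_mem x.1.2 y.1.2) (Γ.inv_mem (Γ.mul_mem y.1.2 x.1.2))
    have h1 : (x.1.1 * y.1.1) * (y.1.1 * x.1.1)⁻¹ = 1 := by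
      by_contra hne
      obtain ⟨c, hc, hc'⟩ := h _ hm (dl_of_ord hk h0) hne
      exact hc (tendsto_nhds_unique hc' h0)
    exact Subtype.ext (Subtype.ext (mul_inv_eq_one.1 h1))
  have : Group.IsSolvable E.ker := Group.isSolvable_of_comm hcomm
  exact Group.isSolvable_of_ker_le_range E.ker.subtype E (by simp)

/-- continuous convergence of rescaled maps at `y`, in the coordinate `y = 1 / (N x)`. -/
def Conv (γ : ℕ → II ≃o II) (y z : ℝ) : Prop :=
  ∀ p : ℕ → II, Tendsto (fun N : ℕ => ((N:ℝ) * p N)⁻¹) atTop (𝓝 y) →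
    Tendsto (fun N : ℕ => ((N:ℝ) * (γ N (p N)))⁻¹) atTop (𝓝 z)

lemma Conv.mul {γ δ : ℕ → II ≃o II} {y z w : ℝ} (h1 : Conv δ z w) (h2 : Conv γ y z) :
    Conv (fun N => δ N * γ N) y w := fun p hp => h1 _ (h2 p hp)

lemma conv_one (y : ℝ) : Conv (fun _ => 1) y y := fun _ hp => hp

lemma conv_one_unique {y z : ℝ} (hy : 0 < y) (h : Conv (fun _ => 1) y z) : z = y := by
  let p : ℕ → II := fun N => ⟨min 1 ((N:ℝ) * y)⁻¹, le_min zero_le_one (by positivity), min_le_left _ _⟩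
  have hp : Tendsto (fun N : ℕ => ((N:ℝ) * p N)⁻¹) atTop (𝓝 y) := by
    refine tendsto_const_nhds.congr' ?_
    have h1 : Tendsto (fun N : ℕ => (N:ℝ) * y) atTop atTop :=
      tendsto_natCast_atTop_atTop.atTop_mul_const hy
    filter_upwards [h1.eventually_ge_atTop 1, eventually_gt_atTop 0] with N hN hN0
    have h2 : ((N:ℝ) * y)⁻¹ ≤ 1 := inv_le_one_of_one_le₀ hN
    have h3 : (p N : ℝ) = ((N:ℝ) * y)⁻¹ := min_eq_right h2
    have : (0:ℝ) < N := by exact_mod_cast hN0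
    rw [h3]; field_simp
  exact tendsto_nhds_unique (h p hp) hp

/-- displacement in the coordinate `x^(-k)`. -/
lemma disp {k : ℕ} (hk : 1 ≤ k) {h : II ≃o II} {a : ℝ} (hh : ord k h a) :
    Tendsto (fun x : II => ((h x : ℝ)^k)⁻¹ - ((x:ℝ)^k)⁻¹) (𝓝[≠] (0:II)) (𝓝 (-(k * a))) := by
  have hd := dl_of_ord hk hh
  have h1 : Tendsto (fun x : II => -(∑ i ∈ Finset.range k, ((h x : ℝ)/x)^i * 1^(k-1-i)) *
      (((h x : ℝ) - x) / (x:ℝ)^(k+1)) * (((h x : ℝ)/x)^k)⁻¹) (𝓝[≠] (0:II))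
      (𝓝 (-(∑ i ∈ Finset.range k, (1:ℝ)^i * 1^(k-1-i)) * a * ((1:ℝ)^k)⁻¹)) := by
    refine Tendsto.mul (Tendsto.mul (Tendsto.neg ?_) hh) ((hd.pow k).inv₀ (by simp))
    exact tendsto_finsetSum _ (fun i _ => (hd.pow i).mul_const _)
  have h2 : -(∑ i ∈ Finset.range k, (1:ℝ)^i * 1^(k-1-i)) * a * ((1:ℝ)^k)⁻¹ = -(k * a) := by simp
  rw [h2] at h1
  refine h1.congr' ?_
  filter_upwards [self_mem_nhdsWithin] with x hx
  have h1 := pos_of_ne hx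
  have h2 := pos_of_ne (map_ne h hx)
  have h3 := (Commute.one_right ((h x : ℝ)/x)).geom_sum₂_mul k
  have h4 : ((h x : ℝ) - x) / (x:ℝ)^(k+1) = ((h x : ℝ)/x - 1) / (x:ℝ)^k := by
    field_simp
    ring
  rw [h4, neg_mul, ← mul_div_assoc, h3, one_pow, div_pow]
  field_simp
  ring

lemma iter_nat {k : ℕ} (hk : 1 ≤ k) {h : II ≃o II} {c ε ρ : ℝ} (hρ : 0 < ρ) (hε : 0 ≤ ε)
    (H : ∀ x : II, x ≠ 0 → (x:ℝ) < ρ → |((h x : ℝ)^k)⁻¹ - ((x:ℝ)^k)⁻¹ - c| ≤ ε)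
    (x : II) (hx : x ≠ 0) (n : ℕ) (hn : (ρ^k)⁻¹ < ((x:ℝ)^k)⁻¹ - n * (|c| + ε)) :
    |(((h^n) x : ℝ)^k)⁻¹ - ((x:ℝ)^k)⁻¹ - n * c| ≤ n * ε := by
  induction n with
  | zero => simp
  | succ n ih =>
    push_cast at hn ⊢
    have h0 : 0 ≤ |c| + ε := by positivity
    have h1 := ih (by nlinarith)
    have hpow : (h^(n+1)) x = h ((h^n) x) := by rw [pow_succ']; rfl
    have hne : (h^n) x ≠ 0 := map_ne _ hx
    have hpos := pos_of_ne hne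
    have hsm : ((h^n) x : ℝ) < ρ := by
      have h2 : (ρ^k)⁻¹ < (((h^n) x : ℝ)^k)⁻¹ := by
        have h3 := (abs_le.1 h1).1
        have h4 := neg_abs_le c
        have h5 : (n:ℝ) * (-|c|) ≤ n * c := mul_le_mul_of_nonneg_left h4 (by positivity)
        nlinarith
      have h3 := (inv_lt_inv₀ (by positivity) (by positivity)).1 h2
      exact lt_of_pow_lt_pow_left₀ k hρ.le h3
    have h2 := H _ hne hsm
    rw [hpow]
    calc _ = |(((h ((h^n) x) : ℝ)^k)⁻¹ - (((h^n) x : ℝ)^k)⁻¹ - c) +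
          ((((h^n) x : ℝ)^k)⁻¹ - ((x:ℝ)^k)⁻¹ - n * c)| := by congr 1; ring
      _ ≤ ε + n * ε := (abs_add_le _ _).trans (add_le_add h2 h1)
      _ = _ := by ring

lemma near {k : ℕ} (hk : 1 ≤ k) {h : II ≃o II} {a : ℝ} (hh : ord k h a) {ε : ℝ} (hε : 0 < ε) :
    ∃ ρ > 0, ∀ x : II, x ≠ 0 → (x:ℝ) < ρ →
      |((h x : ℝ)^k)⁻¹ - ((x:ℝ)^k)⁻¹ - (-(k * a))| ≤ ε := by
  have h1 := (Metric.tendsto_nhds.1 (disp hk hh)) ε hε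
  rw [eventually_nhdsWithin_iff, Metric.eventually_nhds_iff] at h1
  obtain ⟨ρ, hρ, h2⟩ := h1
  refine ⟨ρ, hρ, fun x hx hxρ => ?_⟩
  have h3 := h2 (y := x) (by
    have : dist x 0 = |(x:ℝ) - 0| := rfl
    rw [this, sub_zero, abs_of_pos (pos_of_ne hx)]; exact hxρ) hx
  rw [Real.dist_eq] at h3
  exact h3.le

lemma iter_int {k : ℕ} (hk : 1 ≤ k) {h : II ≃o II} {a : ℝ} (hh : ord k h a) {ε : ℝ} (hε : 0 < ε) :
    ∃ R : ℝ, ∀ x : II, x ≠ 0 → ∀ m : ℤ, R < ((x:ℝ)^k)⁻¹ - |(m:ℝ)| * (|k * a| + ε) →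
    |(((h^m) x : ℝ)^k)⁻¹ - ((x:ℝ)^k)⁻¹ - m * (-(k * a))| ≤ |(m:ℝ)| * ε := by
  obtain ⟨ρ, hρ, H⟩ := near hk hh hε
  obtain ⟨ρ', hρ', H'⟩ := near hk (ord_inv hk hh) hε
  refine ⟨max (ρ^k)⁻¹ (ρ'^k)⁻¹, fun x hx m hm => ?_⟩
  rw [max_lt_iff] at hm
  rcases Int.eq_nat_or_neg m with ⟨n, rfl | rfl⟩
  · have := iter_nat hk hρ hε.le H x hx n (by
      have := hm.1
      simpa [abs_mul] using this)
    simpa using this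
  · have := iter_nat hk hρ' hε.le H' x hx n (by
      have := hm.2
      simpa [abs_mul] using this)
    simpa using this

noncomputable def S (k : ℕ) (c y : ℝ) : ℝ := (y^k + c) ^ ((k:ℝ)⁻¹)

lemma conv_S {k : ℕ} (hk : 1 ≤ k) {h : II ≃o II} {a : ℝ} (hh : ord k h a) (m : ℕ → ℤ) {c y : ℝ}
    (hm : Tendsto (fun N : ℕ => (m N : ℝ) / (N:ℝ)^k) atTop (𝓝 (c / (-(k * a))))) (ha : a ≠ 0)
    (hy : 0 < y) (hc : |c| < y^k) : Conv (fun N => h ^ (m N)) y (S k c y) := by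
  intro p hp
  have hk0 : (0:ℝ) < k := by exact_mod_cast hk
  have hka : 0 < |k * a| := abs_pos.2 (mul_ne_zero hk0.ne' ha)
  have hpk : Tendsto (fun N : ℕ => (((p N : ℝ))^k)⁻¹ / (N:ℝ)^k) atTop (𝓝 (y^k)) := by
    refine (hp.pow k).congr (fun N => ?_)
    rw [inv_pow, mul_pow, mul_inv, div_eq_mul_inv, mul_comm]
  have hNk : Tendsto (fun N : ℕ => (N:ℝ)^k) atTop atTop :=
    (tendsto_pow_atTop (by omega)).comp tendsto_natCast_atTop_atTop
  have hpne : ∀ᶠ N : ℕ in atTop, p N ≠ 0 := by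
    filter_upwards [hp.eventually (lt_mem_nhds hy)] with N hN h0
    rw [h0] at hN
    simp at hN
  set q : ℕ → ℝ := fun N => ((((h ^ (m N)) (p N) : ℝ))^k)⁻¹ with hq
  have hdiff : Tendsto (fun N : ℕ => q N / (N:ℝ)^k - ((((p N : ℝ))^k)⁻¹ / (N:ℝ)^k) -
      ((m N : ℝ) / (N:ℝ)^k) * (-(k*a))) atTop (𝓝 0) := by
    rw [Metric.tendsto_nhds]
    intro η hη
    set t := |c / (-(k * a))| with ht
    have htc : t * |k * a| = |c| := by
      rw [ht, abs_div, abs_neg]; field_simp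
    have ht0 : 0 ≤ t := abs_nonneg _
    have hyc : 0 < y^k - |c| := by linarith
    -- choose ε
    obtain ⟨ε, hε, h1, h2⟩ : ∃ ε > 0, t * ε < η ∧ t * (|k * a| + ε) < y^k := by
      refine ⟨min (η / (t+1)) ((y^k - |c|) / (t + 1)) , by positivity, ?_, ?_⟩
      · calc t * _ ≤ t * (η / (t+1)) := mul_le_mul_of_nonneg_left (min_le_left _ _) ht0
          _ = (t / (t+1)) * η := by ring
          _ < 1 * η := by
            apply mul_lt_mul_of_pos_right _ hη
            rw [div_lt_one (by positivity)]; linarith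
          _ = η := one_mul _
      · have : t * min (η / (t+1)) ((y^k - |c|) / (t + 1)) < y^k - |c| := by
          calc t * _ ≤ t * ((y^k - |c|) / (t+1)) := mul_le_mul_of_nonneg_left (min_le_right _ _) ht0
          _ = (t / (t+1)) * (y^k - |c|) := by ring
          _ < 1 * (y^k - |c|) := by
            apply mul_lt_mul_of_pos_right _ hyc
            rw [div_lt_one (by positivity)]; linarith
          _ = (y^k - |c|) := one_mul _
        rw [mul_add, htc]; linarith
    obtain ⟨R, hR⟩ := iter_int hk hh hε
    have e1 := (hm.abs.mul_const ε).eventually (gt_mem_nhds h1)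
    have e2 : ∀ᶠ N : ℕ in atTop, R / (N:ℝ)^k < ((((p N : ℝ))^k)⁻¹ / (N:ℝ)^k) -
        |(m N : ℝ) / (N:ℝ)^k| * (|k * a| + ε) := by
      refine Tendsto.eventually_lt (tendsto_const_nhds.div_atTop hNk)
        (hpk.sub (hm.abs.mul_const (|k * a| + ε))) ?_
      exact sub_pos.2 h2
    filter_upwards [e1, e2, hpne, eventually_gt_atTop 0] with N g1 g2 g3 g4
    have hN : (0:ℝ) < (N:ℝ)^k := by positivity
    rw [abs_div, abs_of_pos hN] at g1 g2
    have g5 := hR (p N) g3 (m N) (by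
      rw [div_mul_eq_mul_div, ← sub_div, div_lt_div_iff_of_pos_right hN] at g2
      exact g2)
    rw [Real.dist_eq, sub_zero, div_mul_eq_mul_div, ← sub_div, ← sub_div, abs_div, abs_of_pos hN]
    refine lt_of_le_of_lt ?_ g1
    rw [div_mul_eq_mul_div]
    exact div_le_div_of_nonneg_right g5 hN.le
  have hlim : Tendsto (fun N : ℕ => q N / (N:ℝ)^k) atTop (𝓝 (y^k + c)) := by
    have := (hdiff.add hpk).add (hm.mul_const (-(k*a)))
    have e : (0:ℝ) + y^k + c / (-(k*a)) * (-(k*a)) = y^k + c := by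
      have : (k:ℝ) * a ≠ 0 := mul_ne_zero hk0.ne' ha
      field_simp
      ring
    rw [e] at this
    refine this.congr (fun N => ?_)
    ring
  have hpos : 0 < y^k + c := by linarith [neg_abs_le c]
  have hfin := hlim.rpow_const (p := (k:ℝ)⁻¹) (Or.inl hpos.ne')
  refine hfin.congr' ?_
  filter_upwards [hpne, eventually_gt_atTop 0] with N g3 g4
  have h1 := pos_of_ne (map_ne (h^(m N)) g3)
  have h2 : q N / (N:ℝ)^k = (((N:ℝ) * ((h ^ m N) (p N) : ℝ))⁻¹)^k := by
    rw [hq, inv_pow, mul_pow, mul_inv, div_eq_mul_inv, mul_comm]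
  rw [h2]
  exact Real.pow_rpow_inv_natCast (by positivity) (by omega)

/-- A one-parameter family of (sequences of) group elements whose rescaled limits move
points with initial velocity `v`. -/
structure PathOn (Γ : Subgroup (II ≃o II)) (h : ℝ → ℕ → II ≃o II) (φ : ℝ → ℝ → ℝ)
    (v : ℝ → ℝ) : Prop where
  mem : ∀ τ N, h τ N ∈ Γ
  conv : ∀ y ∈ Set.Ioo (1:ℝ) 3, ∀ᶠ q : ℝ × ℝ in 𝓝 (0, y), Conv (h q.1) q.2 (φ q.1 q.2) ∧
    DifferentiableAt ℝ (fun q : ℝ × ℝ => φ q.1 q.2) q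
  zero : ∀ y ∈ Set.Ioo (1:ℝ) 3, φ 0 y = y
  der : ∀ y ∈ Set.Ioo (1:ℝ) 3, HasDerivAt (fun τ => φ τ y) (v y) 0

variable {Γ : Subgroup (II ≃o II)}

lemma PathOn.diff {h : ℝ → ℕ → II ≃o II} {φ : ℝ → ℝ → ℝ} {v : ℝ → ℝ} (P : PathOn Γ h φ v)
    {y : ℝ} (hy : y ∈ Set.Ioo (1:ℝ) 3) :
    DifferentiableAt ℝ (fun q : ℝ × ℝ => φ q.1 q.2) (0, y) :=
  ((P.conv y hy).self_of_nhds).2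

lemma PathOn.curve {h : ℝ → ℕ → II ≃o II} {φ : ℝ → ℝ → ℝ} {v : ℝ → ℝ} (P : PathOn Γ h φ v)
    {c : ℝ → ℝ} {d : ℝ} (hc : HasDerivAt c d 0) (hy : c 0 ∈ Set.Ioo (1:ℝ) 3) :
    HasDerivAt (fun τ => φ τ (c τ)) (v (c 0) + d) 0 := by
  have hF := (P.diff hy).hasFDerivAt
  set L := fderiv ℝ (fun q : ℝ × ℝ => φ q.1 q.2) (0, c 0)
  have key : ∀ (a b : ℝ → ℝ) (a' b' : ℝ), HasDerivAt a a' 0 → HasDerivAt b b' 0 → a 0 = 0 →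
      b 0 = c 0 → HasDerivAt (fun τ => φ (a τ) (b τ)) (L (a', b')) 0 := by
    intro a b a' b' ha hb ha0 hb0
    have h1 := ha.prodMk hb
    have h2 : HasFDerivAt (fun q : ℝ × ℝ => φ q.1 q.2) L ((fun x => (a x, b x)) 0) := by
      simp only [ha0, hb0]; exact hF
    exact h2.comp_hasDerivAt 0 h1
  have h1 := (key _ _ _ _ (hasDerivAt_id 0) (hasDerivAt_const 0 (c 0)) rfl rfl).unique
    (P.der _ hy)
  have h2 := (key _ _ _ _ (hasDerivAt_const 0 0) hc rfl rfl).unique (f₁' := d) (by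
    refine hc.congr_of_eventuallyEq ?_
    have : ∀ᶠ t in 𝓝 (0:ℝ), c t ∈ Set.Ioo (1:ℝ) 3 :=
      hc.continuousAt.eventually (isOpen_Ioo.mem_nhds hy)
    filter_upwards [this] with t ht
    exact P.zero _ ht)
  have h3 := key _ _ _ _ (hasDerivAt_id 0) hc rfl rfl
  have h4 : ((1:ℝ), d) = ((1:ℝ), (0:ℝ)) + ((0:ℝ), d) := by simp
  rw [h4, map_add, h1, h2] at h3
  exact h3

lemma PathOn.mul {h₁ h₂ : ℝ → ℕ → II ≃o II} {φ₁ φ₂ : ℝ → ℝ → ℝ} {v₁ v₂ : ℝ → ℝ}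
    (P₁ : PathOn Γ h₁ φ₁ v₁) (P₂ : PathOn Γ h₂ φ₂ v₂) :
    PathOn Γ (fun τ N => h₁ τ N * h₂ τ N) (fun τ y => φ₁ τ (φ₂ τ y)) (v₁ + v₂) where
  mem τ N := Γ.mul_mem (P₁.mem τ N) (P₂.mem τ N)
  conv y hy := by
    have hd := P₂.diff hy
    have hc : ContinuousAt (fun q : ℝ × ℝ => (q.1, φ₂ q.1 q.2)) (0, y) :=
      continuousAt_fst.prodMk hd.continuousAt
    have ht : Tendsto (fun q : ℝ × ℝ => (q.1, φ₂ q.1 q.2)) (𝓝 (0, y)) (𝓝 (0, y)) := by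
      have := hc.tendsto
      simp only [P₂.zero y hy] at this
      exact this
    filter_upwards [P₂.conv y hy, ht.eventually (P₁.conv y hy)] with q h1 h2
    refine ⟨h2.1.mul h1.1, ?_⟩
    exact DifferentiableAt.comp q (f := fun q : ℝ × ℝ => (q.1, φ₂ q.1 q.2))
      (g := fun q : ℝ × ℝ => φ₁ q.1 q.2) h2.2 (differentiableAt_fst.prodMk h1.2)
  zero y hy := by rw [P₂.zero y hy, P₁.zero y hy]
  der y hy := by
    have h0 := P₂.zero y hy
    have := P₁.curve (P₂.der y hy) (by rw [h0]; exact hy)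
    rw [h0] at this
    exact this

lemma PathOn.reparam {h : ℝ → ℕ → II ≃o II} {φ : ℝ → ℝ → ℝ} {v : ℝ → ℝ} (P : PathOn Γ h φ v)
    (c : ℝ) : PathOn Γ (fun τ => h (c * τ)) (fun τ => φ (c * τ)) (c • v) where
  mem τ N := P.mem _ N
  conv y hy := by
    have ht : Tendsto (fun q : ℝ × ℝ => (c * q.1, q.2)) (𝓝 (0, y)) (𝓝 (0, y)) := by
      have : Continuous (fun q : ℝ × ℝ => (c * q.1, q.2)) := by fun_prop
      have := this.tendsto (0, y)
      simpa using this
    filter_upwards [ht.eventually (P.conv y hy)] with q h1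
    refine ⟨h1.1, ?_⟩
    exact DifferentiableAt.comp q (f := fun q : ℝ × ℝ => (c * q.1, q.2))
      (g := fun q : ℝ × ℝ => φ q.1 q.2) h1.2 (by fun_prop)
  zero y hy := by rw [mul_zero]; exact P.zero y hy
  der y hy := by
    have h1 : HasDerivAt (fun τ : ℝ => c * τ) c 0 := by
      simpa using (hasDerivAt_id (0:ℝ)).const_mul c
    have h2 : HasDerivAt (fun τ => φ τ y) (v y) (c * 0) := by rw [mul_zero]; exact P.der y hy
    have := h2.comp 0 h1
    rw [mul_comm] at this
    exact this

lemma PathOn.one : PathOn Γ (fun _ _ => 1) (fun _ y => y) 0 where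
  mem _ _ := Γ.one_mem
  conv y hy := by
    filter_upwards with q
    exact ⟨conv_one _, differentiableAt_snd⟩
  zero y hy := rfl
  der y hy := hasDerivAt_const _ _

/-- realizable vector fields -/
def VF (Γ : Subgroup (II ≃o II)) (v : ℝ → ℝ) : Prop :=
  ∃ h φ ψ, PathOn Γ h φ v ∧ PathOn Γ (fun τ N => (h τ N)⁻¹) ψ (-v)

lemma VF.add {v w : ℝ → ℝ} (hv : VF Γ v) (hw : VF Γ w) : VF Γ (v + w) := by
  obtain ⟨h₁, φ₁, ψ₁, P₁, Q₁⟩ := hv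
  obtain ⟨h₂, φ₂, ψ₂, P₂, Q₂⟩ := hw
  refine ⟨_, _, fun τ y => ψ₂ τ (ψ₁ τ y), P₁.mul P₂, ?_⟩
  have := Q₂.mul Q₁
  simp only [mul_inv_rev]
  rw [neg_add, add_comm]
  exact this

lemma VF.smul {v : ℝ → ℝ} (hv : VF Γ v) (c : ℝ) : VF Γ (c • v) := by
  obtain ⟨h₁, φ₁, ψ₁, P₁, Q₁⟩ := hv
  refine ⟨_, _, fun τ => ψ₁ (c * τ), P₁.reparam c, ?_⟩
  rw [← smul_neg]
  exact Q₁.reparam c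

lemma VF.zero : VF Γ 0 := by
  refine ⟨_, _, fun _ y => y, PathOn.one, ?_⟩
  simp only [inv_one, neg_zero]
  exact PathOn.one

lemma S_pos {k : ℕ} {c y : ℝ} (h : |c| < y^k) : 0 < S k c y :=
  Real.rpow_pos_of_pos (by linarith [neg_abs_le c]) _

lemma S_pow {k : ℕ} (hk : 1 ≤ k) {c y : ℝ} (h : |c| < y^k) : S k c y ^ k = y^k + c :=
  Real.rpow_inv_natCast_pow (by linarith [neg_abs_le c]) (by omega)

lemma S_zero {k : ℕ} (hk : 1 ≤ k) {y : ℝ} (h : 0 ≤ y) : S k 0 y = y := by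
  rw [S, add_zero]
  exact Real.pow_rpow_inv_natCast h (by omega)

lemma S_inv {k : ℕ} (hk : 1 ≤ k) {c y : ℝ} (hy : 0 ≤ y) (h : |c| < y^k) :
    S k c (S k (-c) y) = y := by
  rw [S, S_pow hk (by rwa [abs_neg]), neg_add_cancel_right]
  exact Real.pow_rpow_inv_natCast hy (by omega)

lemma S_diff {E : Type*} [NormedAddCommGroup E] [NormedSpace ℝ E] {k : ℕ} {c y : E → ℝ} {q : E}
    (hc : DifferentiableAt ℝ c q) (hy : DifferentiableAt ℝ y q) (h : |c q| < (y q)^k) :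
    DifferentiableAt ℝ (fun q => S k (c q) (y q)) q := by
  unfold S
  apply DifferentiableAt.rpow_const
  · exact (hy.pow k).add hc
  · left; linarith [neg_abs_le (c q)]

noncomputable def vs (i j : ℕ) (s y : ℝ) : ℝ :=
  ((y^i) ^ ((i:ℝ)⁻¹ - 1) / j) * (y^i - s) ^ (-((j:ℝ)/i - 1))

lemma base_path {i j : ℕ} (hi : 1 ≤ i) (hj : 1 ≤ j) {f g : II ≃o II} {a b : ℝ} (hf : ord i f a)
    (hg : ord j g b) (ha : a ≠ 0) (hb : b ≠ 0) (hfΓ : f ∈ Γ) (hgΓ : g ∈ Γ) {s : ℝ} (hs : |s| < 1/4)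
    (n : ℕ → ℤ) (hn : Tendsto (fun N : ℕ => (n N : ℝ) / (N:ℝ)^i) atTop (𝓝 (s / (-(i * a)))))
    (m : ℝ → ℕ → ℤ)
    (hm : ∀ τ, Tendsto (fun N : ℕ => (m τ N : ℝ) / (N:ℝ)^j) atTop (𝓝 (τ / (-(j * b))))) :
    PathOn Γ (fun τ N => f ^ (n N) * (g ^ (m τ N) * f ^ (- n N)))
      (fun τ y => S i s (S j τ (S i (-s) y))) (vs i j s) where
  mem τ N := Γ.mul_mem (Γ.zpow_mem hfΓ _) (Γ.mul_mem (Γ.zpow_mem hgΓ _) (Γ.zpow_mem hfΓ _))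
  conv y hy := by
    have hyi : 1 ≤ y^i := one_le_pow₀ hy.1.le
    have hy0 : 0 < y := by linarith [hy.1]
    have hsy : |-s| < y^i := by rw [abs_neg]; linarith
    have e1 : ∀ᶠ q : ℝ × ℝ in 𝓝 (0, y), 0 < q.2 ∧ |-s| < q.2^i := by
      have c1 : Tendsto (fun q : ℝ × ℝ => q.2) (𝓝 (0, y)) (𝓝 y) := continuousAt_snd
      exact (c1.eventually (lt_mem_nhds hy0)).and ((c1.pow i).eventually (lt_mem_nhds hsy))
    have d1 : ∀ q : ℝ × ℝ, |-s| < q.2^i → DifferentiableAt ℝ (fun q : ℝ × ℝ => S i (-s) q.2) q :=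
      fun q hq => S_diff (differentiableAt_const _) differentiableAt_snd hq
    have c1 : Tendsto (fun q : ℝ × ℝ => S i (-s) q.2) (𝓝 (0, y)) (𝓝 (S i (-s) y)) :=
      (d1 (0, y) hsy).continuousAt
    have w0 : 0 < S i (-s) y := S_pos hsy
    have e2 : ∀ᶠ q : ℝ × ℝ in 𝓝 (0, y), |q.1| < (S i (-s) q.2)^j := by
      have c0 : Tendsto (fun q : ℝ × ℝ => |q.1|) (𝓝 (0, y)) (𝓝 0) := by
        have : Continuous (fun q : ℝ × ℝ => |q.1|) := by fun_prop
        simpa using this.tendsto (0, y)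
      exact c0.eventually_lt (c1.pow j) (by positivity)
    have d2 : ∀ q : ℝ × ℝ, |-s| < q.2^i → |q.1| < (S i (-s) q.2)^j →
        DifferentiableAt ℝ (fun q : ℝ × ℝ => S j q.1 (S i (-s) q.2)) q :=
      fun q hq hq' => S_diff differentiableAt_fst (d1 q hq) hq'
    have c2 : Tendsto (fun q : ℝ × ℝ => S j q.1 (S i (-s) q.2)) (𝓝 (0, y)) (𝓝 (S i (-s) y)) := by
      have := (d2 (0, y) hsy (by simpa using pow_pos w0 j)).continuousAt.tendsto
      simp only [S_zero hj w0.le] at this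
      exact this
    have e3 : ∀ᶠ q : ℝ × ℝ in 𝓝 (0, y), |s| < (S j q.1 (S i (-s) q.2))^i := by
      refine (c2.pow i).eventually (lt_mem_nhds ?_)
      rw [S_pow hi hsy]
      linarith [le_abs_self s]
    filter_upwards [e1, e2, e3] with q h1 h2 h3
    refine ⟨?_, S_diff (differentiableAt_const _) (d2 q h1.2 h2) h3⟩
    refine (conv_S hi hf n hn ha (S_pos h2) h3).mul
      ((conv_S hj hg (m q.1) (hm q.1) hb (S_pos h1.2) h2).mul
      (conv_S hi hf (fun N => - n N) ?_ ha h1.1 h1.2))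
    have := hn.neg
    rw [neg_div]
    refine this.congr (fun N => ?_)
    push_cast; ring
  zero y hy := by
    have hyi : 1 ≤ y^i := one_le_pow₀ hy.1.le
    have hy0 : 0 < y := by linarith [hy.1]
    have hsy : |s| < y^i := by linarith
    have w0 : 0 < S i (-s) y := S_pos (by rwa [abs_neg])
    rw [S_zero hj w0.le, S_inv hi hy0.le hsy]
  der y hy := by
    have hyi : 1 ≤ y^i := one_le_pow₀ hy.1.le
    have hy0 : 0 < y := by linarith [hy.1]
    have hsy : |-s| < y^i := by rw [abs_neg]; linarith
    have w0 : 0 < S i (-s) y := S_pos hsy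
    have wi := S_pow hi hsy
    have hA : 0 < y^i + -s := by linarith [neg_abs_le (-s)]
    have hi0 : (i:ℝ) ≠ 0 := by positivity
    have hj0 : (j:ℝ) ≠ 0 := by positivity
    have hwdef : S i (-s) y = (y^i + -s) ^ ((i:ℝ)⁻¹) := rfl
    set w := S i (-s) y
    have h1 : HasDerivAt (fun τ => S j τ w) ((w^j) ^ ((j:ℝ)⁻¹ - 1) / j) 0 := by
      have h0 : HasDerivAt (fun τ : ℝ => w^j + τ) 1 0 := by
        simpa using (hasDerivAt_id (0:ℝ)).const_add (w^j)
      have := h0.rpow_const (p := (j:ℝ)⁻¹) (by left; have := pow_pos w0 j; simp only [add_zero]; exact this.ne')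
      refine this.congr_deriv ?_
      rw [add_zero]; field_simp
    have h2 : HasDerivAt (fun z => S i s z) (w^(i-1) * (y^i) ^ ((i:ℝ)⁻¹ - 1)) w := by
      have h0 : HasDerivAt (fun z : ℝ => z^i + s) (i * w^(i-1)) w := by
        simpa using (hasDerivAt_pow i w).add_const s
      have hh : w^i + s = y^i := by rw [wi]; ring
      have := h0.rpow_const (p := (i:ℝ)⁻¹) (by left; rw [hh]; positivity)
      refine this.congr_deriv ?_
      rw [hh]; field_simp
    have h3 : HasDerivAt (fun z => S i s z) (w^(i-1) * (y^i) ^ ((i:ℝ)⁻¹ - 1)) (S j 0 w) := by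
      rw [S_zero hj w0.le]; exact h2
    refine (h3.comp 0 h1).congr_deriv ?_
    have h4 : w^(i-1) * (w^j) ^ ((j:ℝ)⁻¹ - 1) = (y^i - s) ^ (-((j:ℝ)/i - 1)) := by
      rw [← Real.rpow_natCast w (i-1), ← Real.rpow_natCast w j, ← Real.rpow_mul w0.le,
        ← Real.rpow_add w0, hwdef, ← Real.rpow_mul hA.le, ← sub_eq_add_neg]
      congr 1
      rw [Nat.cast_sub hi]
      field_simp
      push_cast
      ring
    rw [vs, ← h4]
    ring

lemma floor_lim (t : ℝ) {k : ℕ} (hk : 1 ≤ k) :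
    Tendsto (fun N : ℕ => ((⌊t * (N:ℝ)^k⌋ : ℤ) : ℝ) / (N:ℝ)^k) atTop (𝓝 t) := by
  have hNk : Tendsto (fun N : ℕ => (N:ℝ)^k) atTop atTop :=
    (tendsto_pow_atTop (by omega)).comp tendsto_natCast_atTop_atTop
  have h1 : Tendsto (fun N : ℕ => t - 1 / (N:ℝ)^k) atTop (𝓝 t) := by
    simpa using (tendsto_const_nhds (x := t)).sub
      ((tendsto_const_nhds (x := (1:ℝ))).div_atTop hNk)
  refine tendsto_of_tendsto_of_tendsto_of_le_of_le' h1 (tendsto_const_nhds (x := t)) ?_ ?_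
  · filter_upwards [eventually_gt_atTop 0] with N hN
    have : (0:ℝ) < (N:ℝ)^k := by positivity
    rw [le_div_iff₀ this, sub_mul, div_mul_cancel₀ _ this.ne']
    exact (Int.sub_one_lt_floor _).le
  · filter_upwards [eventually_gt_atTop 0] with N hN
    have : (0:ℝ) < (N:ℝ)^k := by positivity
    rw [div_le_iff₀ this]
    exact Int.floor_le _

lemma base_VF {i j : ℕ} (hi : 1 ≤ i) (hj : 1 ≤ j) {f g : II ≃o II} {a b : ℝ} (hf : ord i f a)
    (hg : ord j g b) (ha : a ≠ 0) (hb : b ≠ 0) (hfΓ : f ∈ Γ) (hgΓ : g ∈ Γ) {s : ℝ}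
    (hs : |s| < 1/4) : VF Γ (vs i j s) := by
  set n : ℕ → ℤ := fun N => ⌊s / (-(i * a)) * (N:ℝ)^i⌋
  set m : ℝ → ℕ → ℤ := fun τ N => ⌊τ / (-(j * b)) * (N:ℝ)^j⌋
  have P := base_path hi hj hf hg ha hb hfΓ hgΓ hs n (floor_lim _ hi) m (fun τ => floor_lim _ hj)
  have Q := (base_path hi hj hf hg ha hb hfΓ hgΓ hs n (floor_lim _ hi) (fun τ N => - m (-τ) N)
    (fun τ => by
      have := (floor_lim (-τ / (-(j * b))) hj).neg
      have e : -(-τ / (-(j * b))) = τ / (-(j * b)) := by ring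
      rw [e] at this
      refine this.congr (fun N => ?_)
      push_cast; ring)).reparam (-1)
  refine ⟨_, _, fun τ => (fun τ y => S i s (S j τ (S i (-s) y))) (-1 * τ), P, ?_⟩
  have e1 : (fun (τ : ℝ) N => (f ^ (n N) * (g ^ (m τ N) * f ^ (- n N)))⁻¹) =
    fun τ N => f ^ (n N) * (g ^ (- m (-(-1 * τ)) N) * f ^ (- n N)) := by
    funext τ N
    have : -(-1 * τ) = τ := by ring
    rw [this]
    group
  rw [e1]
  simpa using Q

lemma vandermonde {T : Type*} [Fintype T] {X d : T → ℝ} (hX : Function.Injective X)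
    (h : ∀ m : ℕ, ∑ x, d x * X x ^ m = 0) : d = 0 := by
  let e := Fintype.equivFin T
  have := Matrix.eq_zero_of_forall_pow_sum_mul_pow_eq_zero (f := X ∘ e.symm) (v := d ∘ e.symm)
    (hX.comp e.symm.injective) (fun i => by
      rw [← h i]
      exact e.symm.sum_comp (fun x => d x * X x ^ (i:ℕ)))
  funext x
  have h2 := congrFun this (e x)
  simpa using h2

lemma indep {T : Type*} [Fintype T] {X d : T → ℝ} (hX : Function.Injective X) (h1 : ∀ x, 1 ≤ X x)
    {q : ℝ} (hq : 0 < q)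
    (h : ∀ s : ℝ, |s| < 1/4 → ∑ x, d x * (X x - s) ^ (-q) = 0) : d = 0 := by
  have hpos : ∀ s : ℝ, |s| < 1/4 → ∀ x, 0 < X x - s := fun s hs x => by
    linarith [le_abs_self s, h1 x]
  have key : ∀ m : ℕ, ∀ s : ℝ, |s| < 1/4 → ∑ x, d x * (X x - s) ^ (-q - m) = 0 := by
    intro m
    induction m with
    | zero => simpa using h
    | succ m ih =>
      intro s hs
      have hd : HasDerivAt (fun s => ∑ x, d x * (X x - s) ^ (-q - m))
          (∑ x, d x * ((-1) * (-q - m) * (X x - s) ^ (-q - m - 1))) s := by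
        refine HasDerivAt.fun_sum (fun x _ => HasDerivAt.const_mul _ ?_)
        have h0 : HasDerivAt (fun s : ℝ => X x - s) (-1) s := by
          simpa using (hasDerivAt_id s).const_sub (X x)
        exact h0.rpow_const (Or.inl (hpos s hs x).ne')
      have hz : HasDerivAt (fun s => ∑ x, d x * (X x - s) ^ (-q - m)) 0 s := by
        refine (hasDerivAt_const s (0:ℝ)).congr_of_eventuallyEq ?_
        have : ∀ᶠ t in 𝓝 s, |t| < 1/4 :=
          continuous_abs.continuousAt.eventually (gt_mem_nhds hs)
        filter_upwards [this] with t ht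
        exact ih t ht
      have he := hd.unique hz
      have e : ∑ x, d x * ((-1) * (-q - m) * (X x - s) ^ (-q - m - 1)) =
          (q + m) * ∑ x, d x * (X x - s) ^ (-q - (m+1 : ℕ)) := by
        rw [Finset.mul_sum]
        refine Finset.sum_congr rfl (fun x _ => ?_)
        have : -q - ((m+1 : ℕ):ℝ) = -q - m - 1 := by push_cast; ring
        rw [this]; ring
      rw [e] at he
      exact (mul_eq_zero.1 he).resolve_left (by positivity)
  have hz : (fun x => d x * X x ^ (-q)) = 0 := by
    refine vandermonde (X := fun x => (X x)⁻¹) (inv_injective.comp hX) (fun m => ?_)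
    have := key m 0 (by norm_num)
    rw [← this]
    refine Finset.sum_congr rfl (fun x _ => ?_)
    have h0 : 0 < X x := by linarith [h1 x]
    rw [sub_zero, Real.rpow_sub h0, Real.rpow_natCast, inv_pow]
    ring
  funext x
  have h0 : 0 < X x := by linarith [h1 x]
  have := congrFun hz x
  exact (mul_eq_zero.1 this).resolve_right (Real.rpow_pos_of_pos h0 _).ne'

lemma separate {i j : ℕ} (hi : 1 ≤ i) (hij : i < j) {f g : II ≃o II} {a b : ℝ} (hf : ord i f a)
    (hg : ord j g b) (ha : a ≠ 0) (hb : b ≠ 0) (hfΓ : f ∈ Γ) (hgΓ : g ∈ Γ)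
    (A : Finset ℝ) (hA : ∀ x ∈ A, x ∈ Set.Ioo (1:ℝ) 3) (y : ℝ) (hy : y ∈ Set.Ioo (1:ℝ) 3)
    (hyA : y ∉ A) : ∃ v, VF Γ v ∧ (∀ x ∈ A, v x = 0) ∧ v y ≠ 0 := by
  classical
  let T := {x // x ∈ insert y A}
  have hT : ∀ x : T, x.1 ∈ Set.Ioo (1:ℝ) 3 := by
    rintro ⟨x, hx⟩
    rcases Finset.mem_insert.1 hx with rfl | h
    · exact hy
    · exact hA x h
  let V : Submodule ℝ (T → ℝ) :=
    { carrier := {u | ∃ v, VF Γ v ∧ ∀ x : T, u x = v x}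
      add_mem' := by
        rintro u u' ⟨v, hv, h⟩ ⟨v', hv', h'⟩
        exact ⟨v + v', hv.add hv', fun x => by simp [h, h']⟩
      zero_mem' := ⟨0, VF.zero, fun x => rfl⟩
      smul_mem' := by
        rintro c u ⟨v, hv, h⟩
        exact ⟨c • v, hv.smul c, fun x => by simp [h]⟩ }
  have hV : V = ⊤ := by
    by_contra hne
    obtain ⟨F, hF0, hF⟩ := Submodule.exists_le_ker_of_lt_top V (lt_top_iff_ne_top.2 hne)
    apply hF0
    have hexp : ∀ u : T → ℝ, F u = ∑ x, u x * F (Pi.single x 1) := by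
      intro u
      conv_lhs => rw [pi_eq_sum_univ' u]
      simp [map_sum]
    have hz : (fun x : T => F (Pi.single x 1) * ((x.1^i) ^ ((i:ℝ)⁻¹ - 1) / j)) = 0 := by
      have hinj : Function.Injective (fun x : T => x.1^i) := by
        intro x x' h
        apply Subtype.ext
        exact (pow_left_inj₀ (by linarith [(hT x).1]) (by linarith [(hT x').1]) (by omega)).1 h
      refine indep (q := (j:ℝ)/i - 1) hinj (fun x => one_le_pow₀ (hT x).1.le) ?_ ?_
      · have : (0:ℝ) < i := by positivity
        rw [sub_pos, one_lt_div this]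
        exact_mod_cast hij
      · intro s hs
        have hv := base_VF hi (by omega : 1 ≤ j) hf hg ha hb hfΓ hgΓ hs
        have h1 : F (fun x : T => vs i j s x.1) = 0 := hF ⟨_, hv, fun x => rfl⟩
        rw [hexp] at h1
        rw [← h1]
        refine Finset.sum_congr rfl (fun x _ => ?_)
        rw [vs]; ring
    ext x
    have h2 := congrFun hz x
    have hx0 : 0 < x.1 := by linarith [(hT x).1]
    have hj0 : (0:ℝ) < j := by exact_mod_cast (by omega : 0 < j)
    have h3 : 0 < (x.1^i) ^ ((i:ℝ)⁻¹ - 1) / j := by positivity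
    simpa using (mul_eq_zero.1 h2).resolve_right h3.ne'
  have hmem : (Pi.single ⟨y, Finset.mem_insert_self y A⟩ 1 : T → ℝ) ∈ V := by rw [hV]; trivial
  obtain ⟨v, hv, h⟩ := hmem
  refine ⟨v, hv, fun x hx => ?_, ?_⟩
  · rw [← h ⟨x, Finset.mem_insert_of_mem hx⟩]
    apply Pi.single_eq_of_ne
    intro he
    apply hyA
    have h5 : x = y := congrArg Subtype.val he
    rw [← h5]; exact hx
  · rw [← h ⟨y, Finset.mem_insert_self y A⟩, Pi.single_eq_same]
    exact one_ne_zero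

/-- inverse letter -/
def bar {α : Type*} (s : α × Bool) : α × Bool := (s.1, !s.2)

lemma bar_bar {α : Type*} (s : α × Bool) : bar (bar s) = s := by simp [bar]

lemma bar_ne {α : Type*} (s : α × Bool) : bar s ≠ s := by
  intro h
  have := congrArg Prod.snd h
  simp [bar] at this

/-- an assignment of group sequences to the letters, with rescaled limits `φ` -/
structure Assign {α : Type*} (Γ : Subgroup (II ≃o II)) (γ : α × Bool → ℕ → II ≃o II)
    (φ : α × Bool → ℝ → ℝ) (r δ : ℝ) : Prop where
  mem : ∀ s N, γ s N ∈ Γ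
  inv : ∀ s N, γ (bar s) N = (γ s N)⁻¹
  conv : ∀ s y, |y - 2| < r → Conv (γ s) y (φ s y)
  small : ∀ s y, |y - 2| < r → |φ s y - y| < δ
  diff : ∀ s y, |y - 2| < r → DifferentiableAt ℝ (φ s) y

/-- evaluation of a word at the base point 2 -/
def ev {α : Type*} (φ : α × Bool → ℝ → ℝ) : List (α × Bool) → ℝ
  | [] => 2
  | s :: L => φ s (ev φ L)

lemma Assign.ev_le {α : Type*} {γ : α × Bool → ℕ → II ≃o II} {φ : α × Bool → ℝ → ℝ} {r δ : ℝ}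
    (H : Assign Γ γ φ r δ) (hδ : 0 < δ) (L : List (α × Bool)) (hL : L.length * δ ≤ r) :
    |ev φ L - 2| ≤ L.length * δ := by
  induction L with
  | nil => simp [ev]
  | cons s L ih =>
    simp only [List.length_cons, Nat.cast_add, Nat.cast_one, add_mul, one_mul] at hL ⊢
    have h1 := ih (by linarith)
    have h2 := H.small s (ev φ L) (by linarith)
    have h3 : |ev φ (s :: L) - 2| ≤ |φ s (ev φ L) - ev φ L| + |ev φ L - 2| := by
      have : ev φ (s :: L) - 2 = (φ s (ev φ L) - ev φ L) + (ev φ L - 2) := by simp [ev]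
      rw [this]; exact abs_add_le _ _
    linarith

lemma Assign.conv_ev {α : Type*} {γ : α × Bool → ℕ → II ≃o II} {φ : α × Bool → ℝ → ℝ} {r δ : ℝ}
    (H : Assign Γ γ φ r δ) (hδ : 0 < δ) (L : List (α × Bool)) (hL : L.length * δ ≤ r) :
    Conv (fun N => (L.map (fun s => γ s N)).prod) 2 (ev φ L) := by
  induction L with
  | nil => simpa [ev] using conv_one 2
  | cons s L ih =>
    simp only [List.length_cons, Nat.cast_add, Nat.cast_one, add_mul, one_mul] at hL
    simp only [List.map_cons, List.prod_cons]
    refine Conv.mul (H.conv s _ ?_) (ih (by linarith))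
    have := H.ev_le hδ L (by linarith)
    linarith

lemma Assign.left_inv {α : Type*} {γ : α × Bool → ℕ → II ≃o II} {φ : α × Bool → ℝ → ℝ} {r δ : ℝ}
    (H : Assign Γ γ φ r δ) (hr : r < 1) (s : α × Bool) {y : ℝ} (hy : |y - 2| < r)
    (hy' : |φ s y - 2| < r) : φ (bar s) (φ s y) = y := by
  have h := (H.conv (bar s) _ hy').mul (H.conv s y hy)
  simp only [H.inv, inv_mul_cancel] at h
  exact conv_one_unique (by linarith [(abs_lt.1 hy).1]) h

lemma Assign.deriv_ne {α : Type*} {γ : α × Bool → ℕ → II ≃o II} {φ : α × Bool → ℝ → ℝ} {r δ : ℝ}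
    (H : Assign Γ γ φ r δ) (hr : r < 1) (s : α × Bool) {y : ℝ} (hy : |y - 2| < r)
    (hy' : |φ s y - 2| < r) : deriv (φ s) y ≠ 0 := by
  intro h0
  have h1 := (H.diff s y hy).hasDerivAt
  have h2 := (H.diff (bar s) _ hy').hasDerivAt.comp y h1
  rw [h0, mul_zero] at h2
  have c1 : ContinuousAt (fun z : ℝ => |z - 2|) y := by fun_prop
  have c2 : ContinuousAt (fun z : ℝ => |φ s z - 2|) y :=
    (h1.continuousAt.sub continuousAt_const).abs
  have h3 : HasDerivAt (φ (bar s) ∘ φ s) 1 y := by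
    refine (hasDerivAt_id y).congr_of_eventuallyEq ?_
    filter_upwards [c1.eventually (gt_mem_nhds hy), c2.eventually (gt_mem_nhds hy')] with z hz hz'
    exact H.left_inv hr s hz hz'
  exact one_ne_zero (h3.unique h2)

lemma PathOn.unif {h : ℝ → ℕ → II ≃o II} {φ : ℝ → ℝ → ℝ} {v : ℝ → ℝ} (P : PathOn Γ h φ v)
    {r η : ℝ} (hr : r < 1) (hη : 0 < η) : ∀ᶠ τ in 𝓝 (0:ℝ), ∀ y, |y - 2| ≤ r →
      Conv (h τ) y (φ τ y) ∧ |φ τ y - y| < η ∧ DifferentiableAt ℝ (φ τ) y := by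
  have hK : IsCompact (Set.Icc (2 - r) (2 + r)) := isCompact_Icc
  have key : ∀ y ∈ Set.Icc (2 - r) (2 + r), ∀ᶠ q : ℝ × ℝ in 𝓝 (0, y),
      Conv (h q.1) q.2 (φ q.1 q.2) ∧ |φ q.1 q.2 - q.2| < η ∧ DifferentiableAt ℝ (φ q.1) q.2 := by
    intro y hy
    have hy' : y ∈ Set.Ioo (1:ℝ) 3 := ⟨by linarith [hy.1], by linarith [hy.2]⟩
    have c : ContinuousAt (fun q : ℝ × ℝ => |φ q.1 q.2 - q.2|) (0, y) :=
      ((P.diff hy').continuousAt.sub continuousAt_snd).abs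
    have c0 : |φ (0, y).1 (0, y).2 - (0, y).2| < η := by simpa [P.zero y hy'] using hη
    filter_upwards [P.conv y hy', c.eventually (gt_mem_nhds c0)] with q h1 h2
    refine ⟨h1.1, h2, ?_⟩
    exact DifferentiableAt.comp q.2 (f := fun z : ℝ => (q.1, z))
      (g := fun q : ℝ × ℝ => φ q.1 q.2) h1.2 (by fun_prop)
  have := hK.eventually_forall_of_forall_eventually (x₀ := (0:ℝ)) (P := fun τ y =>
      Conv (h τ) y (φ τ y) ∧ |φ τ y - y| < η ∧ DifferentiableAt ℝ (φ τ) y) key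
  filter_upwards [this] with τ hτ y hy
  rw [abs_le] at hy
  exact hτ y ⟨by linarith, by linarith⟩

section step
variable {α : Type*} [DecidableEq α]

/-- perturbed limit maps -/
noncomputable def nφ (s₀ : α × Bool) (φ : α × Bool → ℝ → ℝ) (a b : ℝ → ℝ → ℝ) (τ : ℝ)
    (s : α × Bool) : ℝ → ℝ :=
  if s = s₀ then fun y => φ s₀ (a τ y) else
    if s = bar s₀ then fun y => b τ (φ (bar s₀) y) else φ s

/-- perturbed group elements -/
noncomputable def nγ (s₀ : α × Bool) (γ : α × Bool → ℕ → II ≃o II) (h : ℝ → ℕ → II ≃o II) (τ : ℝ)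
    (s : α × Bool) (N : ℕ) : II ≃o II :=
  if s = s₀ then γ s₀ N * h τ N else
    if s = bar s₀ then (h τ N)⁻¹ * γ (bar s₀) N else γ s N

lemma assign_new {s₀ : α × Bool} {γ : α × Bool → ℕ → II ≃o II} {φ : α × Bool → ℝ → ℝ}
    {r r' δ' : ℝ} (H : Assign Γ γ φ r' δ') (h : ℝ → ℕ → II ≃o II) (a b : ℝ → ℝ → ℝ) (τ : ℝ)
    (hδ : 0 < δ') (hr : r + δ' ≤ r') (hm : ∀ N, h τ N ∈ Γ)
    (ha : ∀ y, |y - 2| ≤ r' →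
      Conv (h τ) y (a τ y) ∧ |a τ y - y| < δ' ∧ DifferentiableAt ℝ (a τ) y)
    (hb : ∀ y, |y - 2| ≤ r' →
      Conv (fun N => (h τ N)⁻¹) y (b τ y) ∧ |b τ y - y| < δ' ∧ DifferentiableAt ℝ (b τ) y) :
    Assign Γ (nγ s₀ γ h τ) (nφ s₀ φ a b τ) r (2 * δ') := by
  have tri : ∀ x y z : ℝ, |x - z| ≤ |x - y| + |y - z| := fun x y z => abs_sub_le x y z
  refine ⟨?_, ?_, ?_, ?_, ?_⟩
  · intro s N
    unfold nγ
    split_ifs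
    · exact Γ.mul_mem (H.mem _ _) (hm _)
    · exact Γ.mul_mem (Γ.inv_mem (hm _)) (H.mem _ _)
    · exact H.mem _ _
  · intro s N
    unfold nγ
    by_cases h1 : s = s₀
    · subst h1
      simp [bar_ne, H.inv]
    · by_cases h2 : s = bar s₀
      · subst h2
        simp [bar_bar, bar_ne, H.inv]
      · have h3 : bar s ≠ s₀ := by rintro rfl; exact h2 (bar_bar s).symm
        have h4 : bar s ≠ bar s₀ := by
          intro h; apply h1; rw [← bar_bar s, h, bar_bar]
        simp [h1, h2, h3, h4, H.inv]
  all_goals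
    intro s y hy
    have hy' : |y - 2| < r' := by linarith
    have A := ha y hy'.le
    have A2 : |a τ y - 2| < r' := by linarith [tri (a τ y) y 2]
    have B1 := H.small (bar s₀) y hy'
    have B2 : |φ (bar s₀) y - 2| < r' := by linarith [tri (φ (bar s₀) y) y 2]
    have B := hb _ B2.le
  · unfold nγ nφ
    split_ifs
    · exact (H.conv s₀ _ A2).mul A.1
    · exact B.1.mul (H.conv _ y hy')
    · exact H.conv _ y hy'
  · unfold nφ
    split_ifs
    · linarith [tri (φ s₀ (a τ y)) (a τ y) y, H.small s₀ _ A2]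
    · linarith [tri (b τ (φ (bar s₀) y)) (φ (bar s₀) y) y]
    · linarith [H.small s y hy']
  · unfold nφ
    split_ifs
    · exact (H.diff s₀ _ A2).comp y A.2.2
    · exact B.2.2.comp y (H.diff _ y hy')
    · exact H.diff s y hy'

/-- the vector fields separate points -/
def Sep (Γ : Subgroup (II ≃o II)) : Prop :=
  ∀ (A : Finset ℝ), (∀ x ∈ A, x ∈ Set.Ioo (1:ℝ) 3) → ∀ y ∈ Set.Ioo (1:ℝ) 3, y ∉ A →
    ∃ v, VF Γ v ∧ (∀ x ∈ A, v x = 0) ∧ v y ≠ 0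

lemma main_ind (hsep : Sep Γ) (L : List (α × Bool)) (hL : FreeGroup.IsReduced L) :
    ∀ r δ : ℝ, 0 < r → r < 1 → 0 < δ → ∃ γ φ, Assign Γ (α := α) γ φ r δ ∧
      ∀ T T', T <:+ L → T' <:+ L → ev φ T = ev φ T' → T = T' := by
  induction L with
  | nil =>
    intro r δ hr hr1 hδ
    refine ⟨fun _ _ => 1, fun _ y => y, ⟨fun _ _ => Γ.one_mem, fun _ _ => inv_one.symm,
      fun _ y _ => conv_one y, fun _ y _ => by simpa using hδ,
      fun _ y _ => differentiableAt_id⟩, ?_⟩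
    intro T T' hT hT' _
    rw [List.suffix_nil.1 hT, List.suffix_nil.1 hT']
  | cons s₀ L ih =>
    intro r δ hr hr1 hδ
    set r' := (1 + r) / 2 with hr'
    have hlen : (0:ℝ) < L.length + 2 := by positivity
    set δ' := min (δ / 2) (min ((1 - r) / 2) (r' / (L.length + 2))) with hδ'
    have hδ0 : 0 < δ' := by
      refine lt_min (by linarith) (lt_min (by linarith) (div_pos (by linarith) hlen))
    have hδ1 : 2 * δ' ≤ δ := by linarith [min_le_left (δ / 2) (min ((1 - r) / 2) (r' / (L.length + 2)))]
    have hδ2 : r + δ' ≤ r' := by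
      have : δ' ≤ (1 - r) / 2 := (min_le_right _ _).trans (min_le_left _ _)
      linarith
    have hδ3 : (L.length + 2) * δ' ≤ r' := by
      have : δ' ≤ r' / (L.length + 2) := (min_le_right _ _).trans (min_le_right _ _)
      rw [le_div_iff₀ hlen] at this
      linarith
    have hr'1 : r' < 1 := by linarith
    clear_value δ' r'
    obtain ⟨γ, φ, H, hinj⟩ := ih (List.IsChain.tail hL) r' δ' (by linarith) hr'1 hδ0
    have hev : ∀ T : List (α × Bool), T.length ≤ L.length + 1 → |ev φ T - 2| < r' := by
      intro T hT
      have hT' : (T.length : ℝ) ≤ L.length + 1 := by exact_mod_cast hT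
      have h1 : (T.length : ℝ) * δ' ≤ (L.length + 1) * δ' := by gcongr
      have := H.ev_le hδ0 T (by linarith)
      linarith
    have hIoo : ∀ x : ℝ, |x - 2| < r' → x ∈ Set.Ioo (1:ℝ) 3 := by
      intro x hx
      rw [abs_lt] at hx
      exact ⟨by linarith, by linarith⟩
    have hsl : ∀ T, T <:+ L → T.length ≤ L.length + 1 := fun T hT => by
      have := hT.length_le; omega
    set A : Finset ℝ := ((L.tails.filter (fun T => T ≠ L)).map (ev φ)).toFinset with hA
    have memA : ∀ x, x ∈ A ↔ ∃ T, T <:+ L ∧ T ≠ L ∧ ev φ T = x := by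
      intro x
      simp [hA, and_assoc]
    obtain ⟨v, ⟨h, a, b, P, Q⟩, hv0, hvy⟩ := hsep A
      (fun x hx => by
        obtain ⟨T, hT, _, rfl⟩ := (memA x).1 hx
        exact hIoo _ (hev T (hsl T hT)))
      (ev φ L) (hIoo _ (hev L (by omega)))
      (fun hx => by
        obtain ⟨T, hT, hne, he⟩ := (memA _).1 hx
        exact hne (hinj T L hT List.suffix_rfl he))
    have hvT : ∀ T, T <:+ L → T ≠ L → v (ev φ T) = 0 := fun T hT hne =>
      hv0 _ ((memA _).2 ⟨T, hT, hne, rfl⟩)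
    -- evaluation through the letter `s₀`
    have step0 : ∀ T, T <:+ L → ev (nφ s₀ φ a b 0) T = ev φ T →
        HasDerivAt (fun τ => ev (nφ s₀ φ a b τ) T) 0 0 →
        ev (nφ s₀ φ a b 0) (s₀ :: T) = ev φ (s₀ :: T) ∧
        HasDerivAt (fun τ => ev (nφ s₀ φ a b τ) (s₀ :: T))
          (deriv (φ s₀) (ev φ T) * v (ev φ T)) 0 := by
      intro T hT h0 hd
      have hx := hev T (hsl T hT)
      have e : ∀ τ, ev (nφ s₀ φ a b τ) (s₀ :: T) = φ s₀ (a τ (ev (nφ s₀ φ a b τ) T)) := by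
        intro τ; simp [ev, nφ]
      have z := P.zero _ (hIoo _ hx)
      refine ⟨by rw [e, h0, z]; rfl, ?_⟩
      simp only [e]
      have h1 := P.curve hd (by rw [h0]; exact hIoo _ hx)
      rw [h0, add_zero] at h1
      have h2 : HasDerivAt (φ s₀) (deriv (φ s₀) (ev φ T)) (a 0 (ev (nφ s₀ φ a b 0) T)) := by
        rw [h0, z]; exact (H.diff s₀ _ hx).hasDerivAt
      exact h2.comp 0 h1
    have hsuf : ∀ T, T <:+ L → ev (nφ s₀ φ a b 0) T = ev φ T ∧
        HasDerivAt (fun τ => ev (nφ s₀ φ a b τ) T) 0 0 := by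
      intro T
      induction T with
      | nil => intro _; exact ⟨rfl, hasDerivAt_const _ _⟩
      | cons s T ihT =>
        intro hT
        have hTL : T <:+ L := (List.suffix_cons s T).trans hT
        have hTne : T ≠ L := by
          rintro rfl
          have := hT.length_le
          simp at this
        obtain ⟨h0, hd⟩ := ihT hTL
        have hx := hev T (hsl T hTL)
        by_cases hs : s = s₀
        · subst hs
          have := step0 T hTL h0 hd
          rwa [hvT T hTL hTne, mul_zero] at this
        · by_cases hs' : s = bar s₀
          · have hne : s :: T ≠ L := by
              rintro rfl
              have hc := List.isChain_cons_cons.1 hL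
              have := hc.1 (by rw [hs']; rfl)
              rw [hs'] at this
              simp [bar] at this
            have e : ∀ τ, ev (nφ s₀ φ a b τ) (s :: T) = b τ (φ s (ev (nφ s₀ φ a b τ) T)) := by
              intro τ; subst hs'; simp [ev, nφ, bar_ne]
            have hx' := hev (s :: T) (hsl _ hT)
            have z := Q.zero _ (hIoo _ hx')
            have h2 : HasDerivAt (φ s) (deriv (φ s) (ev φ T)) (ev (nφ s₀ φ a b 0) T) := by
              rw [h0]; exact (H.diff s _ hx).hasDerivAt
            have h3 := h2.comp 0 hd
            rw [mul_zero] at h3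
            have e3 : (φ s ∘ fun τ => ev (nφ s₀ φ a b τ) T) 0 = ev φ (s :: T) := by
              simp only [Function.comp, h0]; rfl
            have h4 := Q.curve h3 (by rw [e3]; exact hIoo _ hx')
            rw [e3, Pi.neg_apply, hvT _ hT hne, neg_zero, add_zero] at h4
            refine ⟨?_, ?_⟩
            · rw [e, h0]; exact z
            · simp only [e]; exact h4
          · have e : ∀ τ, ev (nφ s₀ φ a b τ) (s :: T) = φ s (ev (nφ s₀ φ a b τ) T) := by
              intro τ; simp [ev, nφ, hs, hs']
            have h2 : HasDerivAt (φ s) (deriv (φ s) (ev φ T)) (ev (nφ s₀ φ a b 0) T) := by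
              rw [h0]; exact (H.diff s _ hx).hasDerivAt
            have h3 := h2.comp 0 hd
            rw [mul_zero] at h3
            refine ⟨?_, ?_⟩
            · rw [e, h0]; rfl
            · simp only [e]; exact h3
    have hfin : {T : List (α × Bool) | T <:+ L}.Finite := by
      have := List.finite_toSet L.tails
      simpa using this
    obtain ⟨hL0, hLd⟩ := step0 L List.suffix_rfl (hsuf L List.suffix_rfl).1
      (hsuf L List.suffix_rfl).2
    have hdne : deriv (φ s₀) (ev φ L) * v (ev φ L) ≠ 0 :=
      mul_ne_zero (H.deriv_ne hr'1 s₀ (hev L (by omega)) (hev (s₀ :: L) (by simp))) hvy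
    have E1 : ∀ᶠ τ in 𝓝[≠] (0:ℝ), ∀ T ∈ {T : List (α × Bool) | T <:+ L},
        ∀ T' ∈ {T : List (α × Bool) | T <:+ L}, T ≠ T' →
          ev (nφ s₀ φ a b τ) T ≠ ev (nφ s₀ φ a b τ) T' := by
      refine (eventually_all_finite hfin).2 (fun T hT => (eventually_all_finite hfin).2
        (fun T' hT' => ?_))
      by_cases hne : T = T'
      · exact Eventually.of_forall (fun _ h => (h hne).elim)
      · have c1 := (hsuf T hT).2.continuousAt
        have c2 := (hsuf T' hT').2.continuousAt
        have h3 : ev (nφ s₀ φ a b 0) T ≠ ev (nφ s₀ φ a b 0) T' := by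
          rw [(hsuf T hT).1, (hsuf T' hT').1]
          exact fun h => hne (hinj T T' hT hT' h)
        have := (c1.sub c2).eventually_ne (y := 0) (sub_ne_zero.2 h3)
        exact (this.filter_mono nhdsWithin_le_nhds).mono (fun τ h _ he => h (by simp [he]))
    have E2 : ∀ᶠ τ in 𝓝[≠] (0:ℝ), ∀ T ∈ {T : List (α × Bool) | T <:+ L},
        ev (nφ s₀ φ a b τ) (s₀ :: L) ≠ ev (nφ s₀ φ a b τ) T := by
      refine (eventually_all_finite hfin).2 (fun T hT => ?_)
      have hd := hLd.sub (hsuf T hT).2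
      rw [sub_zero] at hd
      have := hd.eventually_ne (c := 0) hdne
      exact this.mono (fun τ h he => h (by simp [he]))
    have E3 := (P.unif hr'1 hδ0).filter_mono (nhdsWithin_le_nhds (s := {(0:ℝ)}ᶜ))
    have E4 := (Q.unif hr'1 hδ0).filter_mono (nhdsWithin_le_nhds (s := {(0:ℝ)}ᶜ))
    obtain ⟨τ, e1, e2, e3, e4⟩ := (E1.and (E2.and (E3.and E4))).exists
    have H' := assign_new (s₀ := s₀) H h a b τ hδ0 hδ2 (P.mem τ) e3 e4
    refine ⟨_, _, ⟨H'.mem, H'.inv, H'.conv, fun s y hy => (H'.small s y hy).trans_le hδ1,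
      H'.diff⟩, ?_⟩
    intro T T' hT hT' he
    rcases List.suffix_cons_iff.1 hT with rfl | hT
    · rcases List.suffix_cons_iff.1 hT' with rfl | hT'
      · rfl
      · exact (e2 T' hT' he).elim
    · rcases List.suffix_cons_iff.1 hT' with rfl | hT'
      · exact (e2 T hT he.symm).elim
      · by_contra hne
        exact e1 T hT T' hT' hne he

lemma no_law (hsep : Sep Γ) (w : FreeGroup α) (hw : w ≠ 1)
    (hlaw : ∀ φ : FreeGroup α →* Γ, φ w = 1) : False := by
  set L := w.toWord with hLdef
  have hlen : (0:ℝ) < L.length + 1 := by positivity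
  have hδ : (0:ℝ) < 1 / 2 / (L.length + 1) := by positivity
  obtain ⟨γ, φ, H, hinj⟩ := main_ind hsep L FreeGroup.isReduced_toWord (1/2)
    (1 / 2 / (L.length + 1)) (by norm_num) (by norm_num) hδ
  have hl : L.length * (1 / 2 / ((L.length:ℝ) + 1)) ≤ 1 / 2 := by
    rw [mul_div_assoc', div_le_iff₀ hlen]
    linarith
  have hc := H.conv_ev hδ L hl
  have hp : ∀ N, (L.map (fun s => γ s N)).prod = 1 := by
    intro N
    have h1 := hlaw (FreeGroup.lift (fun x => (⟨γ (x, true) N, H.mem _ _⟩ : Γ)))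
    rw [← FreeGroup.mk_toWord (x := w), FreeGroup.lift_mk] at h1
    have h2 := congrArg Γ.subtype h1
    rw [map_list_prod, map_one, List.map_map] at h2
    rw [← h2]
    congr 1
    refine List.map_congr_left (fun s _ => ?_)
    obtain ⟨x, c⟩ := s
    cases c
    · simpa [bar] using H.inv (x, true) N
    · simp
  simp only [hp] at hc
  have h2 := conv_one_unique (by norm_num) hc
  have := hinj L [] List.suffix_rfl (List.nil_suffix) h2
  exact hw (FreeGroup.toWord_eq_nil_iff.1 this)

end step

lemma final (hΓ : ∀ f ∈ Γ, IsAnalyticDiffeo f) (hlaw : SatisfiesLaw Γ) : Group.IsSolvable Γ := by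
  obtain ⟨n, hn, w, hw, hφ⟩ := hlaw
  have two : ∀ f ∈ Γ, ∀ g ∈ Γ, ∀ i j : ℕ, ∀ a b : ℝ, 1 ≤ i → i < j → a ≠ 0 → b ≠ 0 →
      ord i f a → ord j g b → False := by
    intro f hf g hg i j a b hi hij ha hb hfa hgb
    refine no_law (Γ := Γ) ?_ w hw hφ
    intro A hA y hy hyA
    exact separate hi hij hfa hgb ha hb hf hg A hA y hy hyA
  by_cases hex : ∃ f ∈ Γ, dl f 1 ∧ f ≠ 1
  · obtain ⟨f, hf, hf1, hfne⟩ := hex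
    obtain ⟨k, hk, a, ha, hka⟩ := ord_of_analytic (hΓ f hf) hf1 hfne
    refine solvable_of_same Γ hΓ k hk (fun g hg hg1 hgne => ?_)
    obtain ⟨l, hl, b, hb, hlb⟩ := ord_of_analytic (hΓ g hg) hg1 hgne
    rcases lt_trichotomy k l with hkl | rfl | hkl
    · exact (two f hf g hg k l a b hk hkl ha hb hka hlb).elim
    · exact ⟨b, hb, hlb⟩
    · exact (two g hg f hf l k b a hl hkl hb ha hlb hka).elim
  · exact solvable_of_same Γ hΓ 1 le_rfl (fun g hg hg1 hgne => (hex ⟨g, hg, hg1, hgne⟩).elim)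

end AnLaw

/-- **Theorem A.** Every subgroup of `Diff^ω_+([0,1])` satisfying a nontrivial law
is solvable. -/
theorem solvable_of_satisfiesLaw_of_analytic
    (Γ : Subgroup (↥(Set.Icc (0:ℝ) 1) ≃o ↥(Set.Icc (0:ℝ) 1)))
    (hΓ : ∀ f ∈ Γ, IsAnalyticDiffeo f)
    (hlaw : SatisfiesLaw ↥Γ) :
    IsSolvable ↥Γ := by
  exact AnLaw.final hΓ hlaw
end

section
/- Every virtually solvable subgroup of Diff^ω_+([0,1]) is solvable. -/
open Filter Topology
open scoped commutatorElement

abbrev EI := ↥(Set.Icc (0:ℝ) 1) ≃o ↥(Set.Icc (0:ℝ) 1)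

/-- the real extension -/
noncomputable def rf (f : EI) : ℝ → ℝ :=
  fun x => ((f (Set.projIcc 0 1 zero_le_one x) : ↥(Set.Icc (0:ℝ) 1)) : ℝ)

lemma rf_mem (f : EI) (x : ℝ) : rf f x ∈ Set.Icc (0:ℝ) 1 := Subtype.coe_prop _

lemma rf_eq (f : EI) {x : ℝ} (hx : x ∈ Set.Icc (0:ℝ) 1) : rf f x = f ⟨x, hx⟩ := by
  simp only [rf, Set.projIcc_of_mem _ hx]

lemma rf_mul (f g : EI) (x : ℝ) : rf (f * g) x = rf f (rf g x) := by
  rw [rf_eq f (rf_mem g x)]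
  rfl

lemma rf_one {x : ℝ} (hx : x ∈ Set.Icc (0:ℝ) 1) : rf 1 x = x := by
  rw [rf_eq _ hx]; rfl

lemma rf_inj {f g : EI} (h : ∀ x ∈ Set.Icc (0:ℝ) 1, rf f x = rf g x) : f = g := by
  ext x
  have := h x x.2
  rwa [rf_eq f x.2, rf_eq g x.2] at this

lemma rf_lt (f : EI) {x y : ℝ} (hx : x ∈ Set.Icc (0:ℝ) 1) (hy : y ∈ Set.Icc (0:ℝ) 1)
    (h : x < y) : rf f x < rf f y := by
  rw [rf_eq f hx, rf_eq f hy]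
  have : (⟨x, hx⟩ : ↥(Set.Icc (0:ℝ) 1)) < ⟨y, hy⟩ := h
  exact_mod_cast f.strictMono this

lemma rf_zero (f : EI) : rf f 0 = 0 := by
  rw [rf_eq f ⟨le_rfl, zero_le_one⟩]
  have : f (⊥ : ↥(Set.Icc (0:ℝ) 1)) = ⊥ := f.map_bot
  exact congrArg Subtype.val this

lemma ev_mem : ∀ᶠ x : ℝ in 𝓝[>] 0, x ∈ Set.Icc (0:ℝ) 1 := by
  filter_upwards [Ioo_mem_nhdsGT (zero_lt_one' ℝ)] with x hx
  exact ⟨hx.1.le, hx.2.le⟩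

lemma rf_pos (f : EI) : ∀ᶠ x : ℝ in 𝓝[>] 0, 0 < rf f x := by
  filter_upwards [ev_mem, self_mem_nhdsWithin] with x hx h0
  have := rf_lt f ⟨le_rfl, zero_le_one⟩ hx h0
  rwa [rf_zero] at this

lemma rf_cont (f : EI) : Continuous (rf f) := by
  unfold rf
  exact continuous_subtype_val.comp (f.continuous.comp continuous_projIcc)

lemma rf_tendsto (f : EI) : Tendsto (rf f) (𝓝[>] 0) (𝓝[>] 0) := by
  refine tendsto_nhdsWithin_iff.2 ⟨?_, rf_pos f⟩
  have := (rf_cont f).tendsto 0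
  rw [rf_zero] at this
  exact this.mono_left nhdsWithin_le_nhds

/-- leading term -/
def Lead (f : EI) (n : ℕ) (A : ℝ → ℝ) : Prop :=
  AnalyticAt ℝ A 0 ∧ A 0 ≠ 0 ∧ ∀ᶠ x in 𝓝[>] (0:ℝ), rf f x = x + x ^ n * A x

lemma exists_lead {f : EI} (hf : IsAnalyticDiffeo f) (h1 : f ≠ 1) : ∃ n A, Lead f n A := by
  obtain ⟨F, -, hF, -, -, -, hfF, -⟩ := hf
  have hrF : ∀ x ∈ Set.Icc (0:ℝ) 1, rf f x = F x := fun x hx => by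
    rw [rf_eq f hx, hfF]
  have hD : AnalyticOnNhd ℝ (fun x => F x - x) (Set.Icc 0 1) := hF.sub analyticOnNhd_id
  have h0 : (0:ℝ) ∈ Set.Icc (0:ℝ) 1 := ⟨le_rfl, zero_le_one⟩
  by_cases hz : ∀ᶠ x in 𝓝 (0:ℝ), F x - x = 0
  · exfalso
    apply h1
    apply rf_inj
    intro x hx
    have := hD.eqOn_zero_of_preconnected_of_eventuallyEq_zero isPreconnected_Icc h0 hz hx
    rw [rf_one hx, hrF x hx]
    simpa [sub_eq_zero] using this
  · obtain ⟨n, A, hA, hA0, hE⟩ := (hD 0 h0).exists_eventuallyEq_pow_smul_nonzero_iff.2 hz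
    refine ⟨n, A, hA, hA0, ?_⟩
    filter_upwards [ev_mem, hE.filter_mono nhdsWithin_le_nhds] with x hx hx2
    rw [hrF x hx]
    simp at hx2
    linarith

/-- tangent to identity -/
def Tgt (f : EI) : Prop := Tendsto (fun x => rf f x / x) (𝓝[>] 0) (𝓝 1)

lemma exists_lead2 {f : EI} (hf : IsAnalyticDiffeo f) (h1 : f ≠ 1) (ht : Tgt f) :
    ∃ r A, 1 ≤ r ∧ Lead f (r + 1) A := by
  obtain ⟨n, A, hA, hA0, hE⟩ := exists_lead hf h1
  have hn : 2 ≤ n := by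
    by_contra hn
    have hx0 : Tendsto (fun x : ℝ => x) (𝓝[>] 0) (𝓝 0) := nhdsWithin_le_nhds
    have hAt : Tendsto A (𝓝[>] 0) (𝓝 (A 0)) :=
      hA.continuousAt.tendsto.mono_left nhdsWithin_le_nhds
    have hpos : ∀ᶠ x : ℝ in 𝓝[>] 0, 0 < x := self_mem_nhdsWithin
    apply hA0
    have : Tendsto (fun x => x ^ (1 - n) * (rf f x / x - 1)) (𝓝[>] 0) (𝓝 (0 ^ (1 - n) * (1 - 1))) :=
      (hx0.pow _).mul (ht.sub_const 1)
    rw [sub_self, mul_zero] at this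
    refine tendsto_nhds_unique hAt (this.congr' ?_)
    filter_upwards [hE, hpos] with x hx h0
    rw [hx]
    have : n = 0 ∨ n = 1 := by omega
    rcases this with rfl | rfl <;> field_simp <;> simp
  obtain ⟨r, rfl⟩ : ∃ r, n = r + 1 := ⟨n - 1, by omega⟩
  exact ⟨r, A, by omega, hA, hA0, hE⟩

lemma key_limit {A B : ℝ → ℝ} (p r : ℕ) (hr : 1 ≤ r) (hA : AnalyticAt ℝ A 0)
    (hB : ContinuousAt B 0) :
    Tendsto (fun x => ((x + x ^ (r + 1) * B x) ^ p * A (x + x ^ (r + 1) * B x) - x ^ p * A x)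
      / x ^ (p + r)) (𝓝[>] 0) (𝓝 (p * A 0 * B 0)) := by
  have hx0 : Tendsto (fun x : ℝ => x) (𝓝[>] 0) (𝓝 0) := nhdsWithin_le_nhds
  have hpos : ∀ᶠ x : ℝ in 𝓝[>] 0, 0 < x := self_mem_nhdsWithin
  have hAt := hA.continuousAt.tendsto
  have hBt : Tendsto B (𝓝[>] 0) (𝓝 (B 0)) := hB.tendsto.mono_left nhdsWithin_le_nhds
  have hu : Tendsto (fun x => 1 + x ^ r * B x) (𝓝[>] 0) (𝓝 1) := by
    have := ((hx0.pow r).mul hBt).const_add 1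
    rwa [zero_pow (by omega), zero_mul, add_zero] at this
  have hy : Tendsto (fun x => x + x ^ (r + 1) * B x) (𝓝[>] 0) (𝓝 0) := by
    have := hx0.add ((hx0.pow (r+1)).mul hBt)
    rwa [zero_pow (by omega), zero_mul, add_zero] at this
  have h2 : Tendsto (fun x => (A (x + x ^ (r + 1) * B x) - A x) / x ^ r) (𝓝[>] 0) (𝓝 0) := by
    have hO := hA.hasStrictDerivAt.isBigO_sub
    have hO2 : (fun x => A (x + x ^ (r + 1) * B x) - A x) =O[𝓝[>] 0]
        fun x => x ^ (r + 1) * B x := by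
      have := hO.comp_tendsto (k := fun x => (x + x ^ (r + 1) * B x, x)) (l' := 𝓝[>] 0)
        (by rw [nhds_prod_eq]; exact hy.prodMk hx0)
      simpa [Function.comp_def] using this
    have hO3 : (fun x => (A (x + x ^ (r + 1) * B x) - A x) / x ^ r) =O[𝓝[>] 0]
        fun x => x * B x := by
      refine (hO2.mul (Asymptotics.isBigO_refl (fun x : ℝ => (x ^ r)⁻¹) _)).congr' ?_ ?_
      · exact Eventually.of_forall fun x => (div_eq_mul_inv _ _).symm
      · filter_upwards [hpos] with x hx
        rw [pow_succ]
        field_simp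
    refine hO3.trans_tendsto ?_
    simpa using hx0.mul hBt
  have h1 : Tendsto (fun x => B x * (∑ i ∈ Finset.range p, (1 + x ^ r * B x) ^ i)
      * A (x + x ^ (r + 1) * B x)) (𝓝[>] 0) (𝓝 (B 0 * (∑ i ∈ Finset.range p, 1 ^ i) * A 0)) :=
    (hBt.mul (tendsto_finsetSum _ fun i _ => hu.pow i)).mul (hAt.comp hy)
  have h3 := h1.add h2
  have e : B 0 * (∑ i ∈ Finset.range p, (1:ℝ) ^ i) * A 0 + 0 = p * A 0 * B 0 := by
    simp; ring
  rw [e] at h3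
  refine h3.congr' ?_
  filter_upwards [hpos] with x hx
  have hg := mul_geom_sum (1 + x ^ r * B x) p
  rw [add_sub_cancel_left] at hg
  have e2 : x + x ^ (r + 1) * B x = x * (1 + x ^ r * B x) := by ring
  have e3 : (x + x ^ (r + 1) * B x) ^ p = x ^ p * (x ^ r * B x *
      (∑ i ∈ Finset.range p, (1 + x ^ r * B x) ^ i) + 1) := by
    rw [e2, mul_pow, hg]; ring
  rw [e3, pow_add]
  field_simp
  ring

/-- limit for diffeos -/
lemma key_limit' {f g : EI} {r s : ℕ} {A B : ℝ → ℝ} (hs : 1 ≤ s)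
    (hf : Lead f (r + 1) A) (hg : Lead g (s + 1) B) :
    Tendsto (fun x => (rf f (rf g x) - rf g x - rf f x + x) / x ^ (r + 1 + s)) (𝓝[>] 0)
      (𝓝 (((r + 1 : ℕ) : ℝ) * A 0 * B 0)) := by
  refine (key_limit (r + 1) s hs hf.1 hg.1.continuousAt).congr' ?_
  filter_upwards [hf.2.2, hg.2.2, (rf_tendsto g).eventually hf.2.2] with x h1 h2 h3
  rw [h3, h1, ← h2]
  ring

lemma lead_eq_of_commute {f g : EI} {r s : ℕ} {A B : ℝ → ℝ} (hr : 1 ≤ r) (hs : 1 ≤ s)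
    (hf : Lead f (r + 1) A) (hg : Lead g (s + 1) B) (hc : f * g = g * f) : r = s := by
  have h1 := key_limit' hs hf hg
  have h2 := key_limit' hr hg hf
  have h3 := tendsto_nhds_unique h1 (h2.congr fun x => by
    rw [← rf_mul, ← rf_mul, hc, show s + 1 + r = r + 1 + s by ring]
    ring)
  have hA := hf.2.1
  have hB := hg.2.1
  have h4 : (((r + 1 : ℕ) : ℝ) - ((s + 1 : ℕ) : ℝ)) * (A 0 * B 0) = 0 := by linear_combination h3
  rcases mul_eq_zero.1 h4 with h | h
  · have : ((r + 1 : ℕ) : ℝ) = ((s + 1 : ℕ) : ℝ) := by linarith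
    have := Nat.cast_injective this
    omega
  · exact absurd h (mul_ne_zero hA hB)

lemma lead_comm {c a h : EI} {r s : ℕ} {A B C : ℝ → ℝ} (hr : 1 ≤ r) (hs : 1 ≤ s)
    (hc : Lead c (r + 1) C) (ha : Lead a (r + 1) A) (hh : Lead h (s + 1) B) (ht : Tgt (a * h))
    (e : c * (a * h) = h * a) : False := by
  have h1 := key_limit' hs ha hh
  have h2 := key_limit' hr hh ha
  have hx0 : Tendsto (fun x : ℝ => x) (𝓝[>] 0) (𝓝 0) := nhdsWithin_le_nhds
  have hpos : ∀ᶠ x : ℝ in 𝓝[>] 0, 0 < x := self_mem_nhdsWithin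
  have h3 := (hx0.pow s).mul (h2.sub h1)
  rw [zero_pow (by omega), zero_mul] at h3
  have hC : Tendsto (fun x => C (rf (a * h) x)) (𝓝[>] 0) (𝓝 (C 0)) :=
    hc.1.continuousAt.tendsto.comp ((rf_tendsto (a * h)).mono_right nhdsWithin_le_nhds)
  have h4 := (ht.pow (r + 1)).mul hC
  rw [one_pow, one_mul] at h4
  refine hc.2.1 (tendsto_nhds_unique h4 (h3.congr' ?_))
  filter_upwards [hpos, (rf_tendsto (a * h)).eventually hc.2.2] with x hx h5
  rw [← rf_mul, e] at h5
  rw [← rf_mul, ← rf_mul, h5, show s + 1 + r = r + 1 + s by ring, pow_add x (r + 1) s, div_pow]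
  field_simp
  ring

/-- trichotomy -/
lemma lt_or_gt {f g : EI} (h : IsAnalyticDiffeo (f⁻¹ * g)) (hne : f ≠ g) :
    (∀ᶠ x in 𝓝[>] (0:ℝ), rf f x < rf g x) ∨ (∀ᶠ x in 𝓝[>] (0:ℝ), rf g x < rf f x) := by
  obtain ⟨n, A, hA, hA0, hE⟩ := exists_lead h (by
    intro h; exact hne (inv_mul_eq_one.1 h))
  have hpos : ∀ᶠ x : ℝ in 𝓝[>] 0, 0 < x := self_mem_nhdsWithin
  have hAt : Tendsto A (𝓝[>] 0) (𝓝 (A 0)) :=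
    hA.continuousAt.tendsto.mono_left nhdsWithin_le_nhds
  have hfg : ∀ x, rf g x = rf f (rf (f⁻¹ * g) x) := fun x => by
    rw [← rf_mul, mul_inv_cancel_left]
  rcases lt_or_gt_of_ne hA0 with h0 | h0
  · right
    filter_upwards [hE, hpos, hAt.eventually_lt_const h0, ev_mem] with x h1 h2 h3 h4
    rw [hfg]
    apply rf_lt _ (rf_mem _ _) h4
    rw [h1]
    nlinarith [mul_neg_of_pos_of_neg (pow_pos h2 n) h3]
  · left
    filter_upwards [hE, hpos, hAt.eventually_const_lt h0, ev_mem] with x h1 h2 h3 h4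
    rw [hfg]
    apply rf_lt _ h4 (rf_mem _ _)
    rw [h1]
    nlinarith [mul_pos (pow_pos h2 n) h3]

lemma pow_lt {f g : EI} (h : ∀ᶠ x in 𝓝[>] (0:ℝ), rf f x < rf g x) (n : ℕ) :
    ∀ᶠ x in 𝓝[>] (0:ℝ), rf (f ^ (n + 1)) x < rf (g ^ (n + 1)) x := by
  induction n with
  | zero => simpa using h
  | succ n ih =>
    filter_upwards [ih, (rf_tendsto (g ^ (n + 1))).eventually h] with x h1 h2
    rw [pow_succ' f (n + 1), pow_succ' g (n + 1), rf_mul, rf_mul]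
    exact (rf_lt f (rf_mem _ _) (rf_mem _ _) h1).trans h2

lemma pow_inj' {f g : EI} (h : IsAnalyticDiffeo (f⁻¹ * g)) {n : ℕ} (hn : n ≠ 0)
    (e : f ^ n = g ^ n) : f = g := by
  obtain ⟨m, rfl⟩ := Nat.exists_eq_succ_of_ne_zero hn
  by_contra hne
  rcases lt_or_gt h hne with h | h
  · obtain ⟨x, hx⟩ := (pow_lt h m).exists
    rw [Nat.succ_eq_add_one] at e
    rw [e] at hx
    exact lt_irrefl _ hx
  · obtain ⟨x, hx⟩ := (pow_lt h m).exists
    rw [Nat.succ_eq_add_one] at e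
    rw [e] at hx
    exact lt_irrefl _ hx

lemma exists_mult {f : EI} (hf : IsAnalyticDiffeo f) :
    ∃ c, Tendsto (fun x => rf f x / x) (𝓝[>] 0) (𝓝 c) := by
  obtain ⟨F, -, hF, -, -, -, hfF, -⟩ := hf
  have h0 : (0:ℝ) ∈ Set.Icc (0:ℝ) 1 := ⟨le_rfl, zero_le_one⟩
  have hrF : ∀ x ∈ Set.Icc (0:ℝ) 1, rf f x = F x := fun x hx => by
    rw [rf_eq f hx, hfF]
  have hF0 : F 0 = 0 := by rw [← hrF 0 h0, rf_zero]
  refine ⟨deriv F 0, ?_⟩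
  have := (hF 0 h0).differentiableAt.hasDerivAt.tendsto_slope
  refine (this.mono_left (nhdsWithin_mono _ fun x hx => (ne_of_gt hx : x ≠ 0))).congr' ?_
  filter_upwards [ev_mem] with x hx
  rw [hrF x hx, slope_def_field, hF0, sub_zero, sub_zero]

lemma tendsto_mult_mul {f g : EI} {c d : ℝ} (hf : Tendsto (fun x => rf f x / x) (𝓝[>] 0) (𝓝 c))
    (hg : Tendsto (fun x => rf g x / x) (𝓝[>] 0) (𝓝 d)) :
    Tendsto (fun x => rf (f * g) x / x) (𝓝[>] 0) (𝓝 (c * d)) := by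
  refine ((hf.comp (rf_tendsto g)).mul hg).congr' ?_
  filter_upwards [rf_pos g] with x hx
  simp only [Function.comp, rf_mul]
  field_simp

lemma tgt_one : Tgt 1 := by
  refine tendsto_const_nhds.congr' ?_
  have hpos : ∀ᶠ x : ℝ in 𝓝[>] 0, 0 < x := self_mem_nhdsWithin
  filter_upwards [ev_mem, hpos] with x hx h0
  rw [rf_one hx, div_self h0.ne']

/-- abstract step -/
lemma comm_of_ord {S : Type*} [Group S] [hS : Group.IsSolvable S] (o : S → ℕ)
    (h1 : ∀ f g : S, f ≠ 1 → g ≠ 1 → f * g = g * f → o f = o g)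
    (h2 : ∀ h a : S, a ≠ 1 → ⁅h, a⁆ ≠ 1 → o ⁅h, a⁆ ≠ o a) (f g : S) : f * g = g * f := by
  classical
  obtain ⟨n, hn⟩ := hS.solvable
  by_cases htriv : derivedSeries S 0 = ⊥
  · have : ∀ x : S, x = 1 := fun x => by
      have : x ∈ derivedSeries S 0 := by simp
      rw [htriv] at this
      exact this
    rw [this f, this g]
  have hex : ∃ n, derivedSeries S n = ⊥ := ⟨n, hn⟩
  obtain ⟨m, hm⟩ : ∃ m, Nat.find hex = m + 1 := Nat.exists_eq_succ_of_ne_zero (by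
    intro h; apply htriv; rw [← h]; exact Nat.find_spec hex)
  have hm1 : derivedSeries S (m + 1) = ⊥ := hm ▸ Nat.find_spec hex
  have hm0 : derivedSeries S m ≠ ⊥ := Nat.find_min hex (by omega)
  have hab : ∀ x ∈ derivedSeries S m, ∀ y ∈ derivedSeries S m, x * y = y * x := by
    intro x hx y hy
    have : ⁅x, y⁆ ∈ derivedSeries S (m + 1) := Subgroup.commutator_mem_commutator hx hy
    rw [hm1, Subgroup.mem_bot] at this
    exact commutatorElement_eq_one_iff_mul_comm.1 this
  obtain ⟨a, ha, ha1⟩ := Subgroup.ne_bot_iff_exists_ne_one.1 hm0 |>.elim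
    fun a h => (⟨a.1, a.2, fun e => h (Subtype.ext e)⟩ : ∃ a ∈ derivedSeries S m, a ≠ 1)
  have hcen : ∀ h : S, h * a = a * h := by
    intro h
    apply commutatorElement_eq_one_iff_mul_comm.1
    by_contra hc
    have hmem : ⁅h, a⁆ ∈ derivedSeries S m := by
      rw [commutatorElement_def]
      exact mul_mem ((derivedSeries_normal S m).conj_mem a ha h) (inv_mem ha)
    exact h2 h a ha1 hc (h1 _ _ hc ha1 (hab _ hmem _ ha))
  apply commutatorElement_eq_one_iff_mul_comm.1
  by_contra hc
  have hg : g ≠ 1 := by rintro rfl; simp at hc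
  exact h2 f g hg hc ((h1 _ _ hc ha1 (hcen _)).trans (h1 _ _ hg ha1 (hcen _)).symm)

/-- Every virtually solvable subgroup of `Diff^ω_+([0,1])` is solvable. -/
theorem solvable_of_virtuallySolvable_of_analytic
    (Γ : Subgroup (↥(Set.Icc (0:ℝ) 1) ≃o ↥(Set.Icc (0:ℝ) 1)))
    (hΓ : ∀ f ∈ Γ, IsAnalyticDiffeo f)
    (hvs : ∃ H : Subgroup ↥Γ, IsSolvable ↥H ∧ H.FiniteIndex) :
    IsSolvable ↥Γ := by
  classical
  obtain ⟨H, hH, hfi⟩ := hvs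
  have hH : Group.IsSolvable ↥H := hH
  choose! c hc using fun f : Γ => exists_mult (hΓ f f.2)
  let φ : Γ →* ℝ :=
    { toFun := c
      map_one' := tendsto_nhds_unique (hc 1) tgt_one
      map_mul' := fun f g => tendsto_nhds_unique (hc (f * g)) (tendsto_mult_mul (hc f) (hc g)) }
  let ψ : Γ →* ℝˣ := φ.toHomUnits
  have hker : ∀ f ∈ ψ.ker, Tgt (f : EI) := by
    intro f hf
    have h1 : c f = 1 := congrArg Units.val (MonoidHom.mem_ker.1 hf)
    have := hc f
    rwa [h1] at this
  -- order function
  have hord : ∀ f : Γ, ∃ r : ℕ, f ∈ ψ.ker → f ≠ 1 → ∃ A, 1 ≤ r ∧ Lead (f : EI) (r + 1) A := by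
    intro f
    by_cases h : f ∈ ψ.ker ∧ f ≠ 1
    · obtain ⟨r, A, h1, h2⟩ := exists_lead2 (hΓ f f.2)
        (fun e => h.2 (Subtype.ext e)) (hker f h.1)
      exact ⟨r, fun _ _ => ⟨A, h1, h2⟩⟩
    · exact ⟨0, fun a b => absurd ⟨a, b⟩ h⟩
  choose o ho using hord
  have hL : Group.IsSolvable ↥(H ⊓ ψ.ker) :=
    Group.isSolvable_of_isSolvable_injective (Subgroup.inclusion_injective (inf_le_left : H ⊓ ψ.ker ≤ H))
  have hLc : ∀ f g : ↥(H ⊓ ψ.ker), f * g = g * f := by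
    apply comm_of_ord (fun f => o f.1)
    · intro f g hf hg hfg
      obtain ⟨A, hr, hA⟩ := ho f.1 f.2.2 (fun e => hf (Subtype.ext e))
      obtain ⟨B, hs, hB⟩ := ho g.1 g.2.2 (fun e => hg (Subtype.ext e))
      exact lead_eq_of_commute hr hs hA hB
        (congrArg (fun z : ↥(H ⊓ ψ.ker) => ((z : Γ) : EI)) hfg)
    · intro h a ha hcm he
      have hh : h ≠ 1 := by rintro rfl; simp at hcm
      obtain ⟨C, hr, hC⟩ := ho _ (⁅h, a⁆).2.2 (fun e => hcm (Subtype.ext e))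
      obtain ⟨A, hr', hA⟩ := ho a.1 a.2.2 (fun e => ha (Subtype.ext e))
      obtain ⟨B, hs, hB⟩ := ho h.1 h.2.2 (fun e => hh (Subtype.ext e))
      rw [he] at hC
      refine lead_comm hr' hs hC hA hB (hker (a.1 * h.1) (mul_mem a.2.2 h.2.2)) ?_
      have : ⁅h, a⁆ * (a * h) = h * a := by rw [commutatorElement_def]; group
      exact congrArg (fun z : ↥(H ⊓ ψ.ker) => ((z : Γ) : EI)) this
  have hroot : ∀ (f g : Γ) (n : ℕ), n ≠ 0 → Commute (f ^ n) g → Commute f g := by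
    intro f g n hn hcm
    have e1 : (g * f * g⁻¹) ^ n = f ^ n := by
      rw [conj_pow, ← hcm.eq, mul_inv_cancel_right]
    have e2 : ((g * f * g⁻¹ : Γ) : EI) = f :=
      pow_inj' (hΓ _ ((g * f * g⁻¹)⁻¹ * f).2) hn (congrArg Subtype.val e1)
    have e3 : g * f * g⁻¹ = f := Subtype.ext e2
    exact (mul_inv_eq_iff_eq_mul.1 e3).symm
  have hKc : ∀ f ∈ ψ.ker, ∀ g ∈ ψ.ker, f * g = g * f := by
    intro f hf g hg
    obtain ⟨n, hn, -, hfn⟩ := Subgroup.exists_pow_mem_of_index_ne_zero hfi.index_ne_zero f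
    obtain ⟨m, hm, -, hgm⟩ := Subgroup.exists_pow_mem_of_index_ne_zero hfi.index_ne_zero g
    have h1 : Commute (f ^ n) (g ^ m) := congrArg Subtype.val
      (hLc ⟨f ^ n, hfn, pow_mem hf n⟩ ⟨g ^ m, hgm, pow_mem hg m⟩)
    have h2 : Commute f (g ^ m) := hroot _ _ n (by omega) h1
    exact (hroot _ _ m (by omega) h2.symm).symm
  have hK : Group.IsSolvable ↥ψ.ker :=
    Group.isSolvable_of_comm fun f g => Subtype.ext (hKc f f.2 g g.2)
  exact Group.isSolvable_of_ker_le_range ψ.ker.subtype ψ (by simp)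
end

section
/- Let Γ be a finitely generated group of orientation-preserving homeomorphisms of the real line acting without a global fixed point. Suppose that for every pair of reals c < c' there exist reals a, b, a', b' with a < c < c' < b and a' < b' such that no g ∈ Γ satisfies both g(a) < a' and g(b) > b'. Then either Γ admits a surjective group homomorphism onto ℤ, or Γ contains a subgroup isomorphic to the free group on two generators. -/
section helpers
variable {L : Type*} [LinearOrder L] {G : Type*} [Group G] (ρ : G →* (L ≃o L))

lemma act_mul (g h : G) (x : L) : ρ (g * h) x = ρ g (ρ h x) := by
  rw [map_mul]; rfl

lemma act_one (x : L) : ρ 1 x = x := by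
  rw [map_one]; rfl

lemma act_inv_self (g : G) (x : L) : ρ g⁻¹ (ρ g x) = x := by
  rw [← act_mul, inv_mul_cancel, act_one]

lemma act_self_inv (g : G) (x : L) : ρ g (ρ g⁻¹ x) = x := by
  rw [← act_mul, mul_inv_cancel, act_one]

lemma act_lt_iff (g : G) (x y : L) : ρ g x < y ↔ x < ρ g⁻¹ y := by
  rw [← (ρ g).lt_iff_lt (x := x), act_self_inv]

lemma lt_act_iff (g : G) (x y : L) : y < ρ g x ↔ ρ g⁻¹ y < x := by
  rw [← (ρ g).lt_iff_lt (y := x), act_self_inv]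

lemma act_le_iff (g : G) (x y : L) : ρ g x ≤ y ↔ x ≤ ρ g⁻¹ y := by
  rw [← (ρ g).le_iff_le (x := x), act_self_inv]

lemma le_act_iff (g : G) (x y : L) : y ≤ ρ g x ↔ ρ g⁻¹ y ≤ x := by
  rw [← (ρ g).le_iff_le (y := x), act_self_inv]

/-- index of the attracting interval of a letter -/
def letterIdx (l : Fin 2 × Bool) : ℕ := 2 * l.1.val + (if l.2 then 2 else 1)

lemma iter_comm (S : L → L) (hcomm : ∀ g x, ρ g (S x) = S (ρ g x)) (n : ℕ) (g : G) (x : L) :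
    ρ g (S^[n] x) = S^[n] (ρ g x) := by
  induction n generalizing x with
  | zero => rfl
  | succ n ih => rw [Function.iterate_succ_apply, Function.iterate_succ_apply, ih, hcomm]

lemma pp_step (S : L → L) (hmono : Monotone S)
    (hcomm : ∀ g x, ρ g (S x) = S (ρ g x)) (z : ℕ → L) (zmono : Monotone z)
    (hz : z 5 ≤ S (z 0)) (g : G) (i j d : ℕ) (hj : j ≤ 4)
    (h1 : S^[d] (z i) ≤ ρ g (z (j+1))) (h2 : ρ g (S (z j)) ≤ S^[d] (z (i+1)))
    (k n : ℕ) (hk : k ≤ 4) (hkj : k ≠ j) (x : L)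
    (hx1 : S^[n+1] (z k) ≤ x) (hx2 : x ≤ S^[n+1] (z (k+1))) :
    ∃ n', n ≤ n' ∧ S^[n'] (z i) ≤ ρ g x ∧ ρ g x ≤ S^[n'] (z (i+1)) := by
  have key : ∀ m, S^[m] (z (j+1)) ≤ x → x ≤ S^[m+1] (z j) →
      S^[m+d] (z i) ≤ ρ g x ∧ ρ g x ≤ S^[m+d] (z (i+1)) := by
    intro m a1 a2
    constructor
    · calc S^[m+d] (z i) = S^[m] (S^[d] (z i)) := Function.iterate_add_apply _ _ _ _
        _ ≤ S^[m] (ρ g (z (j+1))) := hmono.iterate m h1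
        _ = ρ g (S^[m] (z (j+1))) := (iter_comm ρ S hcomm _ _ _).symm
        _ ≤ ρ g x := (ρ g).monotone a1
    · calc ρ g x ≤ ρ g (S^[m+1] (z j)) := (ρ g).monotone a2
        _ = S^[m] (ρ g (S (z j))) := by
          rw [Function.iterate_succ_apply, iter_comm ρ S hcomm]
        _ ≤ S^[m] (S^[d] (z (i+1))) := hmono.iterate m h2
        _ = _ := (Function.iterate_add_apply _ _ _ _).symm
  rcases lt_or_gt_of_ne hkj with h | h
  · refine ⟨n + d, by omega, key n ?_ ?_⟩
    · refine le_trans ?_ hx1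
      rw [Function.iterate_succ_apply]
      exact hmono.iterate n (((zmono (by omega)).trans hz).trans (hmono (zmono (Nat.zero_le k))))
    · exact hx2.trans (hmono.iterate (n+1) (zmono (by omega)))
  · refine ⟨n + 1 + d, by omega, key (n+1) ?_ ?_⟩
    · exact le_trans (hmono.iterate (n+1) (zmono (by omega))) hx1
    · refine hx2.trans ?_
      rw [Function.iterate_succ_apply _ (n+1)]
      exact hmono.iterate (n+1) (((zmono (by omega)).trans hz).trans (hmono (zmono (Nat.zero_le j))))

lemma pingpong (S : L → L) (hmono : Monotone S) (hS : ∀ x, x ≤ S x)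
    (hcomm : ∀ g x, ρ g (S x) = S (ρ g x)) (z : ℕ → L) (zmono : Monotone z)
    (hz : z 5 ≤ S (z 0)) (hs1 : ∀ n, S^[n] (z 0) < S^[n] (z 1))
    (hs2 : ∀ n, S^[n] (z 5) < S^[n+1] (z 0)) (a b : G)
    (ha1 : z 2 ≤ ρ a (z 2)) (ha2 : ρ a (S (z 1)) ≤ z 3)
    (hb1 : z 4 ≤ ρ b (z 4)) (hb2 : ρ b (S (z 3)) ≤ z 5) :
    ∃ ι : FreeGroup (Fin 2) →* G, Function.Injective ι := by
  set f : Fin 2 → G := ![a, b] with hf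
  set γ : Fin 2 × Bool → G := fun x => cond x.2 (f x.1) (f x.1)⁻¹ with hγ
  have hletterIdx : ∀ l, 1 ≤ letterIdx l ∧ letterIdx l ≤ 4 := by decide
  have hlet : ∀ l : Fin 2 × Bool, ∃ d,
      S^[d] (z (letterIdx l)) ≤ ρ (γ l) (z (letterIdx (l.1, !l.2) + 1)) ∧
      ρ (γ l) (S (z (letterIdx (l.1, !l.2)))) ≤ S^[d] (z (letterIdx l + 1)) := by
    have inv : ∀ (g : G) (i j : ℕ), z i ≤ ρ g (z (j+1)) → ρ g (S (z j)) ≤ z (i+1) →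
        S^[1] (z j) ≤ ρ g⁻¹ (z (i+1)) ∧ ρ g⁻¹ (S (z i)) ≤ S^[1] (z (j+1)) := by
      intro g i j h1 h2
      refine ⟨(act_le_iff ρ _ _ _).1 h2, ?_⟩
      rw [Function.iterate_one, act_le_iff, inv_inv, hcomm]
      exact hmono h1
    rintro ⟨l, e⟩
    fin_cases l <;> cases e
    · exact ⟨1, inv a 2 1 ha1 ha2⟩
    · exact ⟨0, ha1, ha2⟩
    · exact ⟨1, inv b 4 3 hb1 hb2⟩
    · exact ⟨0, hb1, hb2⟩
  refine ⟨FreeGroup.lift f, ?_⟩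
  rw [injective_iff_map_eq_one]
  intro w hw
  by_contra hne
  have main : ∀ W : List (Fin 2 × Bool), FreeGroup.IsReduced W → ∀ l W', W = l :: W' →
      ∀ N, W.length ≤ N → ∃ n', N - W.length ≤ n' ∧
      S^[n'] (z (letterIdx l)) ≤ ρ (W.map γ).prod (S^[N] (z 0)) ∧
      ρ (W.map γ).prod (S^[N] (z 0)) ≤ S^[n'] (z (letterIdx l + 1)) := by
    intro W
    induction W with
    | nil => intro _ l W' h; simp at h
    | cons l0 W ih =>
      rintro hred l W' heq N hN
      obtain ⟨rfl, rfl⟩ : l0 = l ∧ W = W' := by simpa using heq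
      obtain ⟨d, h1, h2⟩ := hlet l0
      rw [List.map_cons, List.prod_cons, act_mul]
      simp only [List.length_cons] at hN ⊢
      cases W with
      | nil =>
        obtain ⟨M, rfl⟩ : ∃ M, N = M + 1 := ⟨N - 1, by simp at hN; omega⟩
        simp only [List.map_nil, List.prod_nil, act_one]
        obtain ⟨n', hn', h⟩ := pp_step ρ S hmono hcomm z zmono hz (γ l0) (letterIdx l0)
          (letterIdx (l0.1, !l0.2)) d (hletterIdx _).2 h1 h2 0 M (by omega)
          (by have := (hletterIdx (l0.1, !l0.2)).1; omega) (S^[M+1] (z 0)) le_rfl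
          (hmono.iterate _ (zmono (by omega)))
        exact ⟨n', by simp; omega, h⟩
      | cons l1 W =>
        rw [FreeGroup.isReduced_cons_cons] at hred
        obtain ⟨n1, hn1, h3, h4⟩ := ih hred.2 l1 W rfl N (by omega)
        obtain ⟨M, rfl⟩ : ∃ M, n1 = M + 1 := ⟨n1 - 1, by omega⟩
        have hne : letterIdx l1 ≠ letterIdx (l0.1, !l0.2) := by
          have : ∀ l0 l1 : Fin 2 × Bool, (l0.1 = l1.1 → l0.2 = l1.2) →
            letterIdx l1 ≠ letterIdx (l0.1, !l0.2) := by decide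
          exact this _ _ hred.1
        obtain ⟨n', hn', h⟩ := pp_step ρ S hmono hcomm z zmono hz (γ l0) (letterIdx l0)
          (letterIdx (l0.1, !l0.2)) d (hletterIdx _).2 h1 h2 (letterIdx l1) M (hletterIdx _).2 hne _ h3 h4
        exact ⟨n', by omega, h⟩
  have hW : w.toWord ≠ [] := by simpa using hne
  obtain ⟨l, W', hlW⟩ := List.exists_cons_of_ne_nil hW
  obtain ⟨n', -, h1, h2⟩ := main w.toWord FreeGroup.isReduced_toWord l W' hlW _ le_rfl
  have hprod : (w.toWord.map γ).prod = 1 := by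
    rw [← FreeGroup.mk_toWord (x := w), FreeGroup.lift_mk] at hw
    exact hw
  rw [hprod, act_one] at h1 h2
  have hup : ∀ x, Monotone (fun n => S^[n] x) := fun x =>
    monotone_nat_of_le_succ fun n => by
      rw [Function.iterate_succ_apply']; exact hS _
  rcases le_or_gt w.toWord.length n' with h | h
  · have := (hup (z 0) h).trans_lt ((hs1 n').trans_le
      ((hmono.iterate n' (zmono (hletterIdx l).1)).trans h1))
    exact lt_irrefl _ this
  · have := h2.trans_lt ((hmono.iterate n' (zmono (by have := (hletterIdx l).2; omega :
      letterIdx l + 1 ≤ 5))).trans_lt (hs2 n'))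
    exact absurd (hup (z 0) h) (not_le.2 this)

lemma exists_glb (hsup : ∀ A : Set L, A.Nonempty → BddAbove A → ∃ l, IsLUB A l)
    (A : Set L) (h1 : A.Nonempty) (h2 : BddBelow A) : ∃ l, IsGLB A l := by
  obtain ⟨l, hl⟩ := hsup (lowerBounds A) h2 h1.bddAbove_lowerBounds
  exact ⟨l, isLUB_lowerBounds.1 hl⟩

/-- The pair `x, y` can be moved simultaneously into any open interval. -/
def Contr (x y : L) : Prop := ∀ z m w : L, z < m → m < w →
  ∃ g : G, z < ρ g x ∧ ρ g x < w ∧ z < ρ g y ∧ ρ g y < w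

/-- There is a point strictly between. -/
def SepPt (x y : L) : Prop := ∃ z : L, x < z ∧ z < y

lemma Contr.act {x y : L} (h : Contr ρ x y) (k : G) : Contr ρ (ρ k x) (ρ k y) := by
  intro z m w h1 h2
  obtain ⟨g, hg⟩ := h z m w h1 h2
  refine ⟨g * k⁻¹, ?_⟩
  simpa only [act_mul, act_inv_self] using hg

lemma Contr.shrink {x y x' y' : L} (h : Contr ρ x y) (h1 : x ≤ x') (h2 : x' ≤ y')
    (h3 : y' ≤ y) : Contr ρ x' y' := by
  intro z m w hz hw
  obtain ⟨g, g1, g2, g3, g4⟩ := h z m w hz hw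
  exact ⟨g, g1.trans_le ((ρ g).monotone h1), ((ρ g).monotone (h2.trans h3)).trans_lt g4,
    g1.trans_le ((ρ g).monotone (h1.trans h2)), ((ρ g).monotone h3).trans_lt g4⟩

lemma free_of_contr [NoMinOrder L] [NoMaxOrder L]
    (hmin : ∀ x z m w : L, z < m → m < w → ∃ g, z < ρ g x ∧ ρ g x < w)
    (hsup : ∀ A : Set L, A.Nonempty → BddAbove A → ∃ l, IsLUB A l)
    (hB : ∀ p q : L, p < q → ∃ a b, ∀ g, ¬ (ρ g p < a ∧ b < ρ g q))
    (hD : ∀ x y : L, SepPt x y → ∃ w, SepPt x w ∧ SepPt w y)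
    (x₀ y₀ : L) (hsep : SepPt x₀ y₀) (hc : Contr ρ x₀ y₀) :
    ∃ ι : FreeGroup (Fin 2) →* G, Function.Injective ι := by
  have low : ∀ x a : L, ∃ g, ρ g x < a := by
    intro x a
    obtain ⟨m, hm⟩ := exists_lt a
    obtain ⟨z, hz⟩ := exists_lt m
    obtain ⟨g, -, hg⟩ := hmin x z m a hz hm
    exact ⟨g, hg⟩
  have hbdd : ∀ x, BddAbove {y | Contr ρ x y} := by
    intro x
    by_contra hn
    obtain ⟨p, hp⟩ := exists_lt x
    obtain ⟨q, hq⟩ := exists_gt x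
    obtain ⟨a, b, hab⟩ := hB p q (hp.trans hq)
    obtain ⟨h, hh⟩ := low x a
    rw [not_bddAbove_iff] at hn
    obtain ⟨y, hy, hby⟩ := hn (ρ h⁻¹ b)
    obtain ⟨k, k1, k2, k3, k4⟩ := (hy.act ρ h) p x q hp hq
    refine hab k⁻¹ ⟨((lt_act_iff ρ _ _ _).1 k1).trans hh, ?_⟩
    exact ((lt_act_iff ρ _ _ _).2 hby).trans ((act_lt_iff ρ _ _ _).1 k4)
  have hself : ∀ x, Contr ρ x x := by
    intro x z m w h1 h2
    obtain ⟨g, g1, g2⟩ := hmin x z m w h1 h2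
    exact ⟨g, g1, g2, g1, g2⟩
  choose S hSl using fun x => hsup {y | Contr ρ x y} ⟨x, hself x⟩ (hbdd x)
  have hS : ∀ x, x ≤ S x := fun x => (hSl x).1 (hself x)
  have hmono : Monotone S := by
    intro x x' h
    refine (hSl x).2 ?_
    intro y hy
    rcases le_total y x' with h' | h'
    · exact h'.trans (hS x')
    · exact (hSl x').1 (hy.shrink ρ h h' le_rfl)
  have hle : ∀ g x, S (ρ g x) ≤ ρ g (S x) := by
    intro g x
    refine (hSl _).2 ?_
    intro y hy
    rw [le_act_iff]
    refine (hSl x).1 ?_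
    have := hy.act ρ g⁻¹
    rwa [act_inv_self] at this
  have hcomm : ∀ g x, ρ g (S x) = S (ρ g x) := by
    intro g x
    refine le_antisymm ?_ (hle g x)
    have := hle g⁻¹ (ρ g x)
    rwa [act_inv_self, ← act_le_iff] at this
  have hstrict : ∀ x y, SepPt x y → S x < S y := by
    rintro x y ⟨z, hxz, hzy⟩
    refine lt_of_le_of_ne (hmono (hxz.trans hzy).le) ?_
    intro heq
    have hbelow : BddBelow {w | S w = S x} := by
      by_contra hn
      rw [not_bddBelow_iff] at hn
      have hall : ∀ w ≤ x, S w = S x := by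
        intro w hw
        obtain ⟨v, hv, hvw⟩ := hn w
        exact le_antisymm (hmono hw) (hv ▸ hmono hvw.le)
      obtain ⟨h, hh⟩ := low (S x) (S x)
      have h1 := hall (min x (ρ h⁻¹ x)) (min_le_left _ _)
      have h2 := hall (ρ h (min x (ρ h⁻¹ x))) ((act_le_iff ρ _ _ _).2 (min_le_right _ _))
      rw [← hcomm, h1] at h2
      exact hh.ne h2
    obtain ⟨e, he⟩ := exists_glb hsup {w | S w = S x} ⟨x, rfl⟩ hbelow
    have hex : e ≤ x := he.1 rfl
    obtain ⟨g, g1, g2⟩ := hmin e x z y hxz hzy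
    rw [act_lt_iff, isGLB_lt_iff he] at g2
    obtain ⟨w, hw, hwy⟩ := g2
    rw [← act_lt_iff] at hwy
    have hxw : x ≤ ρ g w := g1.le.trans ((ρ g).monotone (he.1 hw))
    have h3 : S (ρ g w) = S x := le_antisymm (heq ▸ hmono hwy.le) (hmono hxw)
    have hw' : S w = S x := hw
    rw [← hcomm, hw'] at h3
    have h4 : S (ρ g⁻¹ x) = S x := by
      rw [← hcomm]
      conv_lhs => rw [← h3]
      rw [act_inv_self]
    have h5 : e ≤ ρ g⁻¹ x := he.1 h4
    rw [← act_le_iff] at h5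
    exact absurd g1 (not_lt.2 h5)
  have hSsep : ∀ x y, SepPt x y → SepPt (S x) (S y) := by
    intro x y h
    obtain ⟨w, h1, h2⟩ := hD x y h
    exact ⟨S w, hstrict _ _ h1, hstrict _ _ h2⟩
  have hit : ∀ n x y, SepPt x y → SepPt (S^[n] x) (S^[n] y) := by
    intro n
    induction n with
    | zero => exact fun x y h => h
    | succ n ih =>
      intro x y h
      rw [Function.iterate_succ_apply, Function.iterate_succ_apply]
      exact ih _ _ (hSsep _ _ h)
  have hlt : ∀ {x y : L}, SepPt x y → x < y := fun ⟨z, h1, h2⟩ => h1.trans h2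
  obtain ⟨z1, s1, t1⟩ := hD _ _ hsep
  obtain ⟨z2, s2, t2⟩ := hD _ _ t1
  obtain ⟨z3, s3, t3⟩ := hD _ _ t2
  obtain ⟨z4, s4, t4⟩ := hD _ _ t3
  obtain ⟨z5, s5, t5⟩ := hD _ _ t4
  have hy0 : y₀ ≤ S x₀ := (hSl x₀).1 hc
  have t5' : SepPt z5 (S x₀) := by
    obtain ⟨u, u1, u2⟩ := t5
    exact ⟨u, u1, u2.trans_le hy0⟩
  -- contraction of the complement of an interval
  have hcontr : ∀ s t, SepPt s t → t ≤ S s → ∀ u v, SepPt u v →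
      ∃ g, u ≤ ρ g t ∧ ρ g (S s) ≤ v := by
    rintro s t hst hts u v ⟨m, hm1, hm2⟩
    have := hstrict _ _ hst
    rw [lt_isLUB_iff (hSl t)] at this
    obtain ⟨y, hy, hys⟩ := this
    obtain ⟨g, g1, g2, g3, g4⟩ := (hy.shrink ρ le_rfl hts hys.le) u m v hm1 hm2
    exact ⟨g, g1.le, g4.le⟩
  have l1 := hlt s1
  have l2 := hlt s2
  have l3 := hlt s3
  have l4 := hlt s4
  have l5 := hlt s5
  have l6 := hlt t5'
  obtain ⟨a, ha1, ha2⟩ := hcontr z1 z2 s2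
    ((l3.trans (l4.trans (l5.trans l6))).le.trans (hmono l1.le)) z2 z3 s3
  obtain ⟨b, hb1, hb2⟩ := hcontr z3 z4 s4
    ((l5.trans l6).le.trans (hmono (l1.trans (l2.trans l3)).le)) z4 z5 s5
  set zz : ℕ → L := fun n => match n with
    | 0 => x₀
    | 1 => z1
    | 2 => z2
    | 3 => z3
    | 4 => z4
    | _ => z5 with hzz
  have zmono : Monotone zz := by
    refine monotone_nat_of_le_succ fun n => ?_
    match n with
    | 0 => exact l1.le
    | 1 => exact l2.le
    | 2 => exact l3.le
    | 3 => exact l4.le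
    | 4 => exact l5.le
    | n+5 => exact le_rfl
  refine pingpong ρ S hmono hS hcomm zz zmono l6.le (fun n => hlt (hit n _ _ s1)) ?_ a b
    ha1 ha2 hb1 hb2
  intro n
  rw [Function.iterate_succ_apply]
  exact hlt (hit n _ _ t5')

lemma fix_of_lub (g : G) (y l : L) (hl : IsLUB (Set.range fun n : ℕ => ρ (g ^ n) y) l)
    (hy : y ≤ ρ g y) : ρ g l = l := by
  have hpow : ∀ n : ℕ, ρ g (ρ (g ^ n) y) = ρ (g ^ (n+1)) y := by
    intro n; rw [← act_mul, pow_succ']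
  refine le_antisymm ?_ (hl.2 ?_)
  · rw [act_le_iff]
    refine hl.2 ?_
    rintro _ ⟨n, rfl⟩
    simp only
    rw [← act_le_iff, hpow]
    exact hl.1 ⟨n+1, rfl⟩
  · rintro _ ⟨n, rfl⟩
    calc ρ (g ^ n) y ≤ ρ (g ^ n) (ρ g y) := (ρ (g^n)).monotone hy
      _ = ρ g (ρ (g ^ n) y) := by rw [hpow, pow_succ, act_mul]
      _ ≤ ρ g l := (ρ g).monotone (hl.1 ⟨n, rfl⟩)

lemma fix_of_glb (g : G) (y l : L) (hl : IsGLB (Set.range fun n : ℕ => ρ (g ^ n) y) l)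
    (hy : ρ g y ≤ y) : ρ g l = l := by
  have hpow : ∀ n : ℕ, ρ g (ρ (g ^ n) y) = ρ (g ^ (n+1)) y := by
    intro n; rw [← act_mul, pow_succ']
  refine le_antisymm (hl.2 ?_) ?_
  · rintro _ ⟨n, rfl⟩
    calc ρ g l ≤ ρ g (ρ (g ^ n) y) := (ρ g).monotone (hl.1 ⟨n, rfl⟩)
      _ = ρ (g ^ n) (ρ g y) := by rw [hpow, pow_succ, act_mul]
      _ ≤ ρ (g ^ n) y := (ρ (g^n)).monotone hy
  · rw [le_act_iff]
    refine hl.2 ?_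
    rintro _ ⟨n, rfl⟩
    simp only
    rw [← le_act_iff, hpow]
    exact hl.1 ⟨n+1, rfl⟩

lemma fix_pow (g : G) (u : L) (h : ρ g u = u) (n : ℕ) : ρ (g ^ n) u = u := by
  induction n with
  | zero => rw [pow_zero, act_one]
  | succ n ih => rw [pow_succ, act_mul, h, ih]

lemma fix_inv (g : G) (u : L) (h : ρ g u = u) : ρ g⁻¹ u = u := by
  conv_lhs => rw [← h]
  rw [act_inv_self]

/-- Non-free case: contraction at a fixed point. -/
lemma contr_of_fix
    (hmin : ∀ x z m w : L, z < m → m < w → ∃ g, z < ρ g x ∧ ρ g x < w)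
    (hsup : ∀ A : Set L, A.Nonempty → BddAbove A → ∃ l, IsLUB A l)
    (g₀ : G) (u y : L) (hu : ρ g₀ u = u) (hy : ρ g₀ y ≠ y) :
    (∀ x y : L, SepPt x y → ∃ w, SepPt x w ∧ SepPt w y) ∧
    ∃ x₀ y₀ : L, SepPt x₀ y₀ ∧ Contr ρ x₀ y₀ := by
  rcases lt_trichotomy u y with huy | huy | huy
  · obtain ⟨g, hgu, hgy⟩ : ∃ g, ρ g u = u ∧ ρ g y < y := by
      rcases lt_or_gt_of_ne hy with h | h
      · exact ⟨g₀, hu, h⟩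
      · exact ⟨g₀⁻¹, fix_inv ρ _ _ hu, (lt_act_iff ρ _ _ _).1 h⟩
    have hlow : u ∈ lowerBounds (Set.range fun n : ℕ => ρ (g ^ n) y) := by
      rintro _ ⟨n, rfl⟩
      rw [← fix_pow ρ g u hgu n]
      exact (ρ (g^n)).monotone huy.le
    obtain ⟨l, hl⟩ := exists_glb hsup (Set.range fun n : ℕ => ρ (g ^ n) y)
      (Set.range_nonempty _) ⟨u, hlow⟩
    have hgl := fix_of_glb ρ g y l hl hgy.le
    have hlt : ∀ n : ℕ, ρ (g ^ (n+1)) y < ρ (g ^ n) y := by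
      intro n
      rw [pow_succ, act_mul]
      exact (ρ (g ^ n)).strictMono hgy
    have hll : ∀ n : ℕ, l < ρ (g ^ n) y := fun n => (hl.1 ⟨n+1, rfl⟩).trans_lt (hlt n)
    have hlim : ∀ w, l < w → ∃ n : ℕ, ρ (g ^ n) y < w := by
      intro w hw
      rw [isGLB_lt_iff hl] at hw
      obtain ⟨_, ⟨n, rfl⟩, hn⟩ := hw
      exact ⟨n, hn⟩
    constructor
    · rintro a b ⟨m, hm1, hm2⟩
      obtain ⟨h, h1, h2⟩ := hmin l a m b hm1 hm2
      rw [act_lt_iff] at h2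
      obtain ⟨n, hn⟩ := hlim _ h2
      rw [← act_lt_iff] at hn
      exact ⟨ρ h (ρ (g ^ (n+1)) y), ⟨ρ h (ρ (g ^ (n+2)) y),
        h1.trans ((ρ h).strictMono (hll _)), (ρ h).strictMono (hlt _)⟩,
        ⟨ρ h (ρ (g ^ n) y), (ρ h).strictMono (hlt _), hn⟩⟩
    · refine ⟨l, y, ⟨ρ (g ^ 1) y, hll 1, by simpa using hgy⟩, ?_⟩
      intro z m w h1 h2
      obtain ⟨h, h3, h4⟩ := hmin l z m w h1 h2
      obtain ⟨n, hn⟩ := hlim _ ((act_lt_iff ρ _ _ _).1 h4)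
      refine ⟨h * g ^ n, ?_⟩
      rw [act_mul, act_mul, fix_pow ρ g l hgl]
      exact ⟨h3, h4, h3.trans ((ρ h).strictMono (hll _)), (act_lt_iff ρ _ _ _).2 hn⟩
  · exact absurd (huy ▸ hu) hy
  · obtain ⟨g, hgu, hgy⟩ : ∃ g, ρ g u = u ∧ y < ρ g y := by
      rcases lt_or_gt_of_ne hy with h | h
      · exact ⟨g₀⁻¹, fix_inv ρ _ _ hu, (act_lt_iff ρ _ _ _).1 h⟩
      · exact ⟨g₀, hu, h⟩
    have hup : u ∈ upperBounds (Set.range fun n : ℕ => ρ (g ^ n) y) := by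
      rintro _ ⟨n, rfl⟩
      rw [← fix_pow ρ g u hgu n]
      exact (ρ (g^n)).monotone huy.le
    obtain ⟨l, hl⟩ := hsup (Set.range fun n : ℕ => ρ (g ^ n) y)
      (Set.range_nonempty _) ⟨u, hup⟩
    have hgl := fix_of_lub ρ g y l hl hgy.le
    have hlt : ∀ n : ℕ, ρ (g ^ n) y < ρ (g ^ (n+1)) y := by
      intro n
      rw [pow_succ, act_mul]
      exact (ρ (g ^ n)).strictMono hgy
    have hll : ∀ n : ℕ, ρ (g ^ n) y < l := fun n => (hlt n).trans_le (hl.1 ⟨n+1, rfl⟩)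
    have hlim : ∀ w, w < l → ∃ n : ℕ, w < ρ (g ^ n) y := by
      intro w hw
      rw [lt_isLUB_iff hl] at hw
      obtain ⟨_, ⟨n, rfl⟩, hn⟩ := hw
      exact ⟨n, hn⟩
    constructor
    · rintro a b ⟨m, hm1, hm2⟩
      obtain ⟨h, h1, h2⟩ := hmin l a m b hm1 hm2
      rw [lt_act_iff] at h1
      obtain ⟨n, hn⟩ := hlim _ h1
      rw [← lt_act_iff] at hn
      exact ⟨ρ h (ρ (g ^ (n+1)) y), ⟨ρ h (ρ (g ^ n) y), hn, (ρ h).strictMono (hlt _)⟩,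
        ⟨ρ h (ρ (g ^ (n+2)) y), (ρ h).strictMono (hlt _),
        ((ρ h).strictMono (hll _)).trans h2⟩⟩
    · refine ⟨y, l, ⟨ρ (g ^ 1) y, by simpa using hgy, hll 1⟩, ?_⟩
      intro z m w h1 h2
      obtain ⟨h, h3, h4⟩ := hmin l z m w h1 h2
      obtain ⟨n, hn⟩ := hlim _ ((lt_act_iff ρ _ _ _).1 h3)
      refine ⟨h * g ^ n, ?_⟩
      rw [act_mul, act_mul, fix_pow ρ g l hgl]
      exact ⟨(lt_act_iff ρ _ _ _).2 hn, ((ρ h).strictMono (hll _)).trans h4, h3, h4⟩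

lemma holder_comm {Q : Type*} [Group Q] [LinearOrder Q] [MulLeftMono Q] [MulRightMono Q]
    (arch : ∀ d : Q, 1 < d → ∀ g : Q, ∃ n : ℤ, d ^ n ≤ g ∧ g < d ^ (n + 1)) (a b : Q) :
    a * b = b * a := by
  by_cases hleast : ∃ d : Q, 1 < d ∧ ∀ e : Q, 1 < e → d ≤ e
  · obtain ⟨d, hd, hmin⟩ := hleast
    have hz : ∀ g : Q, ∃ n : ℤ, g = d ^ n := by
      intro g
      obtain ⟨n, h1, h2⟩ := arch d hd g
      refine ⟨n, le_antisymm ?_ h1⟩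
      by_contra hlt
      rw [not_le] at hlt
      have h3 : 1 < (d ^ n)⁻¹ * g := by
        rwa [← inv_mul_cancel (d ^ n), mul_lt_mul_iff_left]
      have h4 : (d ^ n)⁻¹ * g < d := by
        rw [inv_mul_lt_iff_lt_mul, ← zpow_add_one]; exact h2
      exact absurd (hmin _ h3) (not_le.2 h4)
    obtain ⟨m, rfl⟩ := hz a
    obtain ⟨n, rfl⟩ := hz b
    rw [← zpow_add, ← zpow_add, add_comm]
  · push Not at hleast
    have half : ∀ c : Q, 1 < c → ∃ δ : Q, 1 < δ ∧ δ * δ ≤ c := by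
      intro c hc
      obtain ⟨e, he, hec⟩ := hleast c hc
      rcases le_or_gt (e * e) c with h | h
      · exact ⟨e, he, h⟩
      · have h1 : c * e⁻¹ < e := by rwa [mul_inv_lt_iff_lt_mul]
        refine ⟨c * e⁻¹, by rwa [lt_mul_inv_iff_mul_lt, one_mul], ?_⟩
        calc c * e⁻¹ * (c * e⁻¹) ≤ c * e⁻¹ * e := mul_le_mul_right h1.le _
          _ = c := by group
    have key : ∀ a b : Q, ¬ b * a < a * b := by
      intro a b hlt
      have hc : 1 < a * b * (b * a)⁻¹ := by rwa [lt_mul_inv_iff_mul_lt, one_mul]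
      obtain ⟨δ, hδ, hδc⟩ := half _ hc
      obtain ⟨m, m1, m2⟩ := arch δ hδ a
      obtain ⟨n, n1, n2⟩ := arch δ hδ b
      have : a * b < a * b := by
        calc a * b < δ ^ (m+1) * δ ^ (n+1) := mul_lt_mul_of_lt_of_lt m2 n2
          _ = (δ * δ) * (δ ^ n * δ ^ m) := by
            rw [← zpow_add, ← zpow_add, ← pow_two, ← zpow_natCast, ← zpow_add]
            congr 1; push_cast; ring
          _ ≤ (a * b * (b * a)⁻¹) * (b * a) := mul_le_mul' hδc (mul_le_mul' n1 m1)
          _ = a * b := by group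
      exact lt_irrefl _ this
    exact le_antisymm (not_lt.1 (key a b)) (not_lt.1 (key b a))

lemma surj_of_ordered {Q : Type*} [CommGroup Q] [LinearOrder Q] [IsOrderedMonoid Q]
    [Nontrivial Q] (hfg : Group.FG Q) :
    ∃ φ : Q →* Multiplicative ℤ, Function.Surjective φ := by
  have : Module.Finite ℤ (Additive Q) := by
    rw [Module.Finite.iff_addGroup_fg]
    exact GroupFG.iff_add_fg.1 hfg
  have : Module.Free ℤ (Additive Q) := inferInstance
  let B := Module.Free.chooseBasis ℤ (Additive Q)
  obtain ⟨i⟩ := B.index_nonempty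
  refine ⟨AddMonoidHom.toMultiplicativeRight (B.coord i).toAddMonoidHom, ?_⟩
  intro n
  refine ⟨Additive.toMul (n.toAdd • B i), ?_⟩
  simp

lemma sign_lemma (hsup : ∀ A : Set L, A.Nonempty → BddAbove A → ∃ l, IsLUB A l)
    (hfree : ∀ g (x y : L), ρ g x = x → ρ g y = y) (k : G) (x y : L) (hx : x < ρ k x) :
    y < ρ k y := by
  have main : ∀ (k : G) (x y : L), x < ρ k x → ρ k y < y → ¬ x < y := by
    intro k x y hx hy hxy
    obtain ⟨v, hv⟩ := hsup {m | x ≤ m ∧ m ≤ y ∧ m < ρ k m} ⟨x, le_rfl, hxy.le, hx⟩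
      ⟨y, fun m hm => hm.2.1⟩
    have h1 : v ≤ ρ k v := hv.2 fun m hm => hm.2.2.le.trans ((ρ k).monotone (hv.1 hm))
    have h2 : v < ρ k v := lt_of_le_of_ne h1 fun h => hx.ne (hfree k v x h.symm).symm
    have h3 : v ≤ y := hv.2 fun m hm => hm.2.1
    have h4 : x ≤ v := hv.1 ⟨le_rfl, hxy.le, hx⟩
    exact absurd (hv.1 ⟨h4.trans h1, ((ρ k).monotone h3).trans hy.le, (ρ k).strictMono h2⟩)
      (not_le.2 h2)
  by_contra hn
  have hy : ρ k y < y := lt_of_le_of_ne (not_lt.1 hn) fun h => hx.ne (hfree k y x h).symm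
  rcases lt_trichotomy x y with h | h | h
  · exact main k x y hx hy h
  · subst h; exact lt_asymm hx hy
  · exact main k⁻¹ y x ((act_lt_iff ρ _ _ _).1 hy) ((lt_act_iff ρ _ _ _).1 hx) h

lemma arch_lemma (hsup : ∀ A : Set L, A.Nonempty → BddAbove A → ∃ l, IsLUB A l)
    (hfree : ∀ g (x y : L), ρ g x = x → ρ g y = y) (d : G) (x y : L) (hx : x < ρ d x) :
    ∃ n : ℤ, ρ (d ^ n) x ≤ y ∧ y < ρ (d ^ (n+1)) x := by
  have hsm : StrictMono fun n : ℤ => ρ (d ^ n) x := by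
    refine strictMono_int_of_lt_succ fun n => ?_
    rw [zpow_add_one, act_mul]
    exact (ρ (d ^ n)).strictMono hx
  have hup : ∃ n : ℕ, y < ρ (d ^ n) x := by
    by_contra hn
    push Not at hn
    obtain ⟨l, hl⟩ := hsup (Set.range fun n : ℕ => ρ (d ^ n) x) (Set.range_nonempty _)
      ⟨y, by rintro _ ⟨n, rfl⟩; exact hn n⟩
    exact hx.ne (hfree d l x (fix_of_lub ρ d x l hl hx.le)).symm
  have hx' : ρ d⁻¹ x < x := (lt_act_iff ρ _ _ _).1 hx
  have hdn : ∃ n : ℕ, ρ (d⁻¹ ^ n) x < y := by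
    by_contra hn
    push Not at hn
    obtain ⟨l, hl⟩ := exists_glb hsup (Set.range fun n : ℕ => ρ (d⁻¹ ^ n) x)
      (Set.range_nonempty _) ⟨y, by rintro _ ⟨n, rfl⟩; exact hn n⟩
    exact hx'.ne (hfree d⁻¹ l x (fix_of_glb ρ d⁻¹ x l hl hx'.le))
  obtain ⟨N, hN⟩ := hup
  obtain ⟨N', hN'⟩ := hdn
  obtain ⟨n, h1, h2⟩ := Int.exists_greatest_of_bdd (P := fun n : ℤ => ρ (d ^ n) x ≤ y)
    ⟨N, fun z hz => by
      refine hsm.le_iff_le.1 ?_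
      rw [zpow_natCast]
      exact hz.trans hN.le⟩
    ⟨-N', by rw [zpow_neg, zpow_natCast, ← inv_pow]; exact hN'.le⟩
  refine ⟨n, h1, ?_⟩
  by_contra hn
  have := h2 (n+1) (not_lt.1 hn)
  omega

lemma surj_of_free [Nonempty L] (hfg : Group.FG G)
    (hsup : ∀ A : Set L, A.Nonempty → BddAbove A → ∃ l, IsLUB A l)
    (hfree : ∀ g (x y : L), ρ g x = x → ρ g y = y) (hnt : ∃ g x, ρ g x ≠ x) :
    ∃ φ : G →* Multiplicative ℤ, Function.Surjective φ := by
  obtain ⟨x₀⟩ := ‹Nonempty L›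
  let Q := ρ.range
  have hinj : Function.Injective fun q : Q => q.1 x₀ := by
    rintro ⟨_, g, rfl⟩ ⟨_, h, rfl⟩ heq
    have h0 : ρ g x₀ = ρ h x₀ := heq
    ext y
    have h1 : ρ (h⁻¹ * g) x₀ = x₀ := by rw [act_mul, h0, act_inv_self]
    have h2 := hfree _ _ y h1
    rw [act_mul] at h2
    have h3 := congrArg (ρ h) h2
    rwa [act_self_inv] at h3
  let : LinearOrder Q := LinearOrder.lift' (fun q : Q => q.1 x₀) hinj
  have hle : ∀ p q : Q, p ≤ q ↔ p.1 x₀ ≤ q.1 x₀ := fun _ _ => Iff.rfl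
  have hlt : ∀ p q : Q, p < q ↔ p.1 x₀ < q.1 x₀ := fun p q => by
    rw [← not_le, ← not_le, hle]
  have : MulLeftMono Q := ⟨fun r p q h => by
    rw [hle] at h ⊢
    exact r.1.monotone h⟩
  have : MulRightMono Q := ⟨fun r p q h => by
    have h' : p ≤ q := h
    change p * r ≤ q * r
    rcases h'.eq_or_lt with rfl | h'
    · exact le_rfl
    rw [hlt] at h'
    obtain ⟨_, g, rfl⟩ := p
    obtain ⟨_, k, rfl⟩ := q
    obtain ⟨_, r, rfl⟩ := r
    have h1 : x₀ < ρ (g⁻¹ * k) x₀ := by rw [act_mul, ← act_lt_iff]; exact h'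
    have h2 := sign_lemma ρ hsup hfree _ x₀ (ρ r x₀) h1
    rw [act_mul, ← act_lt_iff] at h2
    exact h2.le⟩
  have arch : ∀ d : Q, 1 < d → ∀ g : Q, ∃ n : ℤ, d ^ n ≤ g ∧ g < d ^ (n + 1) := by
    rintro ⟨_, d, rfl⟩ hd g
    obtain ⟨n, h1, h2⟩ := arch_lemma ρ hsup hfree d x₀ (g.1 x₀) ((hlt _ _).1 hd)
    rw [map_zpow] at h1 h2
    exact ⟨n, (hle _ _).2 h1, (hlt _ _).2 h2⟩
  let : CommGroup Q := { (inferInstance : Group Q) with mul_comm := holder_comm arch }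
  have : IsOrderedMonoid Q := { mul_le_mul_left := fun a b h c => mul_le_mul_left h c }
  obtain ⟨g, x, hgx⟩ := hnt
  have : Nontrivial Q := by
    refine ⟨⟨ρ g, g, rfl⟩, 1, ?_⟩
    intro h
    apply hgx
    have := congrArg (fun q : Q => q.1 x) h
    exact this
  have hQ : Group.FG Q := Group.fg_range ρ
  obtain ⟨φ, hφ⟩ := surj_of_ordered hQ
  exact ⟨φ.comp ρ.rangeRestrict, hφ.comp ρ.rangeRestrict_surjective⟩

lemma abstract_main [Nonempty L] [NoMinOrder L] [NoMaxOrder L] (hfg : Group.FG G)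
    (hmin : ∀ x z m w : L, z < m → m < w → ∃ g, z < ρ g x ∧ ρ g x < w)
    (hsup : ∀ A : Set L, A.Nonempty → BddAbove A → ∃ l, IsLUB A l)
    (hB : ∀ p q : L, p < q → ∃ a b, ∀ g, ¬ (ρ g p < a ∧ b < ρ g q)) :
    (∃ φ : G →* Multiplicative ℤ, Function.Surjective φ) ∨
    (∃ ι : FreeGroup (Fin 2) →* G, Function.Injective ι) := by
  by_cases hfree : ∀ g (x y : L), ρ g x = x → ρ g y = y
  · left
    refine surj_of_free ρ hfg hsup hfree ?_
    obtain ⟨x⟩ := ‹Nonempty L›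
    obtain ⟨m, hm⟩ := exists_gt x
    obtain ⟨w, hw⟩ := exists_gt m
    obtain ⟨g, h, -⟩ := hmin x x m w hm hw
    exact ⟨g, x, h.ne'⟩
  · right
    push Not at hfree
    obtain ⟨g, u, y, hu, hy⟩ := hfree
    obtain ⟨hD, x₀, y₀, h1, h2⟩ := contr_of_fix ρ hmin hsup g u y hu hy
    exact free_of_contr ρ hmin hsup hB hD x₀ y₀ h1 h2

end helpers

/-- Restriction of the group to an invariant set. -/
def restrictHom (Γ : Subgroup (ℝ ≃o ℝ)) (M : Set ℝ) (hM : ∀ g ∈ Γ, ∀ x ∈ M, g x ∈ M) :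
    ↥Γ →* (M ≃o M) where
  toFun g :=
    { toFun := fun x => ⟨g.1 x.1, hM g.1 g.2 x.1 x.2⟩
      invFun := fun x => ⟨g.1.symm x.1, hM (g.1⁻¹) (Γ.inv_mem g.2) x.1 x.2⟩
      left_inv := fun x => Subtype.ext (g.1.symm_apply_apply x.1)
      right_inv := fun x => Subtype.ext (g.1.apply_symm_apply x.1)
      map_rel_iff' := fun {a b} => g.1.le_iff_le }
  map_one' := rfl
  map_mul' _ _ := rfl

lemma orbit_above (Γ : Subgroup (ℝ ≃o ℝ)) (hnofix : ¬ ∃ x : ℝ, ∀ g ∈ Γ, g x = x)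
    (x b : ℝ) : ∃ g ∈ Γ, b < g x := by
  by_contra hn
  push Not at hn
  set A : Set ℝ := {y | ∃ g ∈ Γ, y = g x} with hA
  have hne : A.Nonempty := ⟨x, 1, Γ.one_mem, rfl⟩
  have hbd : BddAbove A := ⟨b, by rintro _ ⟨g, hg, rfl⟩; exact hn g hg⟩
  have hle : ∀ g ∈ Γ, sSup A ≤ g (sSup A) := by
    intro g hg
    refine csSup_le hne ?_
    rintro _ ⟨h, hh, rfl⟩
    have : (g⁻¹ * h) x ≤ sSup A := le_csSup hbd ⟨_, Γ.mul_mem (Γ.inv_mem hg) hh, rfl⟩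
    have h2 := g.monotone this
    rwa [← RelIso.mul_apply, mul_inv_cancel_left] at h2
  refine hnofix ⟨sSup A, fun g hg => le_antisymm ?_ (hle g hg)⟩
  have h2 := g.monotone (hle g⁻¹ (Γ.inv_mem hg))
  rwa [← RelIso.mul_apply, mul_inv_cancel] at h2

lemma orbit_below (Γ : Subgroup (ℝ ≃o ℝ)) (hnofix : ¬ ∃ x : ℝ, ∀ g ∈ Γ, g x = x)
    (x b : ℝ) : ∃ g ∈ Γ, g x < b := by
  obtain ⟨g, hg, h⟩ := orbit_above Γ hnofix b x
  refine ⟨g⁻¹, Γ.inv_mem hg, ?_⟩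
  have := (g⁻¹).strictMono h
  rwa [← RelIso.mul_apply, inv_mul_cancel] at this

lemma exists_compact (Γ : Subgroup (ℝ ≃o ℝ)) (hfg : Group.FG ↥Γ)
    (hnofix : ¬ ∃ x : ℝ, ∀ g ∈ Γ, g x = x) :
    ∃ q : ℝ, ∀ x, ∃ g ∈ Γ, g x ∈ Set.Icc 0 q := by
  obtain ⟨F, hF⟩ := hfg.out
  obtain ⟨q, hq⟩ : ∃ q : ℝ, ∀ s ∈ F, s.1 0 ≤ q ∧ (s⁻¹).1 0 ≤ q := by
    obtain ⟨q1, h1⟩ := (F.image fun s => s.1 0).bddAbove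
    obtain ⟨q2, h2⟩ := (F.image fun s => (s⁻¹).1 0).bddAbove
    refine ⟨max q1 q2, fun s hs => ⟨le_max_of_le_left (h1 ?_), le_max_of_le_right (h2 ?_)⟩⟩
    · simpa using ⟨s.1, ⟨s.2, hs⟩, rfl⟩
    · exact Finset.mem_coe.2 (Finset.mem_image.2 ⟨s, hs, rfl⟩)
  refine ⟨q, fun x => ?_⟩
  by_contra hn
  push Not at hn
  have hP : ∀ g : ↥Γ, ∀ h : ↥Γ, (h.1 x < 0 ↔ (g * h).1 x < 0) := by
    intro g
    have hg : g ∈ Subgroup.closure (F : Set ↥Γ) := by rw [hF]; trivial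
    have step : ∀ s h : ↥Γ, s.1 0 ≤ q → h.1 x < 0 → (s * h).1 x < 0 := by
      intro s h hs hx
      have h1 : (s * h).1 x < s.1 0 := s.1.strictMono hx
      by_contra h2
      exact hn _ (s * h).2 ⟨not_lt.1 h2, h1.le.trans hs⟩
    induction hg using Subgroup.closure_induction with
    | mem s hs =>
      intro h
      refine ⟨step s h (hq s hs).1, fun h1 => ?_⟩
      have := step s⁻¹ (s * h) (hq s hs).2 h1
      rwa [inv_mul_cancel_left] at this
    | one => intro h; rw [one_mul]
    | mul a b _ _ iha ihb => intro h; rw [ihb h, iha (b * h), mul_assoc]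
    | inv a _ iha => intro h; rw [iha (a⁻¹ * h), mul_inv_cancel_left]
  obtain ⟨g, hg, h1⟩ := orbit_below Γ hnofix x 0
  obtain ⟨k, hk, h2⟩ := orbit_above Γ hnofix x 0
  have := (hP (⟨k, hk⟩ * ⟨g, hg⟩⁻¹) ⟨g, hg⟩).1 h1
  rw [inv_mul_cancel_right] at this
  exact lt_asymm this h2

lemma exists_minimal_set (Γ : Subgroup (ℝ ≃o ℝ)) (hfg : Group.FG ↥Γ)
    (hnofix : ¬ ∃ x : ℝ, ∀ g ∈ Γ, g x = x) :
    ∃ M : Set ℝ, IsClosed M ∧ M.Nonempty ∧ (∀ g ∈ Γ, ∀ x ∈ M, g x ∈ M) ∧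
      ∀ x ∈ M, ∀ m ∈ M, ∀ z w, z < m → m < w → ∃ g ∈ Γ, z < g x ∧ g x < w := by
  obtain ⟨q, hq⟩ := exists_compact Γ hfg hnofix
  set 𝒮 : Set (Set ℝ) := {M | IsClosed M ∧ M.Nonempty ∧ ∀ g ∈ Γ, ∀ x ∈ M, g x ∈ M} with h𝒮
  obtain ⟨M, -, hM⟩ := zorn_superset_nonempty 𝒮 (by
    intro c hc hchain hcne
    refine ⟨⋂₀ c, ⟨isClosed_sInter fun t ht => (hc ht).1, ?_, ?_⟩,
      fun s hs => Set.sInter_subset_of_mem hs⟩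
    · have : Nonempty c := hcne.to_subtype
      have := IsCompact.nonempty_iInter_of_directed_nonempty_isCompact_isClosed
        (fun t : c => t.1 ∩ Set.Icc 0 q) (by
          intro s t
          rcases hchain.total s.2 t.2 with h | h
          · exact ⟨s, le_rfl, Set.inter_subset_inter_left _ h⟩
          · exact ⟨t, Set.inter_subset_inter_left _ h, le_rfl⟩)
        (by
          intro t
          obtain ⟨x, hx⟩ := (hc t.2).2.1
          obtain ⟨g, hg, h⟩ := hq x
          exact ⟨g x, (hc t.2).2.2 g hg x hx, h⟩)
        (fun t => isCompact_Icc.inter_left (hc t.2).1)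
        (fun t => (hc t.2).1.inter isClosed_Icc)
      obtain ⟨x, hx⟩ := this
      rw [Set.mem_iInter] at hx
      exact ⟨x, fun t ht => (hx ⟨t, ht⟩).1⟩
    · intro g hg x hx t ht
      exact (hc ht).2.2 g hg x (hx t ht)) Set.univ
      ⟨isClosed_univ, Set.univ_nonempty, fun _ _ _ _ => trivial⟩
  refine ⟨M, hM.prop.1, hM.prop.2.1, hM.prop.2.2, ?_⟩
  intro x hx m hm z w hz hw
  -- points of `M` whose orbit avoids the interval
  by_contra hn
  push Not at hn
  have hN : M ∩ ⋂ g ∈ Γ, Set.preimage (g : ℝ ≃o ℝ) (Set.Ioo z w)ᶜ ∈ 𝒮 := by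
    refine ⟨hM.prop.1.inter (isClosed_biInter fun g _ =>
      isOpen_Ioo.isClosed_compl.preimage g.continuous), ⟨x, hx, ?_⟩, ?_⟩
    · simp only [Set.mem_iInter, Set.mem_preimage, Set.mem_compl_iff, Set.mem_Ioo]
      intro g hg h
      exact absurd h.2 (not_lt.2 (hn g hg h.1))
    · rintro g hg y ⟨hy, hy2⟩
      refine ⟨hM.prop.2.2 g hg y hy, ?_⟩
      simp only [Set.mem_iInter, Set.mem_preimage] at hy2 ⊢
      intro h hh
      exact hy2 (h * g) (Γ.mul_mem hh hg)
  have := (hM.le_of_le hN Set.inter_subset_left hm).2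
  simp only [Set.mem_iInter, Set.mem_preimage] at this
  exact this 1 Γ.one_mem ⟨hz, hw⟩

/-- A finitely generated group of orientation-preserving homeomorphisms of the line
(formalized as order-isomorphisms of `ℝ`) acting without global fixed point, whose
action is not of type III (i.e. fails the expansion property: for every `c < c'` there
are `a < c < c' < b` and `a' < b'` such that no element expands `[a,b]` over `[a',b']`),
either surjects onto `ℤ` or contains a free subgroup on two generators. -/
theorem surjective_onto_int_or_free_subgroup
    (Γ : Subgroup (ℝ ≃o ℝ))
    (hfg : Group.FG ↥Γ)
    (hnofix : ¬ ∃ x : ℝ, ∀ g ∈ Γ, g x = x)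
    (hnotIII : ∀ c c' : ℝ, c < c' →
      ∃ a b a' b' : ℝ, a < c ∧ c' < b ∧ a' < b' ∧
        ∀ g ∈ Γ, ¬ (g a < a' ∧ b' < g b)) :
    (∃ φ : ↥Γ →* Multiplicative ℤ, Function.Surjective φ) ∨
    (∃ ι : FreeGroup (Fin 2) →* ↥Γ, Function.Injective ι) := by
  obtain ⟨M, hcl, hne, hinv, hmin⟩ := exists_minimal_set Γ hfg hnofix
  have : Nonempty M := hne.to_subtype
  have : NoMaxOrder M := ⟨fun x => by
    obtain ⟨g, hg, h⟩ := orbit_above Γ hnofix x.1 x.1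
    exact ⟨⟨g x.1, hinv g hg _ x.2⟩, h⟩⟩
  have : NoMinOrder M := ⟨fun x => by
    obtain ⟨g, hg, h⟩ := orbit_below Γ hnofix x.1 x.1
    exact ⟨⟨g x.1, hinv g hg _ x.2⟩, h⟩⟩
  refine abstract_main (restrictHom Γ M hinv) hfg ?_ ?_ ?_
  · intro x z m w hz hw
    obtain ⟨g, hg, h1, h2⟩ := hmin x.1 x.2 m.1 m.2 z.1 w.1 hz hw
    exact ⟨⟨g, hg⟩, h1, h2⟩
  · intro A hA hbd
    have hA' : (Set.image (fun x : M => x.1) A).Nonempty := hA.image _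
    have hbd' : BddAbove (Set.image (fun x : M => x.1) A) := by
      obtain ⟨b, hb⟩ := hbd
      exact ⟨b.1, by rintro _ ⟨y, hy, rfl⟩; exact hb hy⟩
    have hlub := isLUB_csSup hA' hbd'
    have hmem : sSup (Set.image (fun x : M => x.1) A) ∈ M := by
      have h1 := csSup_mem_closure hA' hbd'
      refine closure_minimal ?_ hcl h1
      rintro _ ⟨y, _, rfl⟩
      exact y.2
    refine ⟨⟨_, hmem⟩, ?_, ?_⟩
    · intro y hy
      exact hlub.1 ⟨y, hy, rfl⟩
    · intro b hb
      have hb' : b.1 ∈ upperBounds (Set.image (fun x : M => x.1) A) := by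
        rintro _ ⟨y, hy, rfl⟩
        exact hb hy
      exact hlub.2 hb'
  · intro p q hpq
    obtain ⟨a, b, a', b', ha, hb, -, h⟩ := hnotIII p.1 q.1 hpq
    obtain ⟨k1, hk1, h1⟩ := orbit_below Γ hnofix p.1 a'
    obtain ⟨k2, hk2, h2⟩ := orbit_above Γ hnofix p.1 b'
    refine ⟨⟨k1 p.1, hinv _ hk1 _ p.2⟩, ⟨k2 p.1, hinv _ hk2 _ p.2⟩, ?_⟩
    rintro g ⟨h3, h4⟩
    have h3' : g.1 p.1 < k1 p.1 := h3
    have h4' : k2 p.1 < g.1 q.1 := h4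
    exact h g.1 g.2 ⟨((g.1.strictMono ha).trans h3').trans h1,
      (h2.trans h4').trans (g.1.strictMono hb)⟩
end

section
/- Let LO(F₂) be the space of left-orders on the free group F₂ on two generators, identified with positive cones and topologized as a subspace of the power set of F₂ with the product topology. The set of left-orders on F₂ satisfying no verbal property — i.e. the set of positive cones P such that for every nonempty reduced word W(a,b) in two letters whose reduced form carries both positive and negative exponents there exist f, g ∈ P with W(f,g) ∉ P — is a dense G_δ subset of LO(F₂). -/
/-- A subset of a group (given by its indicator function `P : Γ → Bool`, so that the
power set `Γ → Bool` carries the product topology with `Bool` discrete) is the positive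
cone of a left-order if it is closed under multiplication, does not contain `1`, and
every `g ≠ 1` lies in exactly one of `P`, `P⁻¹`. -/
def IsLeftOrderCone {Γ : Type*} [Group Γ] (P : Γ → Bool) : Prop :=
  (∀ a b : Γ, P a = true → P b = true → P (a * b) = true) ∧
  P 1 = false ∧
  (∀ g : Γ, g ≠ 1 → (P g = true ↔ P g⁻¹ = false))

/-- A reduced word `w` in two letters carries both positive and negative exponents. -/
def HasBothSigns (w : FreeGroup (Fin 2)) : Prop :=
  (∃ x, (x, true) ∈ w.toWord) ∧ (∃ x, (x, false) ∈ w.toWord)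

/-- A left-order with positive cone `P` is a `W`-order if `W(f,g)` is positive whenever
`f` and `g` are. -/
def IsWOrder {Γ : Type*} [Group Γ] (w : FreeGroup (Fin 2)) (P : Γ → Bool) : Prop :=
  ∀ f g : Γ, P f = true → P g = true → P ((FreeGroup.lift ![f, g]) w) = true

/-- The space of left-orders on the free group `F₂`, as the set of positive cones inside
the power set `F₂ → Bool` with the product topology. -/
def LOF2 : Type := {P : FreeGroup (Fin 2) → Bool // IsLeftOrderCone P}

instance : TopologicalSpace LOF2 :=
  instTopologicalSpaceSubtype

/-- A set of pairs is the graph of a partial strictly increasing injection. -/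
def ConsPairs (G : Set (ℚ × ℚ)) : Prop :=
  ∀ p ∈ G, ∀ q ∈ G, (p.1 < q.1 ↔ p.2 < q.2)

lemma ConsPairs.union {G₁ G₂ : Set (ℚ × ℚ)} (h₁ : ConsPairs G₁) (h₂ : ConsPairs G₂)
    (h : ∀ p ∈ G₁, ∀ q ∈ G₂, p.1 < q.1 ∧ p.2 < q.2) : ConsPairs (G₁ ∪ G₂) := by
  rintro p (hp | hp) q (hq | hq)
  · exact h₁ p hp q hq
  · have := h p hp q hq
    exact ⟨fun _ => this.2, fun _ => this.1⟩
  · have := h q hq p hp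
    exact ⟨fun h' => absurd h' this.1.not_gt, fun h' => absurd h' this.2.not_gt⟩
  · exact h₂ p hp q hq

lemma ConsPairs.singleton (x : ℚ × ℚ) : ConsPairs {x} := by
  rintro p rfl q rfl
  simp

lemma ConsPairs.exists_orderIso {G : Set (ℚ × ℚ)} (hf : G.Finite) (hG : ConsPairs G) :
    ∃ A : ℚ ≃o ℚ, ∀ p ∈ G, A p.1 = p.2 := by
  classical
  have key : ∀ p ∈ hf.toFinset, ∀ q ∈ hf.toFinset, cmp p.1 q.1 = cmp p.2 q.2 := by
    intro p hp q hq
    rw [Set.Finite.mem_toFinset] at hp hq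
    have h1 := hG p hp q hq
    have h2 := hG q hq p hp
    rcases lt_trichotomy p.1 q.1 with h | h | h
    · rw [(cmp_eq_lt_iff _ _).2 h, (cmp_eq_lt_iff _ _).2 (h1.1 h)]
    · have e : p.2 = q.2 := by
        apply le_antisymm
        · exact not_lt.1 fun h' => by have := h2.2 h'; linarith
        · exact not_lt.1 fun h' => by have := h1.2 h'; linarith
      rw [(cmp_eq_eq_iff _ _).2 h, (cmp_eq_eq_iff _ _).2 e]
    · rw [(cmp_eq_gt_iff _ _).2 h, (cmp_eq_gt_iff _ _).2 (h2.1 h)]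
  let p₀ : Order.PartialIso ℚ ℚ := ⟨hf.toFinset, key⟩
  let to_cofinal : ℚ ⊕ ℚ → Order.Cofinal (Order.PartialIso ℚ ℚ) := fun p ↦
    Sum.recOn p (Order.PartialIso.definedAtLeft ℚ) (Order.PartialIso.definedAtRight ℚ)
  let I : Order.Ideal (Order.PartialIso ℚ ℚ) := Order.idealOfCofinals p₀ to_cofinal
  let F a := Order.PartialIso.funOfIdeal a I
    (Order.cofinal_meets_idealOfCofinals _ to_cofinal (Sum.inl a))
  let H b := Order.PartialIso.invOfIdeal b I
    (Order.cofinal_meets_idealOfCofinals _ to_cofinal (Sum.inr b))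
  refine ⟨OrderIso.ofCmpEqCmp (fun a ↦ (F a).val) (fun b ↦ (H b).val) fun a b ↦ ?_, ?_⟩
  · rcases (F a).prop with ⟨f, hf, ha⟩
    rcases (H b).prop with ⟨g, hg, hb⟩
    rcases I.directed _ hf _ hg with ⟨m, _, fm, gm⟩
    exact m.prop (a, _) (fm ha) (_, b) (gm hb)
  · intro p hp
    change (F p.1).val = p.2
    rcases (F p.1).prop with ⟨f, hf', ha⟩
    have h0 : p₀ ∈ I := Order.mem_idealOfCofinals _ _
    rcases I.directed _ hf' _ h0 with ⟨m, _, fm, gm⟩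
    have h1 := m.prop (p.1, _) (fm ha) p (gm (by simpa [p₀] using hp))
    rw [cmp_self_eq_eq] at h1
    exact (cmp_eq_eq_iff _ _).1 h1.symm

open FreeGroup in
lemma lift_cons_apply (φ : Fin 2 → (ℚ ≃o ℚ)) (i : Fin 2) (L : List (Fin 2 × Bool)) (x : ℚ) :
    FreeGroup.lift φ (mk ((i, true) :: L)) x = φ i (FreeGroup.lift φ (mk L) x) ∧
    FreeGroup.lift φ (mk ((i, false) :: L)) x = (φ i).symm (FreeGroup.lift φ (mk L) x) := by
  constructor
  · simp only [FreeGroup.lift_mk, List.map_cons, List.prod_cons]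
    rfl
  · simp only [FreeGroup.lift_mk, List.map_cons, List.prod_cons]
    rfl

open FreeGroup in
/-- Positive words, processed along prescribed maps `F i` on the nonnegative rationals. -/
lemma positive_part (F : Fin 2 → ℚ → ℚ) (hF : ∀ i x, 0 ≤ x → 0 ≤ F i x)
    (L : List (Fin 2 × Bool)) (hL : ∀ x ∈ L, x.2 = true) :
    ∃ (E : Set ℚ) (q : ℚ), E.Finite ∧ 0 ∈ E ∧ (∀ x ∈ E, 0 ≤ x) ∧ 0 ≤ q ∧ (L = [] → q = 0) ∧
      (∀ i, L.head? = some (i, true) → ∃ r, 0 ≤ r ∧ q = F i r) ∧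
      ∀ (x₀ : ℚ) (φ : Fin 2 → (ℚ ≃o ℚ)), (∀ i, ∀ x ∈ E, φ i (x₀ + x) = x₀ + F i x) →
        FreeGroup.lift φ (mk L) x₀ = x₀ + q := by
  induction L with
  | nil =>
    refine ⟨{0}, 0, Set.finite_singleton _, rfl, by simp, le_rfl, by simp, by simp, ?_⟩
    intro x₀ φ _
    rw [← FreeGroup.one_eq_mk]
    simp
  | cons a L ih =>
    obtain ⟨E, q, hE, h0, hpos, hq, -, -, h⟩ := ih (fun x hx => hL x (List.mem_cons_of_mem _ hx))
    obtain ⟨i, b⟩ := a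
    obtain rfl : b = true := hL (i, b) (by simp)
    refine ⟨insert q E, F i q, hE.insert _, Set.mem_insert_of_mem _ h0, ?_, hF _ _ hq, by simp, ?_, ?_⟩
    · rintro x (rfl | hx)
      exacts [hq, hpos x hx]
    · intro j hj
      simp at hj
      subst hj
      exact ⟨q, hq, rfl⟩
    · intro x₀ φ hφ
      rw [(lift_cons_apply φ i L x₀).1, h x₀ φ (fun i x hx => hφ i x (Set.mem_insert_of_mem _ hx))]
      exact hφ i q (Set.mem_insert _ _)

lemma consPairs_graph (E : Set ℚ) (F : ℚ → ℚ) (hF : ∀ x ∈ E, ∀ y ∈ E, x < y → F x < F y) :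
    ConsPairs ((fun x => (x, F x)) '' E) := by
  rintro _ ⟨x, hx, rfl⟩ _ ⟨y, hy, rfl⟩
  refine ⟨hF x hx y hy, fun h => ?_⟩
  simp only at h ⊢
  rcases lt_trichotomy x y with h' | h' | h'
  · exact h'
  · subst h'; exact absurd h (lt_irrefl _)
  · exact absurd h (hF y hy x hx h').not_gt

open FreeGroup in
/-- The finite combinatorial data forcing a word with a negative letter to move a point down
while both generators move it up. -/
lemma word_config (L : List (Fin 2 × Bool)) (hred : IsReduced L)
    (hneg : ∃ x, (x, false) ∈ L) :
    ∃ (C : Fin 2 → Set (ℚ × ℚ)) (p : ℚ), p < 0 ∧ (∀ i, (C i).Finite) ∧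
      (∀ i, ConsPairs (C i)) ∧ (∀ i, ∃ y, 0 < y ∧ (0, y) ∈ C i) ∧
      (∀ i, ∀ q ∈ C i, p ≤ q.1 ∧ p ≤ q.2 ∧ (q.1 = p → L.head? = some (i, false)) ∧
        (q.2 = p → L.head? = some (i, true))) ∧
      ∀ (x₀ : ℚ) (φ : Fin 2 → (ℚ ≃o ℚ)), (∀ i, ∀ q ∈ C i, φ i (x₀ + q.1) = x₀ + q.2) →
        FreeGroup.lift φ (mk L) x₀ = x₀ + p := by
  induction L with
  | nil => simp at hneg
  | cons a L ih =>
    by_cases hL : ∃ x, (x, false) ∈ L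
    · have hredL : IsReduced L := hred.infix ⟨[a], [], by simp⟩
      obtain ⟨C, p, hp, hfin, hcons, hup, hmin, h⟩ := ih hredL hL
      obtain ⟨i, b⟩ := a
      have hhead : L.head? ≠ some (i, !b) := by
        intro hh
        cases L with
        | nil => simp at hh
        | cons c L =>
          simp at hh
          subst hh
          have := (isReduced_cons_cons.1 hred).1 rfl
          cases b <;> simp at this
      cases b with
      | true =>
        refine ⟨Function.update C i (C i ∪ {(p, p - 1)}), p - 1, by linarith, ?_, ?_, ?_, ?_, ?_⟩
        · intro j
          by_cases hj : j = i
          · subst hj; simpa using (hfin j)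
          · simpa [hj] using hfin j
        · intro j
          by_cases hj : j = i
          · subst hj
            rw [Function.update_self, Set.union_comm]
            refine (ConsPairs.singleton _).union (hcons j) ?_
            rintro _ rfl q hq
            obtain ⟨h1, h2, h3, h4⟩ := hmin j q hq
            refine ⟨lt_of_le_of_ne h1 fun e => hhead (h3 e.symm), ?_⟩
            simp only; linarith
          · simpa [hj] using hcons j
        · intro j
          obtain ⟨y, hy, hy'⟩ := hup j
          refine ⟨y, hy, ?_⟩
          by_cases hj : j = i
          · subst hj; simp [hy']
          · simpa [hj] using hy'
        · have old : ∀ j, ∀ q ∈ C j, p - 1 < q.1 ∧ p - 1 < q.2 := fun j q hq => by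
            obtain ⟨h1, h2, -⟩ := hmin j q hq
            constructor <;> linarith
          intro j q hq
          have : q ∈ C j ∨ (j = i ∧ q = (p, p - 1)) := by
            by_cases hj : j = i
            · subst hj
              rw [Function.update_self] at hq
              rcases hq with hq | hq
              exacts [Or.inl hq, Or.inr ⟨rfl, hq⟩]
            · left; simpa [hj] using hq
          rcases this with hq | ⟨rfl, rfl⟩
          · obtain ⟨h1, h2⟩ := old j q hq
            exact ⟨h1.le, h2.le, fun e => absurd e h1.ne', fun e => absurd e h2.ne'⟩
          · refine ⟨by simp, by simp, fun e => ?_, fun e => by simp⟩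
            simp only at e; linarith
        · intro x₀ φ hφ
          rw [(lift_cons_apply φ i L x₀).1, h x₀ φ]
          · exact hφ i (p, p - 1) (by simp)
          · intro j q hq
            apply hφ j q
            by_cases hj : j = i
            · subst hj; simp [hq]
            · simpa [hj] using hq
      | false =>
        refine ⟨Function.update C i (C i ∪ {(p - 1, p)}), p - 1, by linarith, ?_, ?_, ?_, ?_, ?_⟩
        · intro j
          by_cases hj : j = i
          · subst hj; simpa using (hfin j)
          · simpa [hj] using hfin j
        · intro j
          by_cases hj : j = i
          · subst hj
            rw [Function.update_self, Set.union_comm]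
            refine (ConsPairs.singleton _).union (hcons j) ?_
            rintro _ rfl q hq
            obtain ⟨h1, h2, h3, h4⟩ := hmin j q hq
            refine ⟨?_, lt_of_le_of_ne h2 fun e => hhead (h4 e.symm)⟩
            simp only; linarith
          · simpa [hj] using hcons j
        · intro j
          obtain ⟨y, hy, hy'⟩ := hup j
          refine ⟨y, hy, ?_⟩
          by_cases hj : j = i
          · subst hj; simp [hy']
          · simpa [hj] using hy'
        · have old : ∀ j, ∀ q ∈ C j, p - 1 < q.1 ∧ p - 1 < q.2 := fun j q hq => by
            obtain ⟨h1, h2, -⟩ := hmin j q hq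
            constructor <;> linarith
          intro j q hq
          have : q ∈ C j ∨ (j = i ∧ q = (p - 1, p)) := by
            by_cases hj : j = i
            · subst hj
              rw [Function.update_self] at hq
              rcases hq with hq | hq
              exacts [Or.inl hq, Or.inr ⟨rfl, hq⟩]
            · left; simpa [hj] using hq
          rcases this with hq | ⟨rfl, rfl⟩
          · obtain ⟨h1, h2⟩ := old j q hq
            exact ⟨h1.le, h2.le, fun e => absurd e h1.ne', fun e => absurd e h2.ne'⟩
          · refine ⟨by simp, by simp, fun e => by simp, fun e => ?_⟩
            simp only at e; linarith
        · intro x₀ φ hφ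
          rw [(lift_cons_apply φ i L x₀).2, h x₀ φ]
          · rw [OrderIso.symm_apply_eq]
            exact (hφ i (p - 1, p) (by simp)).symm
          · intro j q hq
            apply hφ j q
            by_cases hj : j = i
            · subst hj; simp [hq]
            · simpa [hj] using hq
    · -- `L` is positive and `a` is negative
      have hLpos : ∀ x ∈ L, x.2 = true := by
        rintro ⟨x, b⟩ hx
        cases b
        · exact absurd ⟨x, hx⟩ hL
        · rfl
      obtain ⟨j, b⟩ := a
      obtain rfl : b = false := by
        obtain ⟨x, hx⟩ := hneg
        rcases List.mem_cons.1 hx with hx | hx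
        · exact (Prod.ext_iff.1 hx).2.symm
        · exact absurd ⟨x, hx⟩ hL
      let F : Fin 2 → ℚ → ℚ := fun i x => if i = j then x + 1 else 1 - 1 / (x + 2)
      have hFpos : ∀ i x, 0 ≤ x → 0 < F i x := by
        intro i x hx
        by_cases hi : i = j
        · simp only [F, hi, if_true]; linarith
        · simp only [F, hi, if_false]
          have : 1 / (x + 2) < 1 := by rw [div_lt_one (by linarith)]; linarith
          linarith
      have hFmono : ∀ i x y, 0 ≤ x → x < y → F i x < F i y := by
        intro i x y hx hxy
        by_cases hi : i = j
        · simp only [F, hi, if_true]; linarith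
        · simp only [F, hi, if_false]
          have : 1 / (y + 2) < 1 / (x + 2) := by
            apply one_div_lt_one_div_of_lt <;> linarith
          linarith
      obtain ⟨E, q, hE, h0, hEpos, hq, hnil, hhd, h⟩ :=
        positive_part F (fun i x hx => (hFpos i x hx).le) L hLpos
      have hq1 : q < 1 := by
        cases L with
        | nil =>
          rw [hnil rfl]
          norm_num
        | cons c L =>
          obtain ⟨i, b⟩ := c
          obtain rfl : b = true := hLpos (i, b) (by simp)
          obtain ⟨r, hr, hqr⟩ := hhd i (by simp)
          have hij : i ≠ j := by
            rintro rfl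
            have := (isReduced_cons_cons.1 hred).1 rfl
            simp at this
          rw [hqr]
          simp only [F, hij, if_false]
          have : 0 < 1 / (r + 2) := by positivity
          linarith
      let C : Fin 2 → Set (ℚ × ℚ) := fun i =>
        {x | i = j ∧ x = (-1, q)} ∪ ((fun x => (x, F i x)) '' E)
      refine ⟨C, -1, by norm_num, ?_, ?_, ?_, ?_, ?_⟩
      · intro i
        refine Set.Finite.union ((Set.finite_singleton ((-1 : ℚ), q)).subset ?_) (hE.image _)
        rintro x ⟨-, hx⟩
        exact hx
      · intro i
        refine ConsPairs.union ?_
          (consPairs_graph E (F i) fun x hx y hy hxy => hFmono i x y (hEpos x hx) hxy) ?_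
        · rintro x ⟨-, rfl⟩ y ⟨-, rfl⟩
          simp
        · rintro x ⟨rfl, rfl⟩ _ ⟨y, hy, rfl⟩
          have := hEpos y hy
          simp only [F, if_true]
          constructor <;> linarith
      · intro i
        exact ⟨F i 0, hFpos i 0 le_rfl, Or.inr ⟨0, h0, rfl⟩⟩
      · rintro i x (⟨rfl, rfl⟩ | ⟨y, hy, rfl⟩)
        · refine ⟨le_rfl, by simp only; linarith, fun _ => by simp, fun e => ?_⟩
          simp only at e; linarith
        · have h1 := hEpos y hy
          have h2 := hFpos i y h1
          refine ⟨by simp only; linarith, by simp only; linarith, fun e => ?_, fun e => ?_⟩ <;>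
          · simp only at e; linarith
      · intro x₀ φ hφ
        rw [(lift_cons_apply φ j L x₀).2, h x₀ φ]
        · rw [OrderIso.symm_apply_eq]
          exact (hφ j (-1, q) (Or.inl ⟨rfl, rfl⟩)).symm
        · intro i x hx
          exact hφ i (x, F i x) (Or.inr ⟨x, hx, rfl⟩)

open FreeGroup in
/-- A finite suffix-closed set of words acts as prescribed. -/
lemma suffix_action (T : Set (FreeGroup (Fin 2))) (pos : FreeGroup (Fin 2) → ℚ)
    (φ : Fin 2 → (ℚ ≃o ℚ))
    (hφ : ∀ i, ∀ t ∈ T, FreeGroup.of i * t ∈ T → φ i (pos t) = pos (FreeGroup.of i * t))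
    (L : List (Fin 2 × Bool)) (hL : ∀ L', L' <:+ L → mk L' ∈ T) :
    FreeGroup.lift φ (mk L) (pos 1) = pos (mk L) := by
  induction L with
  | nil => rw [← FreeGroup.one_eq_mk]; simp
  | cons a L ih =>
    have hLT : ∀ L', L' <:+ L → mk L' ∈ T := fun L' h => hL L' (h.trans (List.suffix_cons _ _))
    have ih := ih hLT
    have m1 : mk L ∈ T := hLT L List.suffix_rfl
    have m2 : mk (a :: L) ∈ T := hL _ List.suffix_rfl
    obtain ⟨i, b⟩ := a
    cases b with
    | true =>
      have e : mk ((i, true) :: L) = FreeGroup.of i * mk L := rfl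
      rw [(lift_cons_apply φ i L _).1, ih, e]
      exact hφ i _ m1 (e ▸ m2)
    | false =>
      have e : FreeGroup.of i * mk ((i, false) :: L) = mk L := by
        have : mk ((i, false) :: L) = (FreeGroup.of i)⁻¹ * mk L := rfl
        rw [this, mul_inv_cancel_left]
      rw [(lift_cons_apply φ i L _).2, ih, OrderIso.symm_apply_eq]
      rw [hφ i _ m2 (e.symm ▸ m1), e]

/-- A cone embeds in the rationals as an order. -/
lemma exists_pos (P : FreeGroup (Fin 2) → Bool) (hP : IsLeftOrderCone P) :
    ∃ pos : FreeGroup (Fin 2) → ℚ, ∀ g h, pos g < pos h ↔ P (g⁻¹ * h) = true := by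
  classical
  obtain ⟨hmul, hone, hinv⟩ := hP
  have hanti : ∀ g, P g = true → P g⁻¹ = true → False := by
    intro g h1 h2
    have := hmul _ _ h1 h2
    rw [mul_inv_cancel, hone] at this
    exact Bool.false_ne_true this
  letI : LinearOrder (FreeGroup (Fin 2)) :=
    { le := fun g h => g = h ∨ P (g⁻¹ * h) = true
      le_refl := fun g => Or.inl rfl
      le_trans := by
        rintro a b c (rfl | h1) (rfl | h2)
        · exact Or.inl rfl
        · exact Or.inr h2
        · exact Or.inr h1
        · right
          have := hmul _ _ h1 h2
          simpa [mul_assoc] using this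
      le_antisymm := by
        rintro a b (h1 | h1) (h2 | h2)
        · exact h1
        · exact h1
        · exact h2.symm
        · exact (hanti _ h1 (by simpa using h2)).elim
      le_total := by
        intro a b
        by_cases hab : a = b
        · exact Or.inl (Or.inl hab)
        · by_cases h : P (a⁻¹ * b) = true
          · exact Or.inl (Or.inr h)
          · right; right
            have hne : b⁻¹ * a ≠ 1 := fun e => hab (inv_mul_eq_one.1 e).symm
            rw [hinv _ hne]
            simpa using h
      toDecidableLE := Classical.decRel _ }
  obtain ⟨e⟩ := Order.embedding_from_countable_to_dense (FreeGroup (Fin 2)) ℚ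
  refine ⟨e, fun g h => ?_⟩
  rw [e.lt_iff_lt, lt_iff_le_and_ne]
  constructor
  · rintro ⟨h1 | h1, h2⟩
    · exact absurd h1 h2
    · exact h1
  · intro h1
    refine ⟨Or.inr h1, ?_⟩
    rintro rfl
    rw [inv_mul_cancel, hone] at h1
    exact Bool.false_ne_true h1

/-- The cone induced by an action, ties being broken by a given cone. -/
noncomputable def inducedCone {Γ : Type*} [Group Γ] (Φ : Γ →* (ℚ ≃o ℚ)) (o : ℚ)
    (P : Γ → Bool) : Γ → Bool :=
  fun g => decide (o < Φ g o) || (decide (Φ g o = o) && P g)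

lemma inducedCone_iff {Γ : Type*} [Group Γ] (Φ : Γ →* (ℚ ≃o ℚ)) (o : ℚ) (P : Γ → Bool) (g : Γ) :
    inducedCone Φ o P g = true ↔ o < Φ g o ∨ (Φ g o = o ∧ P g = true) := by
  simp [inducedCone]

lemma inducedCone_isCone {Γ : Type*} [Group Γ] (Φ : Γ →* (ℚ ≃o ℚ)) (o : ℚ) (P : Γ → Bool)
    (hP : IsLeftOrderCone P) : IsLeftOrderCone (inducedCone Φ o P) := by
  obtain ⟨hmul, hone, hinv⟩ := hP
  have happ : ∀ g h : Γ, Φ (g * h) o = Φ g (Φ h o) := fun g h => by rw [map_mul]; rfl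
  refine ⟨?_, ?_, ?_⟩
  · intro a b ha hb
    rw [inducedCone_iff] at ha hb ⊢
    rw [happ]
    rcases hb with hb | ⟨hb, hb'⟩
    · left
      have h1 : Φ a o < Φ a (Φ b o) := (Φ a).lt_iff_lt.2 hb
      rcases ha with ha | ⟨ha, -⟩
      · exact ha.trans h1
      · rwa [ha] at h1
    · rw [hb]
      rcases ha with ha | ⟨ha, ha'⟩
      · exact Or.inl ha
      · exact Or.inr ⟨ha, hmul _ _ ha' hb'⟩
  · rw [← Bool.not_eq_true, inducedCone_iff, map_one]
    simp [hone]
  · intro g hg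
    rw [← Bool.not_eq_true, inducedCone_iff, inducedCone_iff, not_or, not_and]
    have hinv' : Φ g⁻¹ o = (Φ g).symm o := by rw [map_inv]; rfl
    have h1 : o < (Φ g).symm o ↔ Φ g o < o := (Φ g).lt_symm_apply
    have h2 : (Φ g).symm o = o ↔ Φ g o = o := by
      rw [OrderIso.symm_apply_eq]; exact eq_comm
    rw [hinv', h1, h2, Bool.not_eq_true, ← hinv g hg]
    constructor
    · rintro (h | ⟨h, h'⟩)
      · exact ⟨h.not_gt, fun e => absurd e h.ne'⟩
      · exact ⟨by rw [h]; exact lt_irrefl _, fun _ => h'⟩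
    · rintro ⟨h, h'⟩
      rcases (not_lt.1 h).lt_or_eq with h | h
      · exact Or.inl h
      · exact Or.inr ⟨h.symm, h' h.symm⟩

lemma ConsPairs.shift {G : Set (ℚ × ℚ)} (hG : ConsPairs G) (c : ℚ) :
    ConsPairs ((fun p => (c + p.1, c + p.2)) '' G) := by
  rintro _ ⟨x, hx, rfl⟩ _ ⟨y, hy, rfl⟩
  simpa using hG x hx y hy

/-- The key perturbation step. -/
lemma perturb (P : FreeGroup (Fin 2) → Bool) (hP : IsLeftOrderCone P)
    (S : Finset (FreeGroup (Fin 2))) (w : FreeGroup (Fin 2))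
    (hw : ∃ x, (x, false) ∈ w.toWord) :
    ∃ Q : FreeGroup (Fin 2) → Bool, IsLeftOrderCone Q ∧ (∀ s ∈ S, Q s = P s) ∧
      ¬ IsWOrder w Q := by
  classical
  obtain ⟨pos, hpos⟩ := exists_pos P hP
  have hposinj : ∀ g h, pos g = pos h → g = h := by
    intro g h e
    by_contra hne
    have hne' : g⁻¹ * h ≠ 1 := fun e => hne (inv_mul_eq_one.1 e)
    have h1 := (hpos g h).not.1 e.not_lt
    have h2 := (hpos h g).not.1 e.symm.not_lt
    have := hP.2.2 _ hne'
    simp at this h1 h2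
    simp [h1, h2] at this
  have hposmul : ∀ k g h, pos (k * g) < pos (k * h) ↔ pos g < pos h := by
    intro k g h
    rw [hpos, hpos]
    simp [mul_assoc]
  -- the suffix-closed set
  let T : Set (FreeGroup (Fin 2)) :=
    ⋃ s ∈ insert 1 S, (fun L' => FreeGroup.mk L') '' {L' | L' <:+ s.toWord}
  have hTfin : T.Finite := by
    refine Set.Finite.biUnion (Finset.finite_toSet _) fun s _ => Set.Finite.image _ ?_
    refine (s.toWord.tails.finite_toSet).subset ?_
    intro L' hL'
    simpa using hL'
  have hTsuff : ∀ t ∈ T, ∃ L, FreeGroup.mk L = t ∧ ∀ L', L' <:+ L → FreeGroup.mk L' ∈ T := by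
    intro t ht
    simp only [T, Set.mem_iUnion] at ht
    obtain ⟨s, hs, L, hL, rfl⟩ := ht
    refine ⟨L, rfl, fun L' hL' => ?_⟩
    simp only [T, Set.mem_iUnion]
    exact ⟨s, hs, L', hL'.trans hL, rfl⟩
  have hST : ∀ s ∈ S, s ∈ T := by
    intro s hs
    simp only [T, Set.mem_iUnion]
    exact ⟨s, Finset.mem_insert_of_mem hs, s.toWord, List.suffix_rfl, FreeGroup.mk_toWord⟩
  have h1T : (1 : FreeGroup (Fin 2)) ∈ T := by
    simp only [T, Set.mem_iUnion]
    exact ⟨1, Finset.mem_insert_self _ _, [], List.nil_suffix, FreeGroup.one_eq_mk.symm⟩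
  obtain ⟨M, hMT, hM⟩ := Set.exists_max_image T pos hTfin ⟨1, h1T⟩
  -- the letter moving `M` up
  obtain ⟨l, hl, hlM⟩ : ∃ l : FreeGroup (Fin 2),
      (l = FreeGroup.of 0 ∨ l = (FreeGroup.of 0)⁻¹) ∧ pos M < pos (l * M) := by
    rcases lt_trichotomy (pos M) (pos (FreeGroup.of 0 * M)) with h | h | h
    · exact ⟨_, Or.inl rfl, h⟩
    · have := hposinj _ _ h
      have h' : FreeGroup.of (0 : Fin 2) = 1 := by simpa using this
      exact absurd h' (FreeGroup.of_ne_one _)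
    · refine ⟨_, Or.inr rfl, ?_⟩
      rw [← hposmul (FreeGroup.of 0)]
      simpa using h
  have hlMT : l * M ∉ T := fun h => absurd (hM _ h) hlM.not_ge
  set m := pos M with hm
  -- the configuration for the word
  obtain ⟨C, p, hp, hCfin, hCcons, hCup, -, hCw⟩ :=
    word_config w.toWord FreeGroup.isReduced_toWord hw
  rw [FreeGroup.mk_toWord] at hCw
  let V : Set ℚ := ⋃ i, (Prod.fst '' C i ∪ Prod.snd '' C i)
  have hVfin : V.Finite := Set.finite_iUnion fun i => ((hCfin i).image _).union ((hCfin i).image _)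
  obtain ⟨R, hR⟩ : ∃ R : ℚ, ∀ v ∈ V, |v| < R := by
    obtain ⟨R, hR⟩ := (hVfin.image fun v => |v|).bddAbove
    exact ⟨R + 1, fun v hv => lt_of_le_of_lt (hR ⟨v, hv, rfl⟩) (by linarith)⟩
  have hV1 : ∀ i, ∀ q ∈ C i, q.1 ∈ V := fun i q hq =>
    Set.mem_iUnion.2 ⟨i, Or.inl ⟨q, hq, rfl⟩⟩
  have hV2 : ∀ i, ∀ q ∈ C i, q.2 ∈ V := fun i q hq =>
    Set.mem_iUnion.2 ⟨i, Or.inr ⟨q, hq, rfl⟩⟩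
  have hV0 : (0 : ℚ) ∈ V := by
    obtain ⟨y, -, hy⟩ := hCup 0
    exact hV1 0 _ hy
  have hRpos : 0 < R := by simpa using hR 0 hV0
  let D : ℚ := 2 * R
  let x₀ : ℚ := m + D
  -- the graph for `l`
  let Y : Set ℚ := {m} ∪ ((fun v => x₀ + v) '' V ∪ (fun v => x₀ + D + v) '' V)
  have hYfin : Y.Finite := (Set.finite_singleton _).union ((hVfin.image _).union (hVfin.image _))
  have hYm : ∀ y ∈ Y, m ≤ y := by
    rintro y (rfl | ⟨v, hv, rfl⟩ | ⟨v, hv, rfl⟩)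
    · exact le_rfl
    all_goals
      have := (abs_lt.1 (hR v hv)).1
      simp only [x₀, D]
      linarith
  let Gl (k : FreeGroup (Fin 2)) : Set (ℚ × ℚ) :=
    (fun t => (pos t, pos (k * t))) '' {t | t ∈ T ∧ k * t ∈ T}
  have hGlfin : ∀ k, (Gl k).Finite := fun k => (hTfin.subset fun t ht => ht.1).image _
  have hGlcons : ∀ k, ConsPairs (Gl k) := by
    rintro k _ ⟨t, ht, rfl⟩ _ ⟨t', ht', rfl⟩
    exact (hposmul k t t').symm
  have hGlle : ∀ k, ∀ q ∈ Gl k, q.1 ≤ m ∧ q.2 ≤ m := by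
    rintro k _ ⟨t, ht, rfl⟩
    exact ⟨hM _ ht.1, hM _ ht.2⟩
  obtain ⟨A, hA⟩ : ∃ A : ℚ ≃o ℚ, ∀ q ∈ Gl l ∪ (fun y => (y, y + D)) '' Y, A q.1 = q.2 := by
    refine ConsPairs.exists_orderIso ((hGlfin l).union (hYfin.image _)) ?_
    refine (hGlcons l).union (consPairs_graph Y (fun y => y + D) ?_) ?_
    · intro x _ y _ h
      simpa using h
    · rintro _ ⟨t, ht, rfl⟩ _ ⟨y, hy, rfl⟩
      have h1 := hYm y hy
      have h2 := hM _ ht.1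
      have h3 := hM _ ht.2
      have h4 : pos t ≠ m := by
        intro e
        have := hposinj _ _ e
        subst this
        exact hlMT ht.2
      have h5 := lt_of_le_of_ne h2 h4
      simp only [D]
      constructor <;> linarith
  obtain ⟨B, hB⟩ : ∃ B : ℚ ≃o ℚ, ∀ q ∈ Gl (FreeGroup.of 1) ∪
      ((fun q : ℚ × ℚ => (x₀ + D + q.1, x₀ + D + q.2)) '' C 0 ∪
        (fun q : ℚ × ℚ => (x₀ + D + D + q.1, x₀ + D + D + q.2)) '' C 1), B q.1 = q.2 := by
    refine ConsPairs.exists_orderIso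
      ((hGlfin _).union (((hCfin 0).image _).union ((hCfin 1).image _))) ?_
    refine (hGlcons _).union (((hCcons 0).shift _).union ((hCcons 1).shift _) ?_) ?_
    · rintro _ ⟨q, hq, rfl⟩ _ ⟨r, hr, rfl⟩
      have h1 := abs_lt.1 (hR _ (hV1 0 q hq))
      have h2 := abs_lt.1 (hR _ (hV2 0 q hq))
      have h3 := abs_lt.1 (hR _ (hV1 1 r hr))
      have h4 := abs_lt.1 (hR _ (hV2 1 r hr))
      simp only [D]
      constructor <;> linarith
    · rintro q hq r hr
      obtain ⟨h1, h2⟩ := hGlle _ q hq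
      rcases hr with ⟨r, hr, rfl⟩ | ⟨r, hr, rfl⟩
      · have h3 := abs_lt.1 (hR _ (hV1 0 r hr))
        have h4 := abs_lt.1 (hR _ (hV2 0 r hr))
        simp only [x₀, D]
        constructor <;> linarith
      · have h3 := abs_lt.1 (hR _ (hV1 1 r hr))
        have h4 := abs_lt.1 (hR _ (hV2 1 r hr))
        simp only [x₀, D]
        constructor <;> linarith
  -- the action
  obtain ⟨φ, hφl, hφ1, hφT⟩ : ∃ φ : Fin 2 → (ℚ ≃o ℚ), FreeGroup.lift φ l = A ∧ φ 1 = B ∧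
      ∀ i, ∀ t ∈ T, FreeGroup.of i * t ∈ T → φ i (pos t) = pos (FreeGroup.of i * t) := by
    have hBT : ∀ t ∈ T, FreeGroup.of 1 * t ∈ T → B (pos t) = pos (FreeGroup.of 1 * t) :=
      fun t ht ht' => hB (pos t, pos (FreeGroup.of 1 * t)) (Or.inl ⟨t, ⟨ht, ht'⟩, rfl⟩)
    have hAT : ∀ t ∈ T, l * t ∈ T → A (pos t) = pos (l * t) :=
      fun t ht ht' => hA (pos t, pos (l * t)) (Or.inl ⟨t, ⟨ht, ht'⟩, rfl⟩)
    rcases hl with rfl | rfl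
    · refine ⟨![A, B], by simp, by simp, ?_⟩
      rw [Fin.forall_fin_two]
      exact ⟨hAT, hBT⟩
    · refine ⟨![A⁻¹, B], by simp, by simp, ?_⟩
      rw [Fin.forall_fin_two]
      refine ⟨fun t ht ht' => ?_, hBT⟩
      have := hAT _ ht' (by simpa using ht)
      rw [inv_mul_cancel_left] at this
      change A.symm (pos t) = _
      rw [OrderIso.symm_apply_eq, this]
  let Φ : FreeGroup (Fin 2) →* (ℚ ≃o ℚ) := FreeGroup.lift φ
  have hΦT : ∀ t ∈ T, Φ t (pos 1) = pos t := by
    intro t ht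
    obtain ⟨L, rfl, hL⟩ := hTsuff t ht
    exact suffix_action T pos φ hφT L hL
  refine ⟨inducedCone Φ (pos 1) P, inducedCone_isCone Φ _ P hP, ?_, ?_⟩
  · intro s hs
    rw [Bool.eq_iff_iff, inducedCone_iff, hΦT s (hST s hs), hpos]
    simp only [inv_one, one_mul]
    constructor
    · rintro (h | ⟨-, h⟩) <;> exact h
    · exact Or.inl
  · intro hW
    have happ : ∀ (g h : FreeGroup (Fin 2)) x, Φ (g * h) x = Φ g (Φ h x) := fun g h x => by
      rw [map_mul]; rfl
    have hYA : ∀ y ∈ Y, Φ l y = y + D := by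
      intro y hy
      have : Φ l = A := hφl
      rw [this]
      exact hA (y, y + D) (Or.inr ⟨y, hy, rfl⟩)
    have hYA' : ∀ y ∈ Y, Φ l⁻¹ (y + D) = y := by
      intro y hy
      rw [← hYA y hy, ← happ, inv_mul_cancel, map_one]; rfl
    have hΦ1 : Φ (FreeGroup.of 1) = B := by simp [Φ, hφ1]
    let k := l * M
    have hk : Φ k (pos 1) = x₀ := by
      rw [happ, hΦT M hMT]
      exact hYA m (Or.inl rfl)
    let f' := l⁻¹ * (FreeGroup.of 1 * l)
    let g' := l⁻¹ * (l⁻¹ * (FreeGroup.of 1 * (l * l)))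
    have hYV0 : ∀ v ∈ V, x₀ + v ∈ Y := fun v hv => Or.inr (Or.inl ⟨v, hv, rfl⟩)
    have hYV1 : ∀ v ∈ V, x₀ + D + v ∈ Y := fun v hv => Or.inr (Or.inr ⟨v, hv, rfl⟩)
    have hf' : ∀ q ∈ C 0, Φ f' (x₀ + q.1) = x₀ + q.2 := by
      intro q hq
      have e1 : x₀ + q.1 + D = x₀ + D + q.1 := by ring
      have e2 : x₀ + D + q.2 = x₀ + q.2 + D := by ring
      rw [happ, happ, hYA _ (hYV0 _ (hV1 0 q hq)), e1, hΦ1,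
        hB (x₀ + D + q.1, x₀ + D + q.2) (Or.inr (Or.inl ⟨q, hq, rfl⟩))]
      simp only
      rw [e2, hYA' _ (hYV0 _ (hV2 0 q hq))]
    have hg' : ∀ q ∈ C 1, Φ g' (x₀ + q.1) = x₀ + q.2 := by
      intro q hq
      have e1 : x₀ + q.1 + D = x₀ + D + q.1 := by ring
      have e2 : x₀ + D + q.1 + D = x₀ + D + D + q.1 := by ring
      have e3 : x₀ + D + D + q.2 = x₀ + D + q.2 + D := by ring
      have e4 : x₀ + D + q.2 = x₀ + q.2 + D := by ring
      rw [happ, happ, happ, happ, hYA _ (hYV0 _ (hV1 1 q hq)), e1, hYA _ (hYV1 _ (hV1 1 q hq)), e2,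
        hΦ1, hB (x₀ + D + D + q.1, x₀ + D + D + q.2) (Or.inr (Or.inr ⟨q, hq, rfl⟩))]
      simp only
      rw [e3, hYA' _ (hYV1 _ (hV2 1 q hq)), e4, hYA' _ (hYV0 _ (hV2 1 q hq))]
    have hconj : ∀ h, Φ (k⁻¹ * h * k) (pos 1) = (Φ k).symm (Φ h x₀) := by
      intro h
      rw [happ, happ, hk, map_inv]; rfl
    have hpos1 : pos 1 = (Φ k).symm x₀ := by rw [← hk, OrderIso.symm_apply_apply]
    have hcone : ∀ h, x₀ < Φ h x₀ → inducedCone Φ (pos 1) P (k⁻¹ * h * k) = true := by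
      intro h hh
      rw [inducedCone_iff, hconj]
      left
      rw [hpos1]
      exact (Φ k).symm.lt_iff_lt.2 hh
    have hfc : inducedCone Φ (pos 1) P (k⁻¹ * f' * k) = true := by
      obtain ⟨y, hy, hy'⟩ := hCup 0
      have := hf' _ hy'
      simp only [add_zero] at this
      apply hcone
      rw [this]; linarith
    have hgc : inducedCone Φ (pos 1) P (k⁻¹ * g' * k) = true := by
      obtain ⟨y, hy, hy'⟩ := hCup 1
      have := hg' _ hy'
      simp only [add_zero] at this
      apply hcone
      rw [this]; linarith
    have hwc := hW _ _ hfc hgc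
    have hlw : FreeGroup.lift ![k⁻¹ * f' * k, k⁻¹ * g' * k] w
        = k⁻¹ * FreeGroup.lift ![f', g'] w * k := by
      have : FreeGroup.lift ![k⁻¹ * f' * k, k⁻¹ * g' * k]
          = (MulAut.conj k⁻¹).toMonoidHom.comp (FreeGroup.lift ![f', g']) := by
        ext i
        fin_cases i <;> simp
      rw [this]
      simp
    have hΦw : Φ (FreeGroup.lift ![f', g'] w) = FreeGroup.lift ![Φ f', Φ g'] w := by
      have : FreeGroup.lift ![Φ f', Φ g'] = Φ.comp (FreeGroup.lift ![f', g']) := by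
        apply FreeGroup.ext_hom
        intro i
        fin_cases i <;> simp
      rw [this]; rfl
    have hval := hCw x₀ ![Φ f', Φ g'] (by
      rw [Fin.forall_fin_two]
      exact ⟨hf', hg'⟩)
    rw [hlw, inducedCone_iff, hconj, hΦw, hval] at hwc
    have hlt : (Φ k).symm (x₀ + p) < pos 1 := by
      rw [hpos1]
      exact (Φ k).symm.lt_iff_lt.2 (by linarith)
    rcases hwc with h | ⟨h, -⟩
    · exact absurd h hlt.not_gt
    · exact absurd h hlt.ne

lemma isClosed_cones : IsClosed {P : FreeGroup (Fin 2) → Bool | IsLeftOrderCone P} := by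
  have hcl : ∀ (g : FreeGroup (Fin 2)) (b : Bool),
      IsClopen {P : FreeGroup (Fin 2) → Bool | P g = b} := fun g b =>
    (isClopen_discrete ({b} : Set Bool)).preimage (continuous_apply g)
  have e : {P : FreeGroup (Fin 2) → Bool | IsLeftOrderCone P} =
      (⋂ a, ⋂ b, ({P : FreeGroup (Fin 2) → Bool | P a = true}ᶜ ∪
        ({P : FreeGroup (Fin 2) → Bool | P b = true}ᶜ ∪ {P | P (a * b) = true}))) ∩
      ({P | P 1 = false} ∩ ⋂ g, ⋂ (_ : g ≠ 1),
        (({P : FreeGroup (Fin 2) → Bool | P g = true} ∩ {P | P g⁻¹ = false}) ∪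
        ({P : FreeGroup (Fin 2) → Bool | P g = true}ᶜ ∩ {P | P g⁻¹ = false}ᶜ))) := by
    ext P
    simp only [IsLeftOrderCone, Set.mem_setOf_eq, Set.mem_inter_iff, Set.mem_iInter,
      Set.mem_union, Set.mem_compl_iff, iff_iff_and_or_not_and_not, imp_iff_not_or]
  rw [e]
  refine IsClosed.inter ?_ (IsClosed.inter (hcl _ _).1 ?_)
  · exact isClosed_iInter fun a => isClosed_iInter fun b =>
      ((hcl _ _).compl.union ((hcl _ _).compl.union (hcl _ _))).1
  · exact isClosed_iInter fun g => isClosed_iInter fun _ =>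
      (((hcl _ _).inter (hcl _ _)).union ((hcl _ _).compl.inter (hcl _ _).compl)).1

instance : CompactSpace LOF2 := isCompact_iff_compactSpace.1 isClosed_cones.isCompact

instance : T2Space LOF2 :=
  inferInstanceAs (T2Space {P : FreeGroup (Fin 2) → Bool // IsLeftOrderCone P})

lemma isOpen_notW (w : FreeGroup (Fin 2)) : IsOpen {P : LOF2 | ¬ IsWOrder w P.1} := by
  have hcl : ∀ (g : FreeGroup (Fin 2)) (b : Bool),
      IsOpen {P : LOF2 | P.1 g = b} := fun g b =>
    (isOpen_discrete ({b} : Set Bool)).preimage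
      ((continuous_apply g).comp (continuous_subtype_val : Continuous
        (Subtype.val : {P : FreeGroup (Fin 2) → Bool // IsLeftOrderCone P} → _)))
  have e : {P : LOF2 | ¬ IsWOrder w P.1} = ⋃ f, ⋃ g, ({P : LOF2 | P.1 f = true} ∩
      ({P : LOF2 | P.1 g = true} ∩ {P : LOF2 | P.1 (FreeGroup.lift ![f, g] w) = false})) := by
    ext P
    simp [IsWOrder]
  rw [e]
  exact isOpen_iUnion fun f => isOpen_iUnion fun g =>
    (hcl _ _).inter ((hcl _ _).inter (hcl _ _))

lemma dense_notW (w : FreeGroup (Fin 2)) (hw : HasBothSigns w) :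
    Dense {P : LOF2 | ¬ IsWOrder w P.1} := by
  rw [dense_iff_inter_open]
  rintro U hU ⟨P, hPU⟩
  obtain ⟨V, hV, rfl⟩ := isOpen_induced_iff.1 hU
  obtain ⟨I, u, hu, hsub⟩ := isOpen_pi_iff.1 hV P.1 hPU
  obtain ⟨Q, hQ, hQS, hQw⟩ := perturb P.1 P.2 I w hw.2
  refine ⟨⟨Q, hQ⟩, hsub ?_, hQw⟩
  intro s hs
  change Q s ∈ u s
  rw [hQS s hs]
  exact (hu s hs).2

/-- **Theorem C.** The set of left-orders on `F₂` satisfying no verbal property — i.e.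
those that are not `W`-orders for any nonempty reduced word `W` carrying both positive
and negative exponents — is a dense `G_δ` subset of the space of left-orders of `F₂`. -/
theorem no_verbal_property_dense_Gdelta :
    IsGδ {P : LOF2 | ∀ w : FreeGroup (Fin 2), w ≠ 1 → HasBothSigns w → ¬ IsWOrder w P.1} ∧
    Dense {P : LOF2 | ∀ w : FreeGroup (Fin 2), w ≠ 1 → HasBothSigns w → ¬ IsWOrder w P.1} := by
  have e : {P : LOF2 | ∀ w : FreeGroup (Fin 2), w ≠ 1 → HasBothSigns w → ¬ IsWOrder w P.1} =
      ⋂ w ∈ {w : FreeGroup (Fin 2) | w ≠ 1 ∧ HasBothSigns w}, {P : LOF2 | ¬ IsWOrder w P.1} := by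
    ext P
    simp
  rw [e]
  have hc : {w : FreeGroup (Fin 2) | w ≠ 1 ∧ HasBothSigns w}.Countable := Set.to_countable _
  exact ⟨IsGδ.biInter_of_isOpen hc fun w _ => isOpen_notW w,
    dense_biInter_of_isOpen (fun w _ => isOpen_notW w) hc fun w hw => dense_notW w hw.2⟩
end
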